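/- arXiv:1305.6957 — 2 statements merged into one kernel-verified Lean document; each statement's English description precedes it below -/
import Mathlib

section
/- The open Waring rank of ternary cubics satisfies Ork(3, 3) = 5. -/
open MvPolynomial

noncomputable section WaringSetup

variable {k : Type} [Field k] {n : ℕ}

/-- The linear form `∑ aᵢ xᵢ` with coefficient vector `a`. -/
def linForm (a : Fin n → k) : MvPolynomial (Fin n) k :=
  ∑ i, C (a i) * X i

/-- A subset of the space `S₁` of linear forms (identified with the space of coefficient
vectors) is homogeneous Zariski closed if it is the common zero locus of a set of
homogeneous polynomial functions. -/
def HomZariskiClosed (V : Set (Fin n → k)) : Prop :=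
  ∃ P : Set (MvPolynomial (Fin n) k),
    (∀ p ∈ P, ∃ e : ℕ, p.IsHomogeneous e) ∧
    V = {a | ∀ p ∈ P, eval a p = 0}

/-- `F` can be written as a polynomial in `m` linear forms. -/
def WritableIn (m : ℕ) (F : MvPolynomial (Fin n) k) : Prop :=
  ∃ y : Fin m → MvPolynomial (Fin n) k,
    (∀ j, (y j).IsHomogeneous 1) ∧ ∃ G : MvPolynomial (Fin m) k, F = aeval y G

/-- `F` essentially depends on `n` variables: after any linear change of coordinates it
cannot be written using fewer than `n` variables. -/
def EssDep (F : MvPolynomial (Fin n) k) : Prop :=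
  ∀ m : ℕ, m < n → ¬ WritableIn m F

/-- `OrkV d F V` is the minimal number `m` such that `F` is a sum of `m` `d`-th powers of
linear forms lying outside `V` (and `⊤` if there is no such presentation). -/
def OrkV (d : ℕ) (F : MvPolynomial (Fin n) k) (V : Set (Fin n → k)) : ℕ∞ :=
  sInf ((fun m : ℕ => (m : ℕ∞)) ''
    {m : ℕ | ∃ l : Fin m → (Fin n → k), (∀ i, l i ∉ V) ∧ F = ∑ i, linForm (l i) ^ d})

/-- The open Waring rank of a form `F`: the supremum of `OrkV d F V` over all homogeneous
Zariski-closed proper subsets `V ⊊ S₁`. -/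
def Ork (d : ℕ) (F : MvPolynomial (Fin n) k) : ℕ∞ :=
  ⨆ V : {V : Set (Fin n → k) // HomZariskiClosed V ∧ V ≠ Set.univ}, OrkV d F V.1

/-- The open Waring rank `Ork(n, d)`: the supremum of `Ork F` over all forms `F` of degree
`d` essentially depending on `n` variables. -/
def OrkND (k : Type) [Field k] (n d : ℕ) : ℕ∞ :=
  ⨆ F : {F : MvPolynomial (Fin n) k // F.IsHomogeneous d ∧ EssDep F}, Ork d F.1

/-- Apply the constant-coefficient differential operator `D` (a polynomial, whose variable
`i` is read as `∂/∂xᵢ`) to the polynomial `F`. -/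
def contract (D F : MvPolynomial (Fin n) k) : MvPolynomial (Fin n) k :=
  ∑ s ∈ D.support, D.coeff s •
    ((List.finRange n).foldr (fun i G => (fun H => pderiv i H)^[s i] G) F)

/-- Polynomial functions on the affine space of polynomials: the subalgebra of functions
generated by the coefficient functionals. -/
def PolyFun (n : ℕ) (k : Type) [Field k] : Subalgebra k (MvPolynomial (Fin n) k → k) :=
  Algebra.adjoin k (Set.range fun s : Fin n →₀ ℕ => fun F => coeff s F)

end WaringSetup

/-- A functional vanishing on the common kernel of two functionals is a combination. -/
theorem comb_two {k E : Type*} [Field k] [AddCommGroup E] [Module k E] (f g h : E →ₗ[k] k)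
    (H : ∀ x, f x = 0 → g x = 0 → h x = 0) : ∃ u v : k, ∀ x, h x = u * f x + v * g x := by
  have h1 : h ∈ Submodule.span k (Set.range ![f, g]) := by
    apply mem_span_of_iInf_ker_le_ker
    intro x hx
    simp only [Submodule.mem_iInf, LinearMap.mem_ker] at hx
    exact H x (by simpa using hx 0) (by simpa using hx 1)
  rw [Submodule.mem_span_range_iff_exists_fun] at h1
  obtain ⟨c, hc⟩ := h1
  refine ⟨c 0, c 1, fun x => ?_⟩
  rw [← hc]
  simp [Fin.sum_univ_two]

theorem comb_three {k E : Type*} [Field k] [AddCommGroup E] [Module k E] (f : Fin 3 → E →ₗ[k] k)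
    (h : E →ₗ[k] k)
    (H : ∀ x, (∀ i, f i x = 0) → h x = 0) : ∃ u : Fin 3 → k, ∀ x, h x = ∑ i, u i * f i x := by
  have h1 : h ∈ Submodule.span k (Set.range f) := by
    apply mem_span_of_iInf_ker_le_ker
    intro x hx
    simp only [Submodule.mem_iInf, LinearMap.mem_ker] at hx
    exact H x hx
  rw [Submodule.mem_span_range_iff_exists_fun] at h1
  obtain ⟨c, hc⟩ := h1
  refine ⟨c, fun x => ?_⟩
  rw [← hc]
  simp

/-- Sylvester-type lemma. -/
theorem sylvester {k : Type} [Field k] [IsAlgClosed k] [CharZero k]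
    (Φ : Polynomial k →ₗ[k] k)
    (hΦ : ∀ p : Polynomial k, p.degree < 3 →
      (∀ h : Polynomial k, h.degree < 5 → Φ (p * h) = 0) → p = 0)
    (b : Polynomial k) (hb : b ≠ 0) :
    ∃ (s : Finset k) (c : k → k), s.card = 5 ∧ (∀ t ∈ s, b.eval t ≠ 0) ∧
      ∀ h : Polynomial k, h.degree < 7 → Φ h = ∑ t ∈ s, c t * h.eval t := by
  classical
  let ΦX : Polynomial k →ₗ[k] k := Φ ∘ₗ LinearMap.mulLeft k Polynomial.X
  have hΦX : ∀ g, ΦX g = Φ (Polynomial.X * g) := fun g => rfl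
  let L : Submodule k (Polynomial k) :=
    Polynomial.degreeLT k 6 ⊓ (LinearMap.ker Φ ⊓ LinearMap.ker ΦX)
  have memL : ∀ g, g ∈ L ↔ g.degree < 6 ∧ Φ g = 0 ∧ Φ (Polynomial.X * g) = 0 := by
    intro g
    simp only [L, Submodule.mem_inf, LinearMap.mem_ker, hΦX]
    rw [Polynomial.mem_degreeLT]
    norm_num
  -- general base point freeness
  have key : ∀ ℓ : Polynomial k →ₗ[k] k, (∀ x ∈ L, ℓ x = 0) →
      ∃ u v : k, ∀ x : Polynomial k, x.degree < 6 → ℓ x = Φ ((Polynomial.C u + Polynomial.C v * Polynomial.X) * x) := by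
    intro ℓ hℓ
    obtain ⟨u, v, huv⟩ := comb_two (Φ ∘ₗ (Polynomial.degreeLT k 6).subtype)
      (ΦX ∘ₗ (Polynomial.degreeLT k 6).subtype) (ℓ ∘ₗ (Polynomial.degreeLT k 6).subtype) (by
        intro x h1 h2
        exact hℓ x ⟨x.2, h1, h2⟩)
    refine ⟨u, v, fun x hx => ?_⟩
    have := huv ⟨x, by rw [Polynomial.mem_degreeLT]; exact_mod_cast hx⟩
    simp only [LinearMap.comp_apply, Submodule.subtype_apply, hΦX] at this
    rw [this, add_mul, map_add, mul_assoc, ← Polynomial.smul_eq_C_mul, ← Polynomial.smul_eq_C_mul]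
    simp
  have deg2 : ∀ (u v : k), (Polynomial.C u + Polynomial.C v * Polynomial.X).degree ≤ 1 := by
    intro u v; rw [add_comm]; exact Polynomial.degree_linear_le
  have bpf : ∀ β : k, ∃ g ∈ L, g.eval β ≠ 0 := by
    intro β
    by_contra hcon
    push Not at hcon
    obtain ⟨u, v, huv⟩ := key (Polynomial.leval β) (fun x hx => hcon x hx)
    have h0 := hΦ ((Polynomial.C u + Polynomial.C v * Polynomial.X) * (Polynomial.X - Polynomial.C β)) (by
        rw [Polynomial.degree_mul, Polynomial.degree_X_sub_C]
        calc _ ≤ (1 : WithBot ℕ) + 1 := by gcongr; exact deg2 u v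
          _ < 3 := by norm_num) (by
        intro h hh
        rw [mul_assoc, ← huv]
        · simp [Polynomial.leval]
        · rw [Polynomial.degree_mul, Polynomial.degree_X_sub_C]
          by_cases h0 : h = 0
          · rw [h0]; simp; exact WithBot.bot_lt_coe 6
          · rw [Polynomial.degree_eq_natDegree h0] at hh ⊢
            have : h.natDegree < 5 := by exact_mod_cast hh
            have : 1 + h.natDegree < 6 := by omega
            exact_mod_cast this)
    have h1 : (Polynomial.C u + Polynomial.C v * Polynomial.X) = 0 :=
      (mul_eq_zero.1 h0).resolve_right (Polynomial.X_sub_C_ne_zero β)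
    have h2 := huv 1 (by simp)
    rw [h1] at h2
    simp [Polynomial.leval] at h2
  have bpi : ∃ g ∈ L, g.coeff 5 ≠ 0 := by
    by_contra hcon
    push Not at hcon
    obtain ⟨u, v, huv⟩ := key (Polynomial.lcoeff k 5) (fun x hx => hcon x hx)
    have h0 := hΦ ((Polynomial.C u + Polynomial.C v * Polynomial.X)) ((deg2 u v).trans_lt (by norm_num)) (by
        intro h hh
        rw [← huv]
        · simp only [Polynomial.lcoeff_apply]
          exact Polynomial.coeff_eq_zero_of_degree_lt (by exact_mod_cast hh)
        · exact hh.trans (by norm_num))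
    have h2 := huv (Polynomial.X ^ 5) (by simp; decide)
    rw [h0] at h2
    simp at h2
  obtain ⟨g0, hg0L, hg0⟩ := bpi
  have hg00 : g0 ≠ 0 := by rintro rfl; simp at hg0
  obtain ⟨g1, hg1L, hg1⟩ := Module.Dual.exists_forall_mem_ne_zero_of_forall_exists L
    (fun β : g0.roots.toFinset => Polynomial.leval (β : k)) (fun β => bpf β)
  have cop : ∀ β, g0.eval β = 0 → g1.eval β ≠ 0 := by
    intro β h
    exact hg1 ⟨β, by simp [hg00, h]⟩
  have hcop : IsCoprime g0 g1 := by
    rw [Polynomial.isCoprime_iff_aeval_ne_zero_of_isAlgClosed k k]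
    intro a
    by_cases h : g0.eval a = 0
    · right; simpa using cop a h
    · left; simpa using h
  set W := Polynomial.derivative g0 * g1 - g0 * Polynomial.derivative g1 with hW
  have hW0 : W ≠ 0 := by
    intro h
    have h1 : g0 ∣ Polynomial.derivative g0 * g1 := ⟨Polynomial.derivative g1, sub_eq_zero.1 h⟩
    have h2 := hcop.dvd_of_dvd_mul_right h1
    have h3 : Polynomial.derivative g0 = 0 := by
      by_contra h4
      have := Polynomial.degree_le_of_dvd h2 h4
      exact absurd (Polynomial.degree_derivative_lt hg00) (not_lt.2 this)
    have h4 := Polynomial.derivative_eq_zero.1 h3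
    have : 5 ≤ g0.natDegree := Polynomial.le_natDegree_of_ne_zero hg0
    omega
  obtain ⟨lam, hlam⟩ := Infinite.exists_notMem_finset
    (insert (-(g0.coeff 5 / g1.coeff 5)) ((W * b).roots.toFinset.image (fun β => -(g0.eval β / g1.eval β))))
  simp only [Finset.mem_insert, Finset.mem_image, not_or, not_exists, not_and] at hlam
  obtain ⟨hl1, hl2⟩ := hlam
  set g := g0 + lam • g1 with hg
  have hgL : g ∈ L := L.add_mem hg0L (L.smul_mem _ hg1L)
  have aux : ∀ x y : k, (x = 0 → y ≠ 0) → lam ≠ -(x / y) → x + lam * y ≠ 0 := by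
    intro x y h1 h2 h3
    by_cases hy : y = 0
    · subst hy
      simp at h3
      exact h1 h3 rfl
    · apply h2
      field_simp
      linear_combination h3
  have hgc : g.coeff 5 ≠ 0 := by
    simp only [hg, Polynomial.coeff_add, Polynomial.coeff_smul, smul_eq_mul]
    exact aux _ _ (fun h => absurd h hg0) hl1
  have hge : ∀ β, W.eval β = 0 ∨ b.eval β = 0 → g.eval β ≠ 0 := by
    intro β h
    simp only [hg, Polynomial.eval_add, Polynomial.eval_smul, smul_eq_mul]
    refine aux _ _ (cop β) (fun h' => hl2 β ?_ h'.symm)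
    rw [Multiset.mem_toFinset, Polynomial.mem_roots (mul_ne_zero hW0 hb)]
    simpa [Polynomial.IsRoot] using h
  have hgne : g ≠ 0 := by intro h; rw [h] at hgc; simp at hgc
  obtain ⟨hgd, hgΦ, hgΦX⟩ := (memL g).1 hgL
  have hgn : g.natDegree = 5 := by
    have h1 : 5 ≤ g.natDegree := Polynomial.le_natDegree_of_ne_zero hgc
    rw [Polynomial.degree_eq_natDegree hgne] at hgd
    have : g.natDegree < 6 := by exact_mod_cast hgd
    omega
  have hnod : g.roots.Nodup := by
    rw [Multiset.nodup_iff_count_le_one]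
    intro β
    rw [Polynomial.count_roots]
    by_contra hc
    push Not at hc
    rw [Polynomial.one_lt_rootMultiplicity_iff_isRoot hgne] at hc
    obtain ⟨h1, h2⟩ := hc
    refine hge β (Or.inl ?_) h1
    have : W = Polynomial.derivative g * g1 - g * Polynomial.derivative g1 := by
      simp only [hW, hg, Polynomial.derivative_add, Polynomial.smul_eq_C_mul, Polynomial.derivative_C_mul]
      ring
    rw [this]
    simp [h1.eq_zero, h2.eq_zero]
  have hcard : g.roots.toFinset.card = 5 := by
    rw [Multiset.toFinset_card_of_nodup hnod, ← (IsAlgClosed.splits g).natDegree_eq_card_roots, hgn]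
  refine ⟨g.roots.toFinset, fun t => Φ (Lagrange.basis g.roots.toFinset id t), hcard, ?_, ?_⟩
  · intro t ht hbt
    refine hge t (Or.inr hbt) ?_
    rw [Multiset.mem_toFinset, Polynomial.mem_roots hgne] at ht
    exact ht
  · intro h hh
    set s := g.roots.toFinset with hs
    set r := Lagrange.interpolate s id (fun t => h.eval t) with hr
    have hinj : Set.InjOn (id : k → k) (s : Set k) := Function.injective_id.injOn
    have hrdeg : r.degree < 5 := by
      have := Lagrange.degree_interpolate_lt (fun t => h.eval t) hinj
      rw [hcard] at this
      exact_mod_cast this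
    have hΦr : Φ r = ∑ t ∈ s, Φ (Lagrange.basis s id t) * h.eval t := by
      rw [hr, Lagrange.interpolate_apply, map_sum]
      refine Finset.sum_congr rfl fun t _ => ?_
      rw [← Polynomial.smul_eq_C_mul, map_smul, smul_eq_mul, mul_comm]
    rw [← hΦr, ← sub_eq_zero, ← map_sub]
    have hdvd : g ∣ h - r := by
      by_cases h0 : h - r = 0
      · rw [h0]; exact dvd_zero _
      rw [(IsAlgClosed.splits g).dvd_iff_roots_le_roots hgne h0]
      rw [Multiset.le_iff_subset hnod]
      intro t ht
      rw [Polynomial.mem_roots h0, Polynomial.IsRoot, Polynomial.eval_sub]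
      have := Lagrange.eval_interpolate_at_node (i := t) (fun t => h.eval t) hinj (by rw [hs]; simpa using ht)
      simp only [id] at this
      rw [hr]
      exact sub_eq_zero.2 this.symm
    obtain ⟨u, hu⟩ := hdvd
    have hud : u.natDegree ≤ 1 := by
      by_cases h0 : u = 0
      · simp [h0]
      have h1 : (h - r).degree < 7 := lt_of_le_of_lt (Polynomial.degree_sub_le _ _)
        (max_lt hh (hrdeg.trans (by norm_num)))
      rw [hu, Polynomial.degree_mul, Polynomial.degree_eq_natDegree h0, Polynomial.degree_eq_natDegree hgne, hgn] at h1
      have : 5 + u.natDegree < 7 := by exact_mod_cast h1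
      omega
    rw [hu, Polynomial.eq_X_add_C_of_natDegree_le_one hud]
    have : g * (Polynomial.C (u.coeff 1) * Polynomial.X + Polynomial.C (u.coeff 0))
        = u.coeff 1 • (Polynomial.X * g) + u.coeff 0 • g := by
      simp only [Polynomial.smul_eq_C_mul]; ring
    rw [this]
    simp [hgΦ, hgΦX]

/-- Change of basis for a cubic tensor. -/
def trT {k : Type} [Field k] (B : Matrix (Fin 3) (Fin 3) k) (T : Fin 3 → Fin 3 → Fin 3 → k) :
    Fin 3 → Fin 3 → Fin 3 → k :=
  fun a b c => ∑ i, ∑ j, ∑ l, T i j l * B i a * B j b * B l c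

/-- The cubic with given tensor. -/
noncomputable def cubF {k : Type} [Field k] {n : ℕ} (T : Fin 3 → Fin 3 → Fin 3 → k)
    (y : Fin 3 → MvPolynomial (Fin n) k) : MvPolynomial (Fin n) k :=
  ∑ a, ∑ b, ∑ c, C (T a b c) * (y a * y b * y c)

/-- Symmetry of a tensor. -/
def SymT {k : Type} (T : Fin 3 → Fin 3 → Fin 3 → k) : Prop :=
  (∀ a b c, T a b c = T b a c) ∧ (∀ a b c, T a b c = T a c b)

/-- The quadric `q` is apolar to `T`. -/
def InN {k : Type} [Field k] (T : Fin 3 → Fin 3 → Fin 3 → k) (q : Matrix (Fin 3) (Fin 3) k) : Prop :=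
  ∀ c, ∑ a, ∑ b, q a b * T a b c = 0

theorem cubF_tr {k : Type} [Field k] {n : ℕ} (T : Fin 3 → Fin 3 → Fin 3 → k)
    (B : Matrix (Fin 3) (Fin 3) k) (z : Fin 3 → MvPolynomial (Fin n) k) :
    cubF T (fun i => ∑ a, C (B i a) * z a) = cubF (trT B T) z := by
  simp only [cubF, trT, map_sum, map_mul, Finset.sum_mul, Finset.mul_sum]
  have h : ∀ f : Fin 3 → Fin 3 → Fin 3 → Fin 3 → Fin 3 → Fin 3 → MvPolynomial (Fin n) k,
      ∑ i, ∑ j, ∑ l, ∑ a, ∑ b, ∑ c, f i j l a b c = ∑ a, ∑ b, ∑ c, ∑ i, ∑ j, ∑ l, f i j l a b c := by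
    intro f
    simp only [← Fintype.sum_prod_type']
    refine Fintype.sum_equiv
      ⟨fun x => ⟨x.2.2.2.1, x.2.2.2.2.1, x.2.2.2.2.2, x.1, x.2.1, x.2.2.1⟩,
       fun x => ⟨x.2.2.2.1, x.2.2.2.2.1, x.2.2.2.2.2, x.1, x.2.1, x.2.2.1⟩,
       fun x => rfl, fun x => rfl⟩ _ _ (fun x => rfl)
  have h2 : ∀ f : Fin 3 → Fin 3 → Fin 3 → MvPolynomial (Fin n) k,
      ∑ c, ∑ b, ∑ a, f a b c = ∑ a, ∑ b, ∑ c, f a b c := by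
    intro f
    rw [Finset.sum_comm]
    rw [Finset.sum_comm' (t' := Finset.univ) (s' := fun _ => Finset.univ) (by simp)]
    simp only [Fin.sum_univ_three]
    abel
  conv_lhs =>
    enter [2, i, 2, j, 2, l]
    rw [h2 (fun a b c => C (T i j l) * (C (B i a) * z a * (C (B j b) * z b) * (C (B l c) * z c)))]
  rw [h]
  refine Finset.sum_congr rfl fun a _ => Finset.sum_congr rfl fun b _ => Finset.sum_congr rfl fun c _ =>
    Finset.sum_congr rfl fun i _ => Finset.sum_congr rfl fun j _ => Finset.sum_congr rfl fun l _ => ?_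
  ring

theorem tr_pair {k : Type} [Field k] (T : Fin 3 → Fin 3 → Fin 3 → k)
    (B r : Matrix (Fin 3) (Fin 3) k) (c : Fin 3) :
    ∑ a, ∑ b, r a b * trT B T a b c =
      ∑ l, B l c * ∑ i, ∑ j, (B * r * B.transpose) i j * T i j l := by
  simp only [trT, Matrix.mul_apply, Matrix.transpose_apply, Fin.sum_univ_three]
  ring

theorem InN_tr {k : Type} [Field k] {T : Fin 3 → Fin 3 → Fin 3 → k}
    {A B q : Matrix (Fin 3) (Fin 3) k} (hBA : B * A = 1) (h : InN T q) :
    InN (trT B T) (A * q * A.transpose) := by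
  intro c
  rw [tr_pair]
  have : B * (A * q * A.transpose) * B.transpose = q := by
    calc _ = (B * A) * q * (B * A).transpose := by
            rw [Matrix.transpose_mul]; simp only [Matrix.mul_assoc]
      _ = q := by rw [hBA]; simp
  rw [this]
  simp [h _]

theorem InN_of_tr {k : Type} [Field k] {T : Fin 3 → Fin 3 → Fin 3 → k}
    {A B r : Matrix (Fin 3) (Fin 3) k} (hBA : B * A = 1) (h : InN (trT B T) r) :
    InN T (B * r * B.transpose) := by
  have h1 : ∀ c, ∑ l, B l c * ∑ i, ∑ j, (B * r * B.transpose) i j * T i j l = 0 := by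
    intro c
    rw [← tr_pair]
    exact h c
  have h2 : Matrix.vecMul (fun l => ∑ i, ∑ j, (B * r * B.transpose) i j * T i j l) B = 0 := by
    ext c
    simp only [Matrix.vecMul, dotProduct, Pi.zero_apply]
    rw [← h1 c]
    exact Finset.sum_congr rfl fun l _ => mul_comm _ _
  have h3 := congrArg (fun v => Matrix.vecMul v A) h2
  simp only [Matrix.vecMul_vecMul, hBA, Matrix.vecMul_one, Matrix.zero_vecMul] at h3
  intro c
  exact congrFun h3 c

theorem SymT_tr {k : Type} [Field k] {T : Fin 3 → Fin 3 → Fin 3 → k}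
    (B : Matrix (Fin 3) (Fin 3) k) (h : SymT T) : SymT (trT B T) := by
  constructor
  · intro a b c
    simp only [trT]
    rw [Finset.sum_comm]
    refine Finset.sum_congr rfl fun i _ => Finset.sum_congr rfl fun j _ => Finset.sum_congr rfl fun l _ => ?_
    rw [h.1 j i l]; ring
  · intro a b c
    simp only [trT]
    refine Finset.sum_congr rfl fun i _ => ?_
    rw [Finset.sum_comm]
    refine Finset.sum_congr rfl fun j _ => Finset.sum_congr rfl fun l _ => ?_
    rw [h.2 i l j]; ring

/-- Symmetric matrix with six given entries. -/
def Sym6 {k : Type} (r : Fin 6 → k) : Matrix (Fin 3) (Fin 3) k :=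
  !![r 0, r 1, r 2; r 1, r 3, r 4; r 2, r 4, r 5]

/-- Functionals cutting out the apolar quadrics. -/
def fN {k : Type} [Field k] (T : Fin 3 → Fin 3 → Fin 3 → k) (c : Fin 3) : (Fin 6 → k) →ₗ[k] k where
  toFun r := r 0 * T 0 0 c + r 1 * (T 0 1 c + T 1 0 c) + r 2 * (T 0 2 c + T 2 0 c) + r 3 * T 1 1 c
    + r 4 * (T 1 2 c + T 2 1 c) + r 5 * T 2 2 c
  map_add' x y := by simp only [Pi.add_apply]; ring
  map_smul' a x := by simp only [Pi.smul_apply, smul_eq_mul, RingHom.id_apply]; ring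

/-- The space of apolar quadrics. -/
def NS {k : Type} [Field k] (T : Fin 3 → Fin 3 → Fin 3 → k) : Submodule k (Fin 6 → k) :=
  ⨅ c, LinearMap.ker (fN T c)

theorem mem_NS {k : Type} [Field k] {T : Fin 3 → Fin 3 → Fin 3 → k} {r : Fin 6 → k} :
    r ∈ NS T ↔ InN T (Sym6 r) := by
  simp only [NS, Submodule.mem_iInf, LinearMap.mem_ker, InN]
  refine forall_congr' fun c => ?_
  have : fN T c r = ∑ a, ∑ b, Sym6 r a b * T a b c := by
    simp [fN, Sym6, Fin.sum_univ_three]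
    ring
  rw [this]

theorem det_Sym6 {k : Type} [Field k] (r : Fin 6 → k) : (Sym6 r).det =
    r 0 * r 3 * r 5 - r 0 * r 4 ^ 2 - r 1 ^ 2 * r 5 + 2 * r 1 * r 2 * r 4 - r 2 ^ 2 * r 3 := by
  simp [Sym6, Matrix.det_fin_three]
  ring

theorem Sym6_of_symm {k : Type} [Field k] {q : Matrix (Fin 3) (Fin 3) k} (h : q.transpose = q) :
    ∃ r, q = Sym6 r := by
  have h1 : ∀ i j, q i j = q j i := fun i j => by conv_lhs => rw [← h, Matrix.transpose_apply]
  refine ⟨![q 0 0, q 0 1, q 0 2, q 1 1, q 1 2, q 2 2], ?_⟩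
  ext i j
  fin_cases i <;> fin_cases j <;> simp [Sym6] <;> exact h1 _ _

theorem Sym6_symm {k : Type} (r : Fin 6 → k) : (Sym6 r).transpose = Sym6 r := by
  ext i j
  fin_cases i <;> fin_cases j <;> simp [Sym6]

/-- Contraction of a tensor with a vector. -/
def St {k : Type} [Field k] (T : Fin 3 → Fin 3 → Fin 3 → k) (g : Fin 3 → k) (a b : Fin 3) : k :=
  ∑ c, g c * T a b c

theorem St_swap {k : Type} [Field k] {T : Fin 3 → Fin 3 → Fin 3 → k} (hT : SymT T)
    (g h : Fin 3 → k) (b : Fin 3) : ∑ a, St T g a b * h a = ∑ a, St T h a b * g a := by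
  simp only [St, Finset.sum_mul]
  rw [Finset.sum_comm]
  refine Finset.sum_congr rfl fun a _ => Finset.sum_congr rfl fun c _ => ?_
  rw [hT.1 c b a, hT.2 b c a, hT.1 b a c]
  ring

theorem rep_NS {k : Type} [Field k] {T : Fin 3 → Fin 3 → Fin 3 → k} (hT : SymT T)
    (ℓ : (Fin 6 → k) →ₗ[k] k) (h : ∀ r ∈ NS T, ℓ r = 0) :
    ∃ g : Fin 3 → k, ∀ r, ℓ r = r 0 * St T g 0 0 + 2 * r 1 * St T g 0 1 + 2 * r 2 * St T g 0 2
      + r 3 * St T g 1 1 + 2 * r 4 * St T g 1 2 + r 5 * St T g 2 2 := by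
  obtain ⟨g, hg⟩ := comb_three (fN T) ℓ (fun x hx => h x (by
    simp only [NS, Submodule.mem_iInf, LinearMap.mem_ker]; exact hx))
  refine ⟨g, fun r => ?_⟩
  rw [hg]
  simp only [fN, LinearMap.coe_mk, AddHom.coe_mk, St, Fin.sum_univ_three]
  simp only [hT.1 1 0, hT.1 2 0, hT.1 2 1]
  ring

theorem St_symm {k : Type} [Field k] {T : Fin 3 → Fin 3 → Fin 3 → k} (hT : SymT T)
    (g : Fin 3 → k) (a b : Fin 3) : St T g a b = St T g b a := by
  simp only [St]
  exact Finset.sum_congr rfl fun c _ => by rw [hT.1]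

/-- values of the contraction from the functional -/
theorem rep_vals {k : Type} [Field k] [CharZero k] {T : Fin 3 → Fin 3 → Fin 3 → k} (hT : SymT T)
    (w : Fin 6 → k) (h : ∀ r ∈ NS T, r 0 * w 0 + 2 * r 1 * w 1 + 2 * r 2 * w 2 + r 3 * w 3
      + 2 * r 4 * w 4 + r 5 * w 5 = 0) :
    ∃ g : Fin 3 → k, ∀ a b, St T g a b = Sym6 w a b := by
  obtain ⟨g, hg⟩ := rep_NS hT
    { toFun := fun r => r 0 * w 0 + 2 * r 1 * w 1 + 2 * r 2 * w 2 + r 3 * w 3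
        + 2 * r 4 * w 4 + r 5 * w 5
      map_add' := fun x y => by simp only [Pi.add_apply]; ring
      map_smul' := fun a x => by simp only [Pi.smul_apply, smul_eq_mul, RingHom.id_apply]; ring } h
  simp only [LinearMap.coe_mk, AddHom.coe_mk] at hg
  refine ⟨g, ?_⟩
  have h0 := hg ![1, 0, 0, 0, 0, 0]
  have h1 := hg ![0, 1, 0, 0, 0, 0]
  have h2 := hg ![0, 0, 1, 0, 0, 0]
  have h3 := hg ![0, 0, 0, 1, 0, 0]
  have h4 := hg ![0, 0, 0, 0, 1, 0]
  have h5 := hg ![0, 0, 0, 0, 0, 1]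
  simp at h0 h1 h2 h3 h4 h5
  intro a b
  fin_cases a <;> fin_cases b <;> simp [Sym6, h0, h1, h2, h3, h4, h5] <;> rw [St_symm hT]

theorem C1_false {k : Type} [Field k] [CharZero k] {T : Fin 3 → Fin 3 → Fin 3 → k} (hT : SymT T)
    (h5 : ∀ r ∈ NS T, r 5 = 0) (h4 : ∀ r ∈ NS T, r 4 = 0) (h2 : ∀ r ∈ NS T, r 2 = 0) : False := by
  obtain ⟨g, hg⟩ := rep_vals hT ![0, 0, 0, 0, 0, 1] (fun r hr => by simp [h5 r hr])
  obtain ⟨h, hh⟩ := rep_vals hT ![0, 0, 1, 0, 0, 0] (fun r hr => by simp [h2 r hr])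
  obtain ⟨m, hm⟩ := rep_vals hT ![0, 0, 0, 0, 1, 0] (fun r hr => by simp [h4 r hr])
  have e1 := St_swap hT g h
  have e2 := St_swap hT g m
  have e3 := St_swap hT h m
  have a0 := e1 0
  have a2 := e1 2
  have b2 := e2 2
  have c0 := e3 0
  have c1 := e3 1
  simp [Fin.sum_univ_three, hg, hh, hm, Sym6] at a0 a2 b2 c0 c1
  have : St T g 2 2 = 0 := by
    have g0 : g 0 = 0 := by rw [← a2, ← c1]
    have g1 : g 1 = 0 := by rw [← b2, c0]
    simp [St, Fin.sum_univ_three, g0, g1, ← a0]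
  rw [hg] at this
  simp [Sym6] at this

theorem C2_false {k : Type} [Field k] [CharZero k] {T : Fin 3 → Fin 3 → Fin 3 → k} (hT : SymT T)
    (c : k)
    (h5 : ∀ r ∈ NS T, r 5 = 0) (h4 : ∀ r ∈ NS T, r 4 = c * r 2)
    (h3 : ∀ r ∈ NS T, 2 * c * r 1 - c ^ 2 * r 0 - r 3 = 0) : False := by
  obtain ⟨g, hg⟩ := rep_vals hT ![0, 0, 0, 0, 0, 1] (fun r hr => by simp [h5 r hr])
  obtain ⟨h, hh⟩ := rep_vals hT ![0, 0, -c, 0, 1, 0] (fun r hr => by simp [h4 r hr]; ring)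
  obtain ⟨m, hm⟩ := rep_vals hT ![c ^ 2, -c, 0, 1, 0, 0] (fun r hr => by
    simp; linear_combination - h3 r hr)
  have e1 := St_swap hT g h
  have e2 := St_swap hT g m
  have e3 := St_swap hT h m
  have a1 := e1 1
  have a2 := e1 2
  have b1 := e2 1
  have b2 := e2 2
  have c1 := e3 1
  have hg22 := hg 2 2
  have hh22 := hh 2 2
  have hg12 := hg 1 2
  have hh12 := hh 1 2
  simp [Fin.sum_univ_three, hg, hh, hm, Sym6] at a1 a2 b1 b2 c1
  simp [St, Fin.sum_univ_three, Sym6] at hg22 hh22 hg12 hh12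
  have p1 : g 1 = c * g 0 := by linear_combination -b1
  have p2 : h 2 = 0 := by linear_combination a2 + p1
  have p3 : h 1 = c * h 0 := by linear_combination -c1 + b2
  have q1 : h 0 = 0 := by
    rw [p1, ← a1] at hg22
    rw [p2, p3] at hh22
    linear_combination g 0 * hh22 - h 0 * hg22
  have q2 : g 0 = 0 := by
    rw [p1, ← a1] at hg12
    rw [p2, p3] at hh12
    linear_combination h 0 * hg12 - g 0 * hh12
  rw [p1, q2, ← a1] at hg22
  simp at hg22

theorem prod_zero {k E : Type} [Field k] [AddCommGroup E] [Module k E] (N : Submodule k E)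
    (f g : E → k) (hf : ∀ x y, f (x + y) = f x + f y) (hg : ∀ x y, g (x + y) = g x + g y)
    (h : ∀ x ∈ N, f x * g x = 0) : (∀ x ∈ N, f x = 0) ∨ (∀ x ∈ N, g x = 0) := by
  by_contra hc
  push Not at hc
  obtain ⟨⟨x, hx, hfx⟩, ⟨y, hy, hgy⟩⟩ := hc
  have h1 := (mul_eq_zero.1 (h x hx)).resolve_left hfx
  have h2 := (mul_eq_zero.1 (h y hy)).resolve_right hgy
  have h3 := h _ (N.add_mem hx hy)
  rw [hf, hg, h1, h2] at h3
  simp at h3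
  tauto

theorem D_false {k : Type} [Field k] [IsAlgClosed k] [CharZero k]
    {T : Fin 3 → Fin 3 → Fin 3 → k} (hT : SymT T)
    (hdet : ∀ r ∈ NS T, (Sym6 r).det = 0) (d0 d1 : k) (h0 : d0 ≠ 0) (h1 : d1 ≠ 0)
    (hd : ![d0, 0, 0, d1, 0, 0] ∈ NS T) : False := by
  have hh : ∀ r ∈ NS T, d0 * d1 * r 5 = 0 ∧ d0 * (r 3 * r 5 - r 4 ^ 2) + d1 * (r 0 * r 5 - r 2 ^ 2) = 0
      ∧ r 0 * r 3 * r 5 - r 0 * r 4 ^ 2 - r 1 ^ 2 * r 5 + 2 * r 1 * r 2 * r 4 - r 2 ^ 2 * r 3 = 0 := by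
    intro r hr
    have key : ∀ t : k, (Sym6 (![d0, 0, 0, d1, 0, 0] + t • r)).det = 0 := fun t =>
      hdet _ ((NS T).add_mem hd ((NS T).smul_mem t hr))
    have k1 := key 1
    have k2 := key (-1)
    have k3 := key 2
    rw [det_Sym6] at k1 k2 k3
    simp at k1 k2 k3
    have k4 := hdet r hr
    rw [det_Sym6] at k4
    refine ⟨?_, ?_, k4⟩
    · linear_combination (1/2) * k1 - (1/2) * k2 - k4
    · linear_combination (1/2) * k1 + (1/2) * k2
  have h5 : ∀ r ∈ NS T, r 5 = 0 := fun r hr => by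
    have := (hh r hr).1
    simpa [h0, h1] using this
  obtain ⟨e, he⟩ := IsAlgClosed.exists_pow_nat_eq (-d1 / d0) (n := 2) (by norm_num)
  have hfin : ∀ c : k, (∀ r ∈ NS T, r 4 = c * r 2) → False := by
    intro c h4
    rcases prod_zero (NS T) (fun r => r 2) (fun r => 2 * c * r 1 - c ^ 2 * r 0 - r 3)
      (by simp) (by intro x y; simp; ring) (by
        intro r hr
        have := (hh r hr).2.2
        rw [h5 r hr, h4 r hr] at this
        have h' : r 2 * (r 2 * (2 * c * r 1 - c ^ 2 * r 0 - r 3)) = 0 := by linear_combination this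
        rcases mul_eq_zero.1 h' with h | h
        · simp [h]
        · exact h) with h | h
    · exact C1_false hT h5 (fun r hr => by rw [h4 r hr, h r hr, mul_zero]) h
    · exact C2_false hT c h5 h4 h
  rcases prod_zero (NS T) (fun r => r 4 - e * r 2) (fun r => r 4 + e * r 2)
    (by intro x y; simp; ring) (by intro x y; simp; ring) (by
      intro r hr
      have := (hh r hr).2.1
      rw [h5 r hr] at this
      have h' : e ^ 2 * d0 = - d1 := by rw [he]; field_simp
      have : d0 * ((r 4 - e * r 2) * (r 4 + e * r 2)) = 0 := by
        linear_combination - this - r 2 ^ 2 * h'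
      exact (mul_eq_zero.1 this).resolve_left h0) with h | h
  · exact hfin e (fun r hr => sub_eq_zero.1 (h r hr))
  · exact hfin (-e) (fun r hr => by linear_combination h r hr)

theorem exists_NS {k : Type} [Field k] (T : Fin 3 → Fin 3 → Fin 3 → k) (i : Fin 6) :
    ∃ s ∈ NS T, s ≠ 0 ∧ s i = 0 := by
  let f : (Fin 6 → k) →ₗ[k] (Fin 4 → k) :=
    LinearMap.pi ![fN T 0, fN T 1, fN T 2, LinearMap.proj i]
  have := LinearMap.ker_ne_bot_of_finrank_lt (f := f) (by simp)
  obtain ⟨s, hs, hs0⟩ := (Submodule.ne_bot_iff _).1 this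
  rw [LinearMap.mem_ker] at hs
  refine ⟨s, ?_, hs0, ?_⟩
  · simp only [NS, Submodule.mem_iInf, LinearMap.mem_ker]
    intro c
    fin_cases c
    · simpa [f] using congrFun hs 0
    · simpa [f] using congrFun hs 1
    · simpa [f] using congrFun hs 2
  · simpa [f] using congrFun hs 3

/-- All 2-minors of the symmetric matrix vanish. -/
def Rk1 {k : Type} [Field k] (r : Fin 6 → k) : Prop :=
  r 1 ^ 2 = r 0 * r 3 ∧ r 2 ^ 2 = r 0 * r 5 ∧ r 4 ^ 2 = r 3 * r 5 ∧ r 0 * r 4 = r 1 * r 2 ∧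
    r 3 * r 2 = r 1 * r 4 ∧ r 5 * r 1 = r 2 * r 4

theorem rk1_false {k : Type} [Field k] (T : Fin 3 → Fin 3 → Fin 3 → k)
    (h : ∀ r ∈ NS T, Rk1 r) : False := by
  obtain ⟨r, hr, hr0, -⟩ := exists_NS T 0
  have h1 := h r hr
  have hz : ∀ s : Fin 6 → k, s 0 = 0 → s 1 = 0 → s 2 = 0 → s 3 = 0 → s 4 = 0 → s 5 = 0 → s = 0 := by
    intro s _ _ _ _ _ _
    ext i; fin_cases i <;> simpa
  have : r 0 ≠ 0 ∨ r 3 ≠ 0 ∨ r 5 ≠ 0 := by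
    by_contra hc
    push Not at hc
    obtain ⟨c1, c2, c3⟩ := hc
    obtain ⟨m1, m2, m3, -⟩ := h1
    rw [c1] at m1 m2
    rw [c2] at m3
    simp at m1 m2 m3
    exact hr0 (hz r c1 m1 m2 c2 m3 c3)
  rcases this with h0 | h0 | h0
  · obtain ⟨s, hs, hs0, hsi⟩ := exists_NS T 0
    obtain ⟨m1, m2, m3, m4, m5, m6⟩ := h1
    obtain ⟨l1, l2, l3, l4, l5, l6⟩ := h s hs
    obtain ⟨n1, n2, n3, n4, n5, n6⟩ := h _ ((NS T).add_mem hr hs)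
    simp only [Pi.add_apply] at n1 n2 n3 n4 n5 n6
    simp [hsi] at l1 l2
    simp only [hsi, l1, l2, add_zero] at n1 n2 n4
    refine hs0 (hz s hsi l1 l2 ?_ ?_ ?_) <;> apply mul_left_cancel₀ h0
    · linear_combination m1 - n1
    · linear_combination n4 - m4
    · linear_combination m2 - n2
  · obtain ⟨s, hs, hs0, hsi⟩ := exists_NS T 3
    obtain ⟨m1, m2, m3, m4, m5, m6⟩ := h1
    obtain ⟨l1, l2, l3, l4, l5, l6⟩ := h s hs
    obtain ⟨n1, n2, n3, n4, n5, n6⟩ := h _ ((NS T).add_mem hr hs)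
    simp only [Pi.add_apply] at n1 n2 n3 n4 n5 n6
    simp [hsi] at l1 l3
    simp only [hsi, l1, l3, add_zero] at n1 n3 n5
    refine hs0 (hz s ?_ l1 ?_ hsi l3 ?_) <;> apply mul_left_cancel₀ h0
    · linear_combination m1 - n1
    · linear_combination n5 - m5
    · linear_combination m3 - n3
  · obtain ⟨s, hs, hs0, hsi⟩ := exists_NS T 5
    obtain ⟨m1, m2, m3, m4, m5, m6⟩ := h1
    obtain ⟨l1, l2, l3, l4, l5, l6⟩ := h s hs
    obtain ⟨n1, n2, n3, n4, n5, n6⟩ := h _ ((NS T).add_mem hr hs)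
    simp only [Pi.add_apply] at n1 n2 n3 n4 n5 n6
    simp [hsi] at l2 l3
    simp only [hsi, l2, l3, add_zero] at n2 n3 n6
    refine hs0 (hz s ?_ ?_ l2 ?_ l3 hsi) <;> apply mul_left_cancel₀ h0
    · linear_combination m2 - n2
    · linear_combination n6 - m6
    · linear_combination m3 - n3

theorem gram_apply {k : Type} [Field k] (A q : Matrix (Fin 3) (Fin 3) k) (i j : Fin 3) :
    (A * q * A.transpose) i j = A i ⬝ᵥ q.mulVec (A j) := by
  rw [Matrix.dotProduct_mulVec, Matrix.mul_apply]
  rfl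

theorem gram_rows {k : Type} [Field k] (p y z : Fin 3 → k) (q : Matrix (Fin 3) (Fin 3) k) :
    (Matrix.of ![p, y, z]) * q * (Matrix.of ![p, y, z]).transpose =
      !![p ⬝ᵥ q.mulVec p, p ⬝ᵥ q.mulVec y, p ⬝ᵥ q.mulVec z;
         y ⬝ᵥ q.mulVec p, y ⬝ᵥ q.mulVec y, y ⬝ᵥ q.mulVec z;
         z ⬝ᵥ q.mulVec p, z ⬝ᵥ q.mulVec y, z ⬝ᵥ q.mulVec z] := by
  ext a b
  rw [gram_apply]
  fin_cases a <;> fin_cases b <;> rfl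

theorem exists_diag {k : Type} [Field k] [CharZero k] {q : Matrix (Fin 3) (Fin 3) k}
    (hq : q.transpose = q) : ∃ (A B : Matrix (Fin 3) (Fin 3) k) (d : Fin 3 → k),
      B * A = 1 ∧ A * q * A.transpose = Matrix.diagonal d := by
  have : Invertible (2 : k) := invertibleOfNonzero two_ne_zero
  have hs : LinearMap.IsSymm (Matrix.toBilin' q) := by
    constructor
    intro x y
    simp only [Matrix.toBilin'_apply', RingHom.id_apply]
    rw [Matrix.dotProduct_mulVec, ← Matrix.mulVec_transpose, hq, dotProduct_comm]
  obtain ⟨v, hv⟩ := LinearMap.BilinForm.exists_orthogonal_basis hs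
  let w := v.reindex (finCongr (by simp : Module.finrank k (Fin 3 → k) = 3))
  let A : Matrix (Fin 3) (Fin 3) k := Matrix.of (fun i => w i)
  have hA : IsUnit A := by
    rw [← Matrix.linearIndependent_rows_iff_isUnit]
    exact w.linearIndependent
  refine ⟨A, A⁻¹, fun i => (A * q * A.transpose) i i,
    Matrix.nonsing_inv_mul _ ((Matrix.isUnit_iff_isUnit_det A).1 hA), ?_⟩
  ext i j
  by_cases hij : i = j
  · subst hij; simp
  · rw [Matrix.diagonal_apply_ne _ hij, gram_apply]
    have := hv (i := (finCongr (by simp : Module.finrank k (Fin 3 → k) = 3)).symm i)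
      (j := (finCongr (by simp : Module.finrank k (Fin 3 → k) = 3)).symm j) (by simpa using hij)
    have h2 : Matrix.toBilin' q (v ((finCongr (by simp : Module.finrank k (Fin 3 → k) = 3)).symm i))
      (v ((finCongr (by simp : Module.finrank k (Fin 3 → k) = 3)).symm j)) = 0 := this
    rw [Matrix.toBilin'_apply'] at h2
    change w i ⬝ᵥ q.mulVec (w j) = 0
    rw [Module.Basis.reindex_apply, Module.Basis.reindex_apply]
    exact h2

theorem exists_nonsing {k : Type} [Field k] [IsAlgClosed k] [CharZero k]
    {T : Fin 3 → Fin 3 → Fin 3 → k} (hT : SymT T) : ∃ r ∈ NS T, (Sym6 r).det ≠ 0 := by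
  by_contra hcon
  push Not at hcon
  have : ∃ r ∈ NS T, ¬ Rk1 r := by
    by_contra h
    push Not at h
    exact rk1_false T h
  obtain ⟨r, hr, hrk⟩ := this
  obtain ⟨A0, B0, d0, hBA0, hd0⟩ := exists_diag (Sym6_symm r)
  have hdet : ∏ i, d0 i = 0 := by
    rw [← Matrix.det_diagonal, ← hd0]
    simp [hcon r hr]
  obtain ⟨i, -, hi⟩ := Finset.prod_eq_zero_iff.1 hdet
  obtain ⟨A, B, d, hBA, hd, hd2⟩ : ∃ (A B : Matrix (Fin 3) (Fin 3) k) (d : Fin 3 → k),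
      B * A = 1 ∧ A * Sym6 r * A.transpose = Matrix.diagonal d ∧ d 2 = 0 := by
    refine ⟨A0.submatrix (Equiv.swap i 2) id, B0.submatrix id (Equiv.swap i 2), d0 ∘ Equiv.swap i 2,
      ?_, ?_, ?_⟩
    · rw [Matrix.submatrix_mul_equiv, hBA0]; exact Matrix.submatrix_id_id _
    · rw [← Matrix.submatrix_diagonal_equiv, ← hd0]
      ext a b
      rw [Matrix.submatrix_apply, gram_apply, gram_apply]
      rfl
    · simp [hi]
  have hback : Sym6 r = B * Matrix.diagonal d * B.transpose := by
    rw [← hd]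
    calc Sym6 r = (B * A) * Sym6 r * (B * A).transpose := by rw [hBA]; simp
      _ = _ := by rw [Matrix.transpose_mul]; simp only [Matrix.mul_assoc]
  have hent : ∀ a b, Sym6 r a b = B a 0 * d 0 * B b 0 + B a 1 * d 1 * B b 1 := by
    intro a b
    rw [hback]
    simp [Matrix.mul_apply, Fin.sum_univ_three, hd2, Matrix.diagonal]
  have e0 : r 0 = _ := hent 0 0
  have e1 : r 1 = _ := hent 0 1
  have e2 : r 2 = _ := hent 0 2
  have e3 : r 3 = _ := hent 1 1
  have e4 : r 4 = _ := hent 1 2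
  have e5 : r 5 = _ := hent 2 2
  by_cases h0 : d 0 = 0
  · apply hrk
    simp only [Rk1, e0, e1, e2, e3, e4, e5, h0]
    refine ⟨?_, ?_, ?_, ?_, ?_, ?_⟩ <;> ring
  by_cases h1 : d 1 = 0
  · apply hrk
    simp only [Rk1, e0, e1, e2, e3, e4, e5, h1]
    refine ⟨?_, ?_, ?_, ?_, ?_, ?_⟩ <;> ring
  refine D_false (SymT_tr B hT) ?_ (d 0) (d 1) h0 h1 ?_
  · intro s hs
    have h2 := InN_of_tr hBA (mem_NS.1 hs)
    obtain ⟨s', hs'⟩ := Sym6_of_symm (q := B * Sym6 s * B.transpose) (by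
      simp [Matrix.transpose_mul, Sym6_symm, Matrix.mul_assoc])
    rw [hs'] at h2
    have h3 := hcon s' (mem_NS.2 h2)
    rw [← hs'] at h3
    have h4 : B.det ≠ 0 := by
      intro h
      have := congrArg Matrix.det hBA
      simp [h] at this
    simpa [h4] using h3
  · rw [mem_NS]
    have := InN_tr hBA (mem_NS.1 hr)
    rw [hd] at this
    convert this using 1
    ext a b
    fin_cases a <;> fin_cases b <;> simp [Sym6, Matrix.diagonal, hd2]

/-- Quadratic polynomial of a symmetric matrix. -/
noncomputable def quadP {k : Type} [Field k] (r : Fin 6 → k) : MvPolynomial (Fin 3) k :=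
  C (r 0) * X 0 ^ 2 + C (2 * r 1) * (X 0 * X 1) + C (2 * r 2) * (X 0 * X 2) + C (r 3) * X 1 ^ 2
    + C (2 * r 4) * (X 1 * X 2) + C (r 5) * X 2 ^ 2

theorem eval_quadP {k : Type} [Field k] (r : Fin 6 → k) (p : Fin 3 → k) :
    eval p (quadP r) = p ⬝ᵥ (Sym6 r).mulVec p := by
  simp [quadP, Sym6, Matrix.mulVec, dotProduct, Fin.sum_univ_three]
  ring

theorem quadP_ne_zero {k : Type} [Field k] [CharZero k] {r : Fin 6 → k} (h : r ≠ 0) : quadP r ≠ 0 := by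
  intro h0
  apply h
  have e : ∀ p : Fin 3 → k, eval p (quadP r) = 0 := fun p => by rw [h0, map_zero]
  have e0 := e ![1, 0, 0]
  have e3 := e ![0, 1, 0]
  have e5 := e ![0, 0, 1]
  have e1 := e ![1, 1, 0]
  have e2 := e ![1, 0, 1]
  have e4 := e ![0, 1, 1]
  simp [quadP] at e0 e3 e5
  simp [quadP, e0, e3, e5] at e1 e2 e4
  ext i; fin_cases i <;> simp [*]

theorem exists_pencil {k : Type} [Field k] [IsAlgClosed k] [CharZero k]
    {T : Fin 3 → Fin 3 → Fin 3 → k} (hT : SymT T) {f : MvPolynomial (Fin 3) k} (hf : f ≠ 0) :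
    ∃ (p : Fin 3 → k) (r : Fin 6 → k), r ∈ NS T ∧ (Sym6 r).det ≠ 0 ∧ eval p f ≠ 0 ∧ p ≠ 0 ∧
      p ⬝ᵥ (Sym6 r).mulVec p = 0 := by
  classical
  obtain ⟨a, ha, hadet⟩ := exists_nonsing hT
  have ha0 : ∃ i, a i ≠ 0 := by
    by_contra h
    push Not at h
    apply hadet
    rw [det_Sym6]
    simp [h]
  obtain ⟨i, hi⟩ := ha0
  obtain ⟨b, hb, hb0, hbi⟩ := exists_NS T i
  let e : Fin 6 → Polynomial k := fun j => Polynomial.C (a j) + Polynomial.X * Polynomial.C (b j)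
  let D : Polynomial k := e 0 * e 3 * e 5 - e 0 * e 4 ^ 2 - e 1 ^ 2 * e 5 + 2 * e 1 * e 2 * e 4
    - e 2 ^ 2 * e 3
  have hD : ∀ t, D.eval t = (Sym6 (a + t • b)).det := by
    intro t
    rw [det_Sym6]
    simp [D, e]
    ring
  have hD0 : D ≠ 0 := by
    intro h
    have := hD 0
    rw [h] at this
    simp at this
    exact hadet this.symm
  have hprod : (∏ t ∈ D.roots.toFinset, quadP (a + t • b)) * quadP b * f ≠ 0 := by
    refine mul_ne_zero (mul_ne_zero (Finset.prod_ne_zero_iff.2 fun t _ => quadP_ne_zero ?_)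
      (quadP_ne_zero hb0)) hf
    intro h
    have := congrFun h i
    simp [hbi, hi] at this
  obtain ⟨p, hp⟩ : ∃ p, eval p ((∏ t ∈ D.roots.toFinset, quadP (a + t • b)) * quadP b * f) ≠ 0 := by
    by_contra h
    push Not at h
    exact hprod (MvPolynomial.funext fun x => by rw [h x, map_zero])
  simp only [map_mul, map_prod] at hp
  have hpf := right_ne_zero_of_mul hp
  have hpb := right_ne_zero_of_mul (left_ne_zero_of_mul hp)
  have hpr := Finset.prod_ne_zero_iff.1 (left_ne_zero_of_mul (left_ne_zero_of_mul hp))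
  set t := - eval p (quadP a) / eval p (quadP b) with ht
  have hzero : eval p (quadP (a + t • b)) = 0 := by
    have : eval p (quadP (a + t • b)) = eval p (quadP a) + t * eval p (quadP b) := by
      simp [quadP]; ring
    rw [this, ht]
    field_simp
    ring
  refine ⟨p, a + t • b, (NS T).add_mem ha ((NS T).smul_mem t hb), ?_, hpf, ?_, ?_⟩
  · rw [← hD]
    intro h
    exact hpr t (by simp [hD0, h]) hzero
  · rintro rfl
    rw [eval_quadP] at hpb
    simp at hpb
  · rw [← eval_quadP, hzero]

theorem normal_form {k : Type} [Field k] [IsAlgClosed k] [CharZero k] {q : Matrix (Fin 3) (Fin 3) k}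
    (hq : q.transpose = q) (hdet : q.det ≠ 0) {p : Fin 3 → k} (hp : p ≠ 0)
    (hqp : p ⬝ᵥ q.mulVec p = 0) : ∃ (A B : Matrix (Fin 3) (Fin 3) k) (κ : k), B * A = 1 ∧ A 0 = p ∧
      κ ≠ 0 ∧ A * q * A.transpose = !![0, 0, κ; 0, -2 * κ, 0; κ, 0, 0] := by
  have sym : ∀ x y, x ⬝ᵥ q.mulVec y = y ⬝ᵥ q.mulVec x := by
    intro x y
    rw [Matrix.dotProduct_mulVec, ← Matrix.mulVec_transpose, hq, dotProduct_comm]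
  have hu : q.mulVec p ≠ 0 := by
    intro h
    exact hdet (Matrix.exists_mulVec_eq_zero_iff.1 ⟨p, hp, h⟩)
  obtain ⟨j, hj⟩ := Function.ne_iff.1 hu
  set κ := q.mulVec p j with hκ
  replace hj : κ ≠ 0 := hj
  set x : Fin 3 → k := Pi.single j 1 with hx
  have hxp : x ⬝ᵥ q.mulVec p = κ := by simp [hx, hκ]
  have hpx : p ⬝ᵥ q.mulVec x = κ := by rw [sym, hxp]
  set z : Fin 3 → k := x - ((x ⬝ᵥ q.mulVec x) / (2 * κ)) • p with hz
  have hzp : z ⬝ᵥ q.mulVec p = κ := by simp [hz, sub_dotProduct, hxp, hqp]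
  have hpz : p ⬝ᵥ q.mulVec z = κ := by rw [sym, hzp]
  have hzz : z ⬝ᵥ q.mulVec z = 0 := by
    simp only [hz, sub_dotProduct, Matrix.mulVec_sub, Matrix.mulVec_smul, dotProduct_sub, smul_dotProduct,
      dotProduct_smul, smul_eq_mul, hxp, hpx, hqp]
    field_simp
    ring
  obtain ⟨y, hy0, hyp, hyz⟩ : ∃ y : Fin 3 → k, y ≠ 0 ∧ y ⬝ᵥ q.mulVec p = 0 ∧ y ⬝ᵥ q.mulVec z = 0 := by
    let f : (Fin 3 → k) →ₗ[k] (Fin 2 → k) := Matrix.mulVecLin (Matrix.of ![q.mulVec p, q.mulVec z])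
    have := LinearMap.ker_ne_bot_of_finrank_lt (f := f) (by simp)
    obtain ⟨s, hs, hs0⟩ := (Submodule.ne_bot_iff _).1 this
    rw [LinearMap.mem_ker] at hs
    refine ⟨s, hs0, ?_, ?_⟩
    · rw [dotProduct_comm]; exact congrFun hs 0
    · rw [dotProduct_comm]; exact congrFun hs 1
  have hpy : p ⬝ᵥ q.mulVec y = 0 := by rw [sym, hyp]
  have hzy : z ⬝ᵥ q.mulVec y = 0 := by rw [sym, hyz]
  set μ := y ⬝ᵥ q.mulVec y with hμ
  let A0 : Matrix (Fin 3) (Fin 3) k := Matrix.of ![p, y, z]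
  have hG0 : A0 * q * A0.transpose = !![0, 0, κ; 0, μ, 0; κ, 0, 0] := by
    rw [gram_rows, hqp, hpy, hpz, hyp, hyz, hzp, hzy, hzz]
  have hA0 : A0.det ≠ 0 := by
    intro h
    obtain ⟨c, hc0, hc⟩ := Matrix.exists_vecMul_eq_zero_iff.2 h
    have h1 : Matrix.vecMul c (A0 * q * A0.transpose) = 0 := by
      rw [Matrix.mul_assoc, ← Matrix.vecMul_vecMul, hc, Matrix.zero_vecMul]
    rw [hG0] at h1
    have k0 := congrFun h1 0
    have k2 := congrFun h1 2
    simp [Matrix.vecMul, dotProduct, Fin.sum_univ_three, hj] at k0 k2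
    have h2 : c 1 • y = 0 := by
      rw [← hc]
      ext l
      simp [Matrix.vecMul, dotProduct, Fin.sum_univ_three, k0, k2, A0]
    have h3 : c 1 = 0 := (smul_eq_zero.1 h2).resolve_right hy0
    apply hc0
    ext l; fin_cases l <;> simp [k0, k2, h3]
  have hμ0 : μ ≠ 0 := by
    intro h
    have h1 := congrArg Matrix.det hG0
    have h2 : Matrix.det !![0, 0, κ; 0, μ, 0; κ, 0, 0] = 0 := by
      rw [h]; simp [Matrix.det_fin_three]
    rw [h2, Matrix.det_mul, Matrix.det_mul, Matrix.det_transpose] at h1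
    exact mul_ne_zero (mul_ne_zero hA0 hdet) hA0 h1
  obtain ⟨s, hs⟩ := IsAlgClosed.exists_pow_nat_eq (-2 * κ / μ) (n := 2) (by norm_num)
  let A : Matrix (Fin 3) (Fin 3) k := Matrix.of ![p, s • y, z]
  have hG : A * q * A.transpose = !![0, 0, κ; 0, -2 * κ, 0; κ, 0, 0] := by
    have h11 : s * (s * μ) = -2 * κ := by
      rw [← mul_assoc, ← sq, hs]; field_simp
    rw [gram_rows]
    simp only [Matrix.mulVec_smul, dotProduct_smul, smul_dotProduct, hqp, hpz, hzp, hzz, hyp, hpy, hyz,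
      hzy, ← hμ, smul_eq_mul, mul_zero, h11]
  have hA : A.det ≠ 0 := by
    intro h
    have h1 := congrArg Matrix.det hG
    rw [Matrix.det_mul, Matrix.det_transpose, h, mul_zero] at h1
    simp [Matrix.det_fin_three, hj] at h1
  exact ⟨A, A⁻¹, κ, Matrix.nonsing_inv_mul _ (isUnit_iff_ne_zero.2 hA), rfl, hj, hG⟩

theorem exists_tensor {k : Type} [Field k] [CharZero k] {F : MvPolynomial (Fin 3) k}
    (hF : F.IsHomogeneous 3) : ∃ T : Fin 3 → Fin 3 → Fin 3 → k, SymT T ∧ F = cubF T X := by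
  have hc : ∀ a b c, ∃ u : k, pderiv c (pderiv b (pderiv a F)) = C u := by
    intro a b c
    have h := ((hF.pderiv (i := a)).pderiv (i := b)).pderiv (i := c)
    exact ⟨_, MvPolynomial.totalDegree_eq_zero_iff_eq_C.1 (Nat.le_zero.1 h.totalDegree_le)⟩
  choose U hU using hc
  have h6 : (6 : MvPolynomial (Fin 3) k) * F = cubF U X := by
    have e1 := hF.sum_X_mul_pderiv
    have e2 := fun a => (hF.pderiv (i := a)).sum_X_mul_pderiv
    have e3 := fun a b => ((hF.pderiv (i := a)).pderiv (i := b)).sum_X_mul_pderiv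
    simp only [hU] at e3
    simp only [nsmul_eq_mul] at e1 e2 e3
    have : (6 : MvPolynomial (Fin 3) k) * F = 2 * ((3 : ℕ) * F) := by push_cast; ring
    rw [this, ← e1, cubF, Finset.mul_sum]
    refine Finset.sum_congr rfl fun a _ => ?_
    have : (2 : MvPolynomial (Fin 3) k) * (X a * pderiv a F) = X a * (((3 - 1 : ℕ) : MvPolynomial (Fin 3) k) * pderiv a F) := by
      norm_num; ring
    rw [this, ← e2, Finset.mul_sum]
    refine Finset.sum_congr rfl fun b _ => ?_
    have := e3 a b
    norm_num at this
    rw [← this, Finset.mul_sum, Finset.mul_sum]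
    refine Finset.sum_congr rfl fun c _ => ?_
    ring
  refine ⟨fun a b c => (U a b c + U a c b + U b a c + U b c a + U c a b + U c b a) / 36, ⟨?_, ?_⟩, ?_⟩
  · intro a b c; ring
  · intro a b c; ring
  · have h36 : (C (36 : k) : MvPolynomial (Fin 3) k) ≠ 0 := by simp
    apply mul_left_cancel₀ h36
    have : (C (36 : k) : MvPolynomial (Fin 3) k) * F = 6 * (6 * F) := by
      rw [map_ofNat]; ring
    rw [this, h6]
    have h3 : ∀ a b c, U a b c + U a c b + U b a c + U b c a + U c a b + U c b a =
      36 * ((U a b c + U a c b + U b a c + U b c a + U c a b + U c b a) / 36) := by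
      intro a b c; field_simp
    have h4 : ∀ a b c, (C (36 : k) : MvPolynomial (Fin 3) k) *
        C ((U a b c + U a c b + U b a c + U b c a + U c a b + U c b a) / 36) =
        C (U a b c) + C (U a c b) + C (U b a c) + C (U b c a) + C (U c a b) + C (U c b a) := by
      intro a b c
      rw [← C_mul, ← h3]; simp
    simp only [cubF, Finset.mul_sum, ← mul_assoc, h4]
    simp only [Fin.sum_univ_three]
    ring

theorem exists_col {k : Type} [Field k] {w : Fin 3 → k} (hw : w ≠ 0) :
    ∃ A B : Matrix (Fin 3) (Fin 3) k, B * A = 1 ∧ ∀ i, B i 2 = w i := by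
  obtain ⟨i, hi⟩ := Function.ne_iff.1 hw
  simp at hi
  have : ∃ B : Matrix (Fin 3) (Fin 3) k, B.det ≠ 0 ∧ ∀ i, B i 2 = w i := by
    fin_cases i
    · refine ⟨!![0, 0, w 0; 1, 0, w 1; 0, 1, w 2], ?_, ?_⟩
      · simpa [Matrix.det_fin_three] using hi
      · intro i; fin_cases i <;> simp
    · refine ⟨!![1, 0, w 0; 0, 0, w 1; 0, 1, w 2], ?_, ?_⟩
      · simpa [Matrix.det_fin_three] using hi
      · intro i; fin_cases i <;> simp
    · refine ⟨!![1, 0, w 0; 0, 1, w 1; 0, 0, w 2], ?_, ?_⟩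
      · simpa [Matrix.det_fin_three] using hi
      · intro i; fin_cases i <;> simp
  obtain ⟨B, hB, h⟩ := this
  exact ⟨B⁻¹, B, Matrix.mul_nonsing_inv _ (isUnit_iff_ne_zero.2 hB), h⟩

theorem change_var {k : Type} [Field k] {A B : Matrix (Fin 3) (Fin 3) k} (hBA : B * A = 1)
    (y : Fin 3 → MvPolynomial (Fin 3) k) :
    y = fun i => ∑ a, C (B i a) * ∑ j, C (A a j) * y j := by
  funext i
  have h : ∀ j, (∑ a, C (B i a) * C (A a j) : MvPolynomial (Fin 3) k) = C ((1 : Matrix (Fin 3) (Fin 3) k) i j) := by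
    intro j
    rw [← hBA, Matrix.mul_apply, map_sum]
    simp
  simp only [Finset.mul_sum, ← mul_assoc]
  rw [Finset.sum_comm]
  simp only [← Finset.sum_mul, h]
  simp [Matrix.one_apply]

theorem ess_tensor {k : Type} [Field k] {F : MvPolynomial (Fin 3) k} (hF : EssDep F)
    {T : Fin 3 → Fin 3 → Fin 3 → k} (hT : SymT T) {y : Fin 3 → MvPolynomial (Fin 3) k}
    (hy : ∀ a, (y a).IsHomogeneous 1) (hFy : F = cubF T y)
    (w : Fin 3 → k) (hw : ∀ a b, ∑ c, w c * T a b c = 0) : w = 0 := by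
  by_contra hw0
  obtain ⟨A, B, hBA, hB⟩ := exists_col hw0
  have h1 := change_var hBA y
  rw [h1, cubF_tr] at hFy
  have hz : ∀ a b, trT B T a b 2 = 0 := by
    intro a b
    simp only [trT, hB]
    refine Finset.sum_eq_zero fun i _ => Finset.sum_eq_zero fun j _ => ?_
    have := congrArg (fun u => B i a * B j b * u) (hw i j)
    simp only [Finset.mul_sum, mul_zero] at this
    rw [← this]
    refine Finset.sum_congr rfl fun l _ => by ring
  have hS := SymT_tr B hT
  have hz2 : ∀ a b, trT B T a 2 b = 0 := fun a b => by rw [hS.2, hz]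
  have hz3 : ∀ a b, trT B T 2 a b = 0 := fun a b => by rw [hS.1, hz2]
  refine hF 2 (by norm_num) ⟨fun a => ∑ j, C (A a.castSucc j) * y j, ?_, ?_⟩
  · intro a
    refine IsHomogeneous.sum _ _ _ fun j _ => ?_
    simpa using (isHomogeneous_C (Fin 3) (A a.castSucc j)).mul (hy j)
  · refine ⟨∑ a : Fin 2, ∑ b : Fin 2, ∑ c : Fin 2,
      C (trT B T a.castSucc b.castSucc c.castSucc) * (X a * X b * X c), ?_⟩
    rw [hFy, cubF]
    simp only [map_sum, map_mul, aeval_X, algHom_C, algebraMap_eq]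
    simp only [Fin.sum_univ_castSucc (n := 2)]
    simp [hz, hz2, hz3]

theorem hom_eval_smul {k : Type} [Field k] {f : MvPolynomial (Fin 3) k} {e : ℕ}
    (hf : f.IsHomogeneous e) (r : k) (v : Fin 3 → k) : eval (r • v) f = r ^ e * eval v f := by
  rw [eval_eq', eval_eq', Finset.mul_sum]
  refine Finset.sum_congr rfl fun d hd => ?_
  have h := hf (mem_support_iff.1 hd)
  simp only [Finsupp.weight_apply, Pi.one_apply, smul_eq_mul, mul_one] at h
  rw [Finsupp.sum_fintype _ _ (fun _ => rfl)] at h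
  simp only [Pi.smul_apply, smul_eq_mul, mul_pow, Finset.prod_mul_distrib]
  rw [Finset.prod_pow_eq_pow_sum, h]
  ring

theorem linForm_smul {k : Type} [Field k] (r : k) (v : Fin 3 → k) :
    linForm (r • v) = C r * linForm v := by
  simp [linForm, Finset.mul_sum, mul_assoc]

/-- The functional on polynomials with given moments. -/
noncomputable def PhiL {k : Type} [Field k] (φ : Fin 7 → k) : Polynomial k →ₗ[k] k :=
  ∑ j : Fin 7, φ j • Polynomial.lcoeff k j

theorem PhiL_X_pow {k : Type} [Field k] (φ : Fin 7 → k) (j : Fin 7) :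
    PhiL φ (Polynomial.X ^ (j : ℕ)) = φ j := by
  simp only [PhiL, LinearMap.sum_apply, LinearMap.smul_apply, Polynomial.lcoeff_apply,
    Polynomial.coeff_X_pow, smul_eq_mul]
  rw [Finset.sum_eq_single j]
  · simp
  · intro b _ hb
    rw [if_neg (fun h => hb (Fin.ext h))]; simp
  · simp

theorem PhiL_tensor {k : Type} [Field k] {T : Fin 3 → Fin 3 → Fin 3 → k} (hT : SymT T)
    (h02 : ∀ c, T 0 2 c = T 1 1 c) (a b c : Fin 3) :
    PhiL ![T 0 0 0, T 0 0 1, T 0 1 1, T 1 1 1, T 1 1 2, T 1 2 2, T 2 2 2]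
      (Polynomial.X ^ ((a : ℕ) + b + c)) = T a b c := by
  have h := PhiL_X_pow ![T 0 0 0, T 0 0 1, T 0 1 1, T 1 1 1, T 1 1 2, T 1 2 2, T 2 2 2]
    ⟨(a : ℕ) + b + c, by omega⟩
  rw [h]
  have q0 := h02 0
  have q1 := h02 1
  have q2 := h02 2
  have s1 := hT.1
  have s2 := hT.2
  have e1 := s1 1 0 0
  have e2 := s2 0 1 0
  have e3 := s1 1 0 1
  have e4 := s2 1 1 0
  have e5 := s1 2 0 0
  have e6 := s2 0 2 0
  have e7 := s1 2 0 1
  have e8 := s2 0 2 1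
  have e9 := s2 1 0 2
  have e10 := s2 1 2 0
  have e11 := s1 2 1 0
  have e12 := s1 1 0 2
  have e13 := s1 2 0 2
  have e14 := s2 2 2 0
  have e15 := s2 1 2 1
  have e16 := s1 2 1 1
  have e17 := s1 2 1 2
  have e18 := s2 2 2 1
  have e19 := s2 2 0 1
  fin_cases a <;> fin_cases b <;> fin_cases c <;> simp <;> grind

theorem eval_curve {k : Type} [Field k] (A : Matrix (Fin 3) (Fin 3) k) (f : MvPolynomial (Fin 3) k)
    (t : k) : (aeval (fun i => Polynomial.C (A 0 i) + Polynomial.X * Polynomial.C (A 1 i)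
      + Polynomial.X ^ 2 * Polynomial.C (A 2 i)) f).eval t
      = eval (A 0 + t • A 1 + t ^ 2 • A 2) f := by
  rw [← Polynomial.coe_aeval_eq_eval, ← AlgHom.comp_apply, comp_aeval, aeval_eq_eval]
  congr 2
  ext i
  simp
  ring

theorem upper {k : Type} [Field k] [IsAlgClosed k] [CharZero k] {F : MvPolynomial (Fin 3) k}
    (hF : F.IsHomogeneous 3) (hE : EssDep F) {V : Set (Fin 3 → k)} (hV : HomZariskiClosed V)
    (hne : V ≠ Set.univ) : OrkV 3 F V ≤ 5 := by
  classical
  obtain ⟨P, hP, rfl⟩ := hV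
  obtain ⟨f, hfP, x0, hx0⟩ : ∃ f ∈ P, ∃ x, eval x f ≠ 0 := by
    by_contra h
    push Not at h
    exact hne (Set.eq_univ_of_forall fun x p hp => h p hp x)
  have hf0 : f ≠ 0 := by rintro rfl; simp at hx0
  obtain ⟨e, hfe⟩ := hP f hfP
  obtain ⟨T, hT, hFT⟩ := exists_tensor hF
  obtain ⟨p, r, hr, hdet, hpf, hp0, hqp⟩ := exists_pencil hT hf0
  obtain ⟨A, B, κ, hBA, hA0, hκ, hG⟩ := normal_form (Sym6_symm r) hdet hp0 hqp
  have hS := SymT_tr B hT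
  have hN := InN_tr hBA (mem_NS.1 hr)
  rw [hG] at hN
  have hFz : F = cubF (trT B T) (fun a => linForm (A a)) := by
    rw [hFT, change_var hBA (X : Fin 3 → MvPolynomial (Fin 3) k), cubF_tr]
    rfl
  generalize trT B T = T' at hS hN hFz
  have h02 : ∀ c, T' 0 2 c = T' 1 1 c := by
    intro c
    have h := hN c
    simp [Fin.sum_univ_three] at h
    rw [hS.1 2 0 c] at h
    have h2 : 2 * κ * (T' 0 2 c - T' 1 1 c) = 0 := by linear_combination h
    have h3 := (mul_eq_zero.1 h2).resolve_left (mul_ne_zero two_ne_zero hκ)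
    exact sub_eq_zero.1 h3
  have hΦ := PhiL_tensor hS h02
  generalize PhiL ![T' 0 0 0, T' 0 0 1, T' 0 1 1, T' 1 1 1, T' 1 1 2, T' 1 2 2, T' 2 2 2] = Φ at hΦ
  have hlin : ∀ a, (linForm (A a)).IsHomogeneous 1 := by
    intro a
    refine IsHomogeneous.sum _ _ _ fun j _ => ?_
    simpa using (isHomogeneous_C (Fin 3) (A a j)).mul (isHomogeneous_X k j)
  obtain ⟨s, c, hs, hsb, hsΦ⟩ := sylvester Φ (by
    intro g hg hgh
    have hgs : g = ∑ j : Fin 3, Polynomial.C (g.coeff j) * Polynomial.X ^ (j : ℕ) := by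
      rw [Fin.sum_univ_eq_sum_range (fun j => Polynomial.C (g.coeff j) * Polynomial.X ^ j)]
      exact Polynomial.as_sum_range_C_mul_X_pow' g (by
        by_cases h0 : g = 0
        · simp [h0]
        · rw [Polynomial.natDegree_lt_iff_degree_lt h0]; exact_mod_cast hg)
    have hw := ess_tensor hE hS hlin hFz (fun j => g.coeff j) (by
      intro a b
      have h1 := hgh (Polynomial.X ^ ((a : ℕ) + b)) (by
        rw [Polynomial.degree_X_pow]
        have : (a : ℕ) + b < 5 := by omega
        exact_mod_cast this)
      rw [hgs, Finset.sum_mul, map_sum] at h1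
      rw [← h1]
      refine Finset.sum_congr rfl fun j _ => ?_
      rw [mul_assoc, ← pow_add, ← Polynomial.smul_eq_C_mul, map_smul, smul_eq_mul, ← hΦ]
      congr 3
      ring)
    rw [hgs]
    exact Finset.sum_eq_zero fun j _ => by rw [show g.coeff j = 0 from congrFun hw j]; simp)
    (aeval (fun i => Polynomial.C (A 0 i) + Polynomial.X * Polynomial.C (A 1 i)
      + Polynomial.X ^ 2 * Polynomial.C (A 2 i)) f) (by
      intro h
      have h1 := eval_curve A f 0
      rw [h] at h1
      simp [hA0] at h1
      exact hpf h1.symm)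
  simp only [eval_curve] at hsb
  set v : k → Fin 3 → k := fun t => A 0 + t • A 1 + t ^ 2 • A 2 with hv
  have hTs : ∀ a b d, T' a b d = ∑ t ∈ s, c t * t ^ ((a : ℕ) + b + d) := by
    intro a b d
    rw [← hΦ, hsΦ]
    · simp
    · rw [Polynomial.degree_X_pow]
      have : (a : ℕ) + b + d < 7 := by omega
      exact_mod_cast this
  have hvlin : ∀ t, linForm (v t) = linForm (A 0) + C t * linForm (A 1) + C t ^ 2 * linForm (A 2) := by
    intro t
    simp only [linForm, hv, Fin.sum_univ_three, Pi.add_apply, Pi.smul_apply, smul_eq_mul, map_add, map_mul,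
      map_pow]
    ring
  have hFs : F = ∑ t ∈ s, C (c t) * linForm (v t) ^ 3 := by
    rw [hFz, cubF]
    simp only [hTs, map_sum, Finset.sum_mul]
    simp only [Fin.sum_univ_three, ← Finset.sum_add_distrib]
    refine Finset.sum_congr rfl fun t _ => ?_
    rw [hvlin]
    simp
    ring
  choose ρ hρ using fun t => IsAlgClosed.exists_pow_nat_eq (c t) (n := 3) (by norm_num)
  set s' := s.filter (fun t => c t ≠ 0) with hs'
  have hFs' : F = ∑ t ∈ s', linForm (ρ t • v t) ^ 3 := by
    rw [hFs, hs', Finset.sum_filter]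
    refine Finset.sum_congr rfl fun t _ => ?_
    split_ifs with h
    · rw [linForm_smul, mul_pow, ← map_pow, hρ]
    · push Not at h
      simp [h]
  have hcard : s'.card ≤ 5 := hs ▸ Finset.card_filter_le _ _
  refine le_trans (sInf_le ⟨s'.card, ⟨fun i => ρ (s'.equivFin.symm i) • v (s'.equivFin.symm i), ?_, ?_⟩, rfl⟩) ?_
  · intro i hi
    have h1 := hi f hfP
    rw [hom_eval_smul hfe] at h1
    have h2 := Finset.mem_filter.1 (s'.equivFin.symm i).2
    refine mul_ne_zero (pow_ne_zero _ ?_) (hsb _ h2.1) h1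
    intro h
    apply h2.2
    rw [← hρ, h]; simp
  · rw [hFs', ← Finset.sum_coe_sort]
    exact (Equiv.sum_comp s'.equivFin.symm (fun t : s' => linForm (ρ t • v t) ^ 3)).symm
  · change ((s'.card : ℕ) : ℕ∞) ≤ 5
    exact_mod_cast hcard

theorem lin_rep {k : Type} [Field k] {y : MvPolynomial (Fin 3) k} (hy : y.IsHomogeneous 1) :
    ∃ u : Fin 3 → k, y = linForm u := by
  have hc : ∀ a, ∃ u : k, pderiv a y = C u := by
    intro a
    exact ⟨_, MvPolynomial.totalDegree_eq_zero_iff_eq_C.1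
      (Nat.le_zero.1 (hy.pderiv (i := a)).totalDegree_le)⟩
  choose u hu using hc
  refine ⟨u, ?_⟩
  have := hy.sum_X_mul_pderiv
  simp only [hu, one_smul] at this
  rw [← this, linForm]
  exact Finset.sum_congr rfl fun i _ => mul_comm _ _

theorem eval_linForm {k : Type} [Field k] (u p : Fin 3 → k) :
    eval p (linForm u) = u ⬝ᵥ p := by
  simp [linForm, dotProduct]

/-- The extremal cubic. -/
noncomputable def exF (k : Type) [Field k] : MvPolynomial (Fin 3) k := X 0 ^ 2 * X 1 + X 2 ^ 3

theorem exF_hom (k : Type) [Field k] : (exF k).IsHomogeneous 3 :=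
  (((isHomogeneous_X k (0 : Fin 3)).pow 2).mul (isHomogeneous_X k 1)).add
    ((isHomogeneous_X k (2 : Fin 3)).pow 3)

theorem exF_ess (k : Type) [Field k] [CharZero k] : EssDep (exF k) := by
  rintro m hm ⟨y, hy, G, hG⟩
  choose u hu using fun j => lin_rep (hy j)
  let L : (Fin 3 → k) →ₗ[k] (Fin m → k) := Matrix.mulVecLin (Matrix.of u)
  have := LinearMap.ker_ne_bot_of_finrank_lt (f := L) (by simpa using hm)
  obtain ⟨w, hw, hw0⟩ := (Submodule.ne_bot_iff _).1 this
  rw [LinearMap.mem_ker] at hw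
  have hw1 : ∀ j, u j ⬝ᵥ w = 0 := fun j => congrFun hw j
  have hev : ∀ p, eval p (exF k) = eval (fun j => u j ⬝ᵥ p) G := by
    intro p
    rw [hG, ← coe_aeval_eq_eval, RingHom.coe_coe, ← AlgHom.comp_apply, comp_aeval, aeval_eq_eval]
    congr 2
    ext j
    rw [hu, ← eval_linForm, ← aeval_eq_eval]
  have hinv : ∀ p, eval (p + w) (exF k) = eval p (exF k) := by
    intro p
    rw [hev, hev]
    simp [dotProduct_add, hw1]
  have hinv2 : ∀ p : Fin 3 → k, (p 0 + w 0) ^ 2 * (p 1 + w 1) + (p 2 + w 2) ^ 3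
      = p 0 ^ 2 * p 1 + p 2 ^ 3 := by
    intro p
    simpa [exF] using hinv p
  have e0 := hinv2 ![0, 0, 0]
  have e1 := hinv2 ![1, 0, 0]
  have e2 := hinv2 ![-1, 0, 0]
  have e3 := hinv2 ![0, 1, 0]
  simp at e0 e1 e2 e3
  have h1 : w 1 = 0 := by
    have h2 : 2 * w 1 = 0 := by linear_combination e1 + e2 - 2 * e0
    simpa using h2
  rw [h1] at e0 e3
  have h2 : w 2 = 0 := by simpa using e0
  rw [h2] at e3
  have h0 : w 0 = 0 := by simpa using e3
  apply hw0
  ext i; fin_cases i <;> simp [h0, h1, h2]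

theorem moments {k : Type} [Field k] [CharZero k] {m : ℕ} (l : Fin m → Fin 3 → k)
    (h : exF k = ∑ i, linForm (l i) ^ 3) :
    ∑ i, l i 0 ^ 3 = 0 ∧ ∑ i, l i 1 ^ 3 = 0 ∧ ∑ i, l i 2 ^ 3 = 1 ∧
    3 * ∑ i, l i 0 ^ 2 * l i 1 = 1 ∧ ∑ i, l i 0 * l i 1 ^ 2 = 0 ∧
    ∑ i, l i 0 ^ 2 * l i 2 = 0 ∧ ∑ i, l i 0 * l i 2 ^ 2 = 0 ∧
    ∑ i, l i 1 ^ 2 * l i 2 = 0 ∧ ∑ i, l i 1 * l i 2 ^ 2 = 0 ∧ ∑ i, l i 0 * l i 1 * l i 2 = 0 := by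
  have hx : ∀ x y z : k, x ^ 2 * y + z ^ 3 = x ^ 3 * ∑ i, l i 0 ^ 3 + y ^ 3 * ∑ i, l i 1 ^ 3
      + z ^ 3 * ∑ i, l i 2 ^ 3 + 3 * x ^ 2 * y * ∑ i, l i 0 ^ 2 * l i 1
      + 3 * x * y ^ 2 * ∑ i, l i 0 * l i 1 ^ 2 + 3 * x ^ 2 * z * ∑ i, l i 0 ^ 2 * l i 2
      + 3 * x * z ^ 2 * ∑ i, l i 0 * l i 2 ^ 2 + 3 * y ^ 2 * z * ∑ i, l i 1 ^ 2 * l i 2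
      + 3 * y * z ^ 2 * ∑ i, l i 1 * l i 2 ^ 2 + 6 * x * y * z * ∑ i, l i 0 * l i 1 * l i 2 := by
    intro x y z
    have h1 := congrArg (eval ![x, y, z]) h
    simp only [map_sum, map_pow, eval_linForm] at h1
    have h2 : eval ![x, y, z] (exF k) = x ^ 2 * y + z ^ 3 := by simp [exF]
    rw [← h2, h1]
    simp only [Finset.mul_sum, ← Finset.sum_add_distrib]
    refine Finset.sum_congr rfl fun i _ => ?_
    simp [dotProduct, Fin.sum_univ_three]
    ring
  generalize ∑ i, l i 0 ^ 3 = s1 at *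
  generalize ∑ i, l i 1 ^ 3 = s2 at *
  generalize ∑ i, l i 2 ^ 3 = s3 at *
  generalize ∑ i, l i 0 ^ 2 * l i 1 = s4 at *
  generalize ∑ i, l i 0 * l i 1 ^ 2 = s5 at *
  generalize ∑ i, l i 0 ^ 2 * l i 2 = s6 at *
  generalize ∑ i, l i 0 * l i 2 ^ 2 = s7 at *
  generalize ∑ i, l i 1 ^ 2 * l i 2 = s8 at *
  generalize ∑ i, l i 1 * l i 2 ^ 2 = s9 at *
  generalize ∑ i, l i 0 * l i 1 * l i 2 = s10 at *
  have h1 : s1 = 0 := by linear_combination -hx 1 0 0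
  have h2 : s2 = 0 := by linear_combination -hx 0 1 0
  have h3 : s3 = 1 := by linear_combination -hx 0 0 1
  subst h1 h2 h3
  have p1 := hx 1 1 0
  have p2 := hx 1 (-1) 0
  have p3 := hx 1 0 1
  have p4 := hx 1 0 (-1)
  have p5 := hx 0 1 1
  have p6 := hx 0 1 (-1)
  have p7 := hx 1 1 1
  have h4 : 3 * s4 = 1 := by linear_combination (-p1 + p2) / 2
  have h5 : s5 = 0 := by linear_combination (-p1 - p2) / 6
  have h6 : s6 = 0 := by linear_combination (-p3 + p4) / 6
  have h7 : s7 = 0 := by linear_combination (-p3 - p4) / 6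
  have h8 : s8 = 0 := by linear_combination (-p5 + p6) / 6
  have h9 : s9 = 0 := by linear_combination (-p5 - p6) / 6
  refine ⟨rfl, rfl, rfl, h4, h5, h6, h7, h8, h9, ?_⟩
  linear_combination (-p7 - h4 - 3 * h5 - 3 * h6 - 3 * h7 - 3 * h8 - 3 * h9) / 6

theorem lower_card {k : Type} [Field k] [CharZero k] {m : ℕ} (l : Fin m → Fin 3 → k)
    (hl : ∀ i, l i 2 ≠ 0) (h : exF k = ∑ i, linForm (l i) ^ 3) : 5 ≤ m := by
  obtain ⟨h1, h2, h3, h4, h5, h6, h7, h8, h9, h10⟩ := moments l h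
  have hli : LinearIndependent k (![fun i => l i 2 ^ 2, fun i => l i 0 ^ 2, fun i => l i 0 * l i 1,
      fun i => l i 0 * l i 2, fun i => l i 1 * l i 2] : Fin 5 → Fin m → k) := by
    rw [Fintype.linearIndependent_iff]
    intro x hx
    have hx2 : ∀ i, x 0 * l i 2 ^ 2 + x 1 * l i 0 ^ 2 + x 2 * (l i 0 * l i 1) + x 3 * (l i 0 * l i 2)
        + x 4 * (l i 1 * l i 2) = 0 := by
      intro i
      have := congrFun hx i
      simpa [Fin.sum_univ_five] using this
    have key : ∀ r : Fin m → k, ∑ i, r i * (x 0 * l i 2 ^ 2 + x 1 * l i 0 ^ 2 + x 2 * (l i 0 * l i 1)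
        + x 3 * (l i 0 * l i 2) + x 4 * (l i 1 * l i 2)) = 0 := by
      intro r
      simp [hx2]
    have x0 : x 0 = 0 := by
      have e : ∑ i, l i 2 * (x 0 * l i 2 ^ 2 + x 1 * l i 0 ^ 2 + x 2 * (l i 0 * l i 1)
          + x 3 * (l i 0 * l i 2) + x 4 * (l i 1 * l i 2)) = x 0 * ∑ i, l i 2 ^ 3
          + x 1 * ∑ i, l i 0 ^ 2 * l i 2 + x 2 * ∑ i, l i 0 * l i 1 * l i 2
          + x 3 * ∑ i, l i 0 * l i 2 ^ 2 + x 4 * ∑ i, l i 1 * l i 2 ^ 2 := by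
        simp only [Finset.mul_sum, ← Finset.sum_add_distrib]
        exact Finset.sum_congr rfl fun i _ => by ring
      rw [key] at e
      linear_combination -e - x 0 * h3 - x 1 * h6 - x 2 * h10 - x 3 * h7 - x 4 * h9
    have x1 : x 1 = 0 := by
      have e : ∑ i, l i 1 * (x 0 * l i 2 ^ 2 + x 1 * l i 0 ^ 2 + x 2 * (l i 0 * l i 1)
          + x 3 * (l i 0 * l i 2) + x 4 * (l i 1 * l i 2)) = x 0 * ∑ i, l i 1 * l i 2 ^ 2
          + x 1 * ∑ i, l i 0 ^ 2 * l i 1 + x 2 * ∑ i, l i 0 * l i 1 ^ 2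
          + x 3 * ∑ i, l i 0 * l i 1 * l i 2 + x 4 * ∑ i, l i 1 ^ 2 * l i 2 := by
        simp only [Finset.mul_sum, ← Finset.sum_add_distrib]
        exact Finset.sum_congr rfl fun i _ => by ring
      rw [key] at e
      linear_combination -3 * e - 3 * x 0 * h9 - x 1 * h4 - 3 * x 2 * h5 - 3 * x 3 * h10 - 3 * x 4 * h8
    have x2 : x 2 = 0 := by
      have e : ∑ i, l i 0 * (x 0 * l i 2 ^ 2 + x 1 * l i 0 ^ 2 + x 2 * (l i 0 * l i 1)
          + x 3 * (l i 0 * l i 2) + x 4 * (l i 1 * l i 2)) = x 0 * ∑ i, l i 0 * l i 2 ^ 2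
          + x 1 * ∑ i, l i 0 ^ 3 + x 2 * ∑ i, l i 0 ^ 2 * l i 1
          + x 3 * ∑ i, l i 0 ^ 2 * l i 2 + x 4 * ∑ i, l i 0 * l i 1 * l i 2 := by
        simp only [Finset.mul_sum, ← Finset.sum_add_distrib]
        exact Finset.sum_congr rfl fun i _ => by ring
      rw [key] at e
      linear_combination -3 * e - 3 * x 0 * h7 - 3 * x 1 * h1 - x 2 * h4 - 3 * x 3 * h6 - 3 * x 4 * h10
    have hab : ∀ i, x 3 * l i 0 + x 4 * l i 1 = 0 := by
      intro i
      apply mul_right_cancel₀ (hl i)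
      have := hx2 i
      rw [x0, x1, x2] at this
      linear_combination this
    have key2 : ∀ r : Fin m → k, ∑ i, r i * (x 3 * l i 0 + x 4 * l i 1) = 0 := by
      intro r
      simp [hab]
    have x3 : x 3 = 0 := by
      have e : ∑ i, l i 0 * l i 1 * (x 3 * l i 0 + x 4 * l i 1) = x 3 * ∑ i, l i 0 ^ 2 * l i 1
          + x 4 * ∑ i, l i 0 * l i 1 ^ 2 := by
        simp only [Finset.mul_sum, ← Finset.sum_add_distrib]
        exact Finset.sum_congr rfl fun i _ => by ring
      rw [key2 (fun i => l i 0 * l i 1)] at e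
      linear_combination -3 * e - x 3 * h4 - 3 * x 4 * h5
    have x4 : x 4 = 0 := by
      have e : ∑ i, l i 0 ^ 2 * (x 3 * l i 0 + x 4 * l i 1) = x 3 * ∑ i, l i 0 ^ 3
          + x 4 * ∑ i, l i 0 ^ 2 * l i 1 := by
        simp only [Finset.mul_sum, ← Finset.sum_add_distrib]
        exact Finset.sum_congr rfl fun i _ => by ring
      rw [key2 (fun i => l i 0 ^ 2)] at e
      linear_combination -3 * e - 3 * x 3 * h1 - x 4 * h4
    intro i
    fin_cases i <;> assumption
  simpa using hli.fintype_card_le_finrank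

theorem lower (k : Type) [Field k] [CharZero k] :
    ∃ V : Set (Fin 3 → k), (HomZariskiClosed V ∧ V ≠ Set.univ) ∧ 5 ≤ OrkV 3 (exF k) V := by
  refine ⟨{a | ∀ p ∈ ({X 2} : Set (MvPolynomial (Fin 3) k)), eval a p = 0}, ⟨⟨{X 2}, ?_, rfl⟩, ?_⟩, ?_⟩
  · rintro p rfl
    exact ⟨1, isHomogeneous_X k 2⟩
  · intro h
    have : (![0, 0, 1] : Fin 3 → k) ∈ {a | ∀ p ∈ ({X 2} : Set (MvPolynomial (Fin 3) k)), eval a p = 0} := by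
      rw [h]; trivial
    have := this (X 2) rfl
    simp at this
  · refine le_sInf ?_
    rintro _ ⟨m, ⟨l, hl, hF⟩, rfl⟩
    have : 5 ≤ m := lower_card l (fun i h => hl i (by rintro p rfl; simpa using h)) hF
    change (5 : ℕ∞) ≤ (m : ℕ∞)
    exact_mod_cast this


/-- The open Waring rank of ternary cubics satisfies `Ork(3, 3) = 5`. -/
theorem stmt_4 (k : Type) [Field k] [IsAlgClosed k] [CharZero k] :
    OrkND k 3 3 = 5 := by
  apply le_antisymm
  · refine iSup_le fun F => iSup_le fun V => ?_
    exact upper F.2.1 F.2.2 V.2.1 V.2.2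
  · obtain ⟨V, hV, h5⟩ := lower k
    refine h5.trans ?_
    refine le_trans ?_ (le_iSup (fun F : {F : MvPolynomial (Fin 3) k // F.IsHomogeneous 3 ∧ EssDep F} =>
      Ork 3 F.1) ⟨exF k, exF_hom k, exF_ess k⟩)
    exact le_iSup (fun V : {V : Set (Fin 3 → k) // HomZariskiClosed V ∧ V ≠ Set.univ} =>
      OrkV 3 (exF k) V.1) ⟨V, hV⟩
end

section
/- For all integers n ≥ 3 and d ≥ 3, the open Waring rank satisfies Ork(n, d) ≤ binom(n+d-2, d-1) − binom(n+d-6, d-3). -/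
open MvPolynomial

namespace Waring

section Basics

variable {k : Type} [Field k] {N : ℕ}

/-- `linForm` as a linear map. -/
lemma linForm_add (a b : Fin N → k) : linForm (a + b) = linForm a + linForm b := by
  simp [linForm, add_mul, Finset.sum_add_distrib]

lemma linForm_smul (c : k) (a : Fin N → k) : linForm (c • a) = c • linForm a := by
  simp [linForm, Finset.smul_sum, MvPolynomial.smul_eq_C_mul, mul_assoc]

lemma linForm_zero : linForm (0 : Fin N → k) = 0 := by
  simp [linForm]

lemma linForm_sub (a b : Fin N → k) : linForm (a - b) = linForm a - linForm b := by
  simp [linForm, sub_mul, Finset.sum_sub_distrib]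

lemma coeff_linForm (a : Fin N → k) (i : Fin N) :
    coeff (Finsupp.single i 1) (linForm a) = a i := by
  simp [linForm, coeff_sum, coeff_C_mul, coeff_X, Finsupp.single_left_inj]

lemma linForm_inj {a b : Fin N → k} (h : linForm a = linForm b) : a = b := by
  funext i
  rw [← coeff_linForm a i, h, coeff_linForm]

lemma linForm_ne_zero {a : Fin N → k} (h : a ≠ 0) : linForm a ≠ 0 := by
  intro h0
  exact h (linForm_inj (h0.trans linForm_zero.symm))

lemma eval_linForm (a l : Fin N → k) : eval l (linForm a) = a ⬝ᵥ l := by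
  simp [linForm, dotProduct]

lemma linForm_isHomogeneous (a : Fin N → k) : (linForm a).IsHomogeneous 1 := by
  unfold linForm
  refine IsHomogeneous.sum _ _ _ fun i _ => ?_
  simpa using (isHomogeneous_C (Fin N) (a i)).mul (isHomogeneous_X k i)

/-- Directional derivative. -/
noncomputable def D (a : Fin N → k) : Derivation k (MvPolynomial (Fin N) k) (MvPolynomial (Fin N) k) :=
  mkDerivation k (fun i => C (a i))

lemma D_X (a : Fin N → k) (i : Fin N) : D a (X i) = C (a i) := by
  simp [D, mkDerivation_X]

lemma D_linForm (a l : Fin N → k) : D a (linForm l) = C (a ⬝ᵥ l) := by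
  simp only [linForm, map_sum, ← smul_eq_C_mul, Derivation.map_smul, D_X, dotProduct]
  simp [smul_eq_C_mul, mul_comm]

lemma D_add (a b : Fin N → k) (F : MvPolynomial (Fin N) k) : D (a + b) F = D a F + D b F := by
  have : D (a + b) = D a + D b := by
    apply derivation_ext
    intro i
    simp [D_X]
  rw [this]; rfl

lemma D_smul (c : k) (a : Fin N → k) (F : MvPolynomial (Fin N) k) : D (c • a) F = c • D a F := by
  have : D (c • a) = c • D a := by
    apply derivation_ext
    intro i
    simp [D_X, smul_eq_C_mul]
  rw [this]; rfl

lemma D_comm (a b : Fin N → k) (F : MvPolynomial (Fin N) k) : D a (D b F) = D b (D a F) := by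
  have : ⁅D a, D b⁆ = 0 := by
    apply derivation_ext
    intro i
    simp [Derivation.commutator_apply, D_X]
  have h2 := congrArg (fun E => E F) this
  simp only [Derivation.commutator_apply] at h2
  exact sub_eq_zero.mp h2

/-- `D` as a linear map in the direction. -/
noncomputable def DL (F : MvPolynomial (Fin N) k) : (Fin N → k) →ₗ[k] MvPolynomial (Fin N) k where
  toFun a := D a F
  map_add' a b := D_add a b F
  map_smul' c a := D_smul c a F

lemma D_pow (a l : Fin N → k) (d : ℕ) :
    D a (linForm l ^ (d + 1)) = ((d + 1 : k) * (a ⬝ᵥ l)) • linForm l ^ d := by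
  rw [Derivation.leibniz_pow, D_linForm]
  simp only [Nat.add_sub_cancel, smul_eq_mul, smul_eq_C_mul, nsmul_eq_mul, map_mul, map_add, map_one, map_natCast]
  push_cast
  ring

/-- Forms of degree `d` in the linear forms from `W`. -/
noncomputable def P (d : ℕ) (W : Submodule k (Fin N → k)) : Submodule k (MvPolynomial (Fin N) k) :=
  Submodule.span k ((fun a => linForm a ^ d) '' (W : Set (Fin N → k)))

lemma pow_mem_P {W : Submodule k (Fin N → k)} {l : Fin N → k} (hl : l ∈ W) (d : ℕ) :
    linForm l ^ d ∈ P d W := Submodule.subset_span ⟨l, hl, rfl⟩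

lemma P_mono (d : ℕ) {W W' : Submodule k (Fin N → k)} (h : W ≤ W') : P d W ≤ P d W' :=
  Submodule.span_mono (Set.image_mono h)

lemma P_induction {d : ℕ} {W : Submodule k (Fin N → k)} {p : MvPolynomial (Fin N) k → Prop}
    (hpow : ∀ l ∈ W, p (linForm l ^ d)) (h0 : p 0) (hadd : ∀ F G, p F → p G → p (F + G))
    (hsmul : ∀ (c : k) F, p F → p (c • F)) {F : MvPolynomial (Fin N) k} (hF : F ∈ P d W) : p F := by
  unfold P at hF
  induction hF using Submodule.span_induction with
  | mem x hx => obtain ⟨l, hl, rfl⟩ := hx; exact hpow l hl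
  | zero => exact h0
  | add x y _ _ hx hy => exact hadd x y hx hy
  | smul c x _ hx => exact hsmul c x hx

lemma D_mem_P {d : ℕ} {W : Submodule k (Fin N → k)} (a : Fin N → k) {F : MvPolynomial (Fin N) k}
    (hF : F ∈ P (d + 1) W) : D a F ∈ P d W := by
  refine P_induction (p := fun F => D a F ∈ P d W) ?_ ?_ ?_ ?_ hF
  · intro l hl
    rw [D_pow]
    exact Submodule.smul_mem _ _ (pow_mem_P hl d)
  · simp
  · intro F G hF hG; rw [map_add]; exact add_mem hF hG
  · intro c F hF; rw [Derivation.map_smul]; exact Submodule.smul_mem _ _ hF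

lemma D_eq_zero_of_mem {d : ℕ} {W : Submodule k (Fin N → k)} {a : Fin N → k}
    (ha : ∀ l ∈ W, a ⬝ᵥ l = 0) {F : MvPolynomial (Fin N) k}
    (hF : F ∈ P d W) : D a F = 0 := by
  refine P_induction (p := fun F => D a F = 0) ?_ ?_ ?_ ?_ hF
  · intro l hl
    cases d with
    | zero => simp
    | succ d => rw [D_pow, ha l hl]; simp
  · simp
  · intro F G hF hG; rw [map_add, hF, hG, add_zero]
  · intro c F hF; rw [Derivation.map_smul, hF, smul_zero]

lemma mem_P_one {W : Submodule k (Fin N → k)} {F : MvPolynomial (Fin N) k} (hF : F ∈ P 1 W) :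
    ∃ l ∈ W, F = linForm l := by
  refine P_induction (p := fun F => ∃ l ∈ W, F = linForm l) ?_ ?_ ?_ ?_ hF
  · intro l hl; exact ⟨l, hl, pow_one _⟩
  · exact ⟨0, W.zero_mem, linForm_zero.symm⟩
  · rintro _ _ ⟨l, hl, rfl⟩ ⟨m, hm, rfl⟩; exact ⟨l + m, add_mem hl hm, (linForm_add _ _).symm⟩
  · rintro c _ ⟨l, hl, rfl⟩; exact ⟨c • l, W.smul_mem c hl, (linForm_smul _ _).symm⟩

lemma euler {d : ℕ} {W : Submodule k (Fin N → k)} {F : MvPolynomial (Fin N) k} (hF : F ∈ P d W) :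
    ∑ i, X i * D (Pi.single i 1) F = (d : k) • F := by
  refine P_induction (p := fun F => ∑ i, X i * D (Pi.single i 1) F = (d : k) • F) ?_ ?_ ?_ ?_ hF
  · intro l hl
    cases d with
    | zero => simp
    | succ d =>
      simp only [D_pow, single_dotProduct, one_mul, smul_eq_C_mul]
      have : ∑ i, X i * (C ((d + 1 : k) * l i) * linForm l ^ d)
          = C (d + 1 : k) * linForm l ^ d * linForm l := by
        conv_rhs => rw [linForm]
        rw [Finset.mul_sum]
        refine Finset.sum_congr rfl fun i _ => ?_
        rw [← linForm, map_mul]; ring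
      rw [this]; push_cast; ring
  · simp
  · intro F G hF hG
    simp only [map_add, mul_add, Finset.sum_add_distrib, hF, hG, smul_add]
  · intro c F hF
    simp only [Derivation.map_smul, mul_smul_comm, ← Finset.smul_sum, hF]
    rw [smul_comm]

lemma eq_zero_of_D [CharZero k] {d : ℕ} {W : Submodule k (Fin N → k)} {F : MvPolynomial (Fin N) k}
    (hF : F ∈ P (d + 1) W) (h : ∀ a, D a F = 0) : F = 0 := by
  have := euler hF
  simp only [h, mul_zero, Finset.sum_const_zero] at this
  rcases smul_eq_zero.mp this.symm with h | h
  · exact absurd h (by exact_mod_cast Nat.succ_ne_zero d)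
  · exact h

/-- The hyperplane orthogonal to `a`. -/
noncomputable def kerv (a : Fin N → k) : Submodule k (Fin N → k) where
  carrier := {x | a ⬝ᵥ x = 0}
  add_mem' := by intro x y hx hy; simp only [Set.mem_ofPred_eq] at *; rw [dotProduct_add, hx, hy, add_zero]
  zero_mem' := by simp
  smul_mem' := by intro c x hx; simp only [Set.mem_ofPred_eq] at *; rw [dotProduct_smul, hx, smul_zero]

lemma mem_kerv {a x : Fin N → k} : x ∈ kerv a ↔ a ⬝ᵥ x = 0 := Iff.rfl

lemma exists_dot (f : (Fin N → k) →ₗ[k] k) : ∃ a : Fin N → k, ∀ x, a ⬝ᵥ x = f x := by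
  refine ⟨fun i => f (Pi.single i 1), fun x => ?_⟩
  conv_rhs => rw [← Finset.univ_sum_single x]
  rw [map_sum, dotProduct]
  refine Finset.sum_congr rfl fun i _ => ?_
  have : (Pi.single i (x i) : Fin N → k) = x i • Pi.single i 1 := by
    rw [← Pi.single_smul]; simp
  rw [this, map_smul, smul_eq_mul, mul_comm]

lemma exists_sep {W : Submodule k (Fin N → k)} {l : Fin N → k} (hl : l ∉ W) :
    ∃ a : Fin N → k, (∀ x ∈ W, a ⬝ᵥ x = 0) ∧ a ⬝ᵥ l ≠ 0 := by
  obtain ⟨f, hf, hW⟩ := Submodule.exists_le_ker_of_notMem hl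
  obtain ⟨a, ha⟩ := exists_dot f
  refine ⟨a, fun x hx => ?_, ?_⟩
  · rw [ha]; exact hW hx
  · rwa [ha]

/-- Taylor: if the derivative along `a` vanishes, one may project. -/
lemma mem_P_kerv [CharZero k] {d : ℕ} {W : Submodule k (Fin N → k)} {F : MvPolynomial (Fin N) k}
    (hF : F ∈ P d W) {a : Fin N → k} (ha : D a F = 0) : F ∈ P d (W ⊓ kerv a) := by
  by_cases hW : ∀ l ∈ W, a ⬝ᵥ l = 0
  · exact P_mono d (le_inf le_rfl hW) hF
  push Not at hW
  obtain ⟨w0, hw0, hne⟩ := hW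
  obtain ⟨w, hw, haw⟩ : ∃ w ∈ W, a ⬝ᵥ w = 1 :=
    ⟨(a ⬝ᵥ w0)⁻¹ • w0, W.smul_mem _ hw0, by rw [dotProduct_smul, smul_eq_mul, inv_mul_cancel₀ hne]⟩
  -- the iterated derivative as a linear map
  let T : MvPolynomial (Fin N) k →ₗ[k] MvPolynomial (Fin N) k :=
    ∑ j ∈ Finset.range (d + 1), ((-1) ^ j / (j.factorial : k)) •
      ((LinearMap.mulLeft k (linForm w ^ j)) ∘ₗ ((D a : MvPolynomial (Fin N) k →ₗ[k] _) ^ j))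
  have hT1 : T F = F := by
    simp only [T, LinearMap.sum_apply]
    rw [Finset.sum_range_succ']
    rw [Finset.sum_eq_zero]
    · simp
    · intro j _
      simp only [LinearMap.smul_apply, LinearMap.comp_apply, pow_succ, Module.End.mul_apply]
      simp [ha]
  have hiter : ∀ j : ℕ, j ≤ d → ∀ l, ((D a : MvPolynomial (Fin N) k →ₗ[k] _) ^ j) (linForm l ^ d)
      = ((d.descFactorial j : k) * (a ⬝ᵥ l) ^ j) • linForm l ^ (d - j) := by
    intro j
    induction j with
    | zero => intro _ l; simp
    | succ j ih =>
      intro hj l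
      rw [pow_succ', Module.End.mul_apply, ih (by omega), map_smul]
      obtain ⟨m, hm⟩ : ∃ m, d - j = m + 1 := ⟨d - j - 1, by omega⟩
      have hm2 : d - (j + 1) = m := by omega
      rw [hm, hm2, Derivation.coeFn_coe, D_pow, smul_smul, Nat.descFactorial_succ, hm]
      congr 1
      push_cast
      ring
  have hT2 : T F ∈ P d (W ⊓ kerv a) := by
    refine P_induction (p := fun F => T F ∈ P d (W ⊓ kerv a)) ?_ ?_ ?_ ?_ hF
    · intro l hl
      have : T (linForm l ^ d) = linForm (l - (a ⬝ᵥ l) • w) ^ d := by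
        rw [linForm_sub, linForm_smul, sub_eq_neg_add, add_pow]
        simp only [T, LinearMap.sum_apply]
        refine Finset.sum_congr rfl fun j hj => ?_
        have hj' : j ≤ d := by simpa [Nat.lt_succ_iff] using hj
        rw [LinearMap.smul_apply, LinearMap.comp_apply, hiter j hj', LinearMap.mulLeft_apply]
        have hfac : (j.factorial : k) ≠ 0 := by exact_mod_cast j.factorial_ne_zero
        have hc : ((-1) ^ j / (j.factorial : k)) * ((d.descFactorial j : k) * (a ⬝ᵥ l) ^ j)
            = (-(a ⬝ᵥ l)) ^ j * (d.choose j : k) := by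
          rw [Nat.descFactorial_eq_factorial_mul_choose, neg_pow (a ⬝ᵥ l)]
          push_cast
          field_simp
        rw [mul_smul_comm, smul_smul, hc, smul_eq_C_mul, smul_eq_C_mul]
        simp only [map_mul, map_pow, map_neg, map_natCast]
        ring
      rw [this]
      refine pow_mem_P (Submodule.mem_inf.mpr ⟨sub_mem hl (W.smul_mem _ hw), ?_⟩) d
      rw [mem_kerv, dotProduct_sub, dotProduct_smul, haw, smul_eq_mul, mul_one, sub_self]
    · simp
    · intro F G hF hG; rw [map_add]; exact add_mem hF hG
    · intro c F hF; rw [map_smul]; exact Submodule.smul_mem _ _ hF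
  rwa [hT1] at hT2

end Basics



section Generic

variable {k : Type} [Field k] {M N : ℕ}

/-- Polynomial functions on `k^M`. -/
def IsPoly (f : (Fin M → k) → k) : Prop := ∃ p : MvPolynomial (Fin M) k, ∀ a, f a = eval a p

lemma IsPoly.const (c : k) : IsPoly (fun _ : Fin M → k => c) := ⟨C c, by simp⟩

lemma IsPoly.coord (i : Fin M) : IsPoly (fun a : Fin M → k => a i) := ⟨X i, by simp⟩

lemma IsPoly.add {f g : (Fin M → k) → k} (hf : IsPoly f) (hg : IsPoly g) :
    IsPoly (fun a => f a + g a) := by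
  obtain ⟨p, hp⟩ := hf
  obtain ⟨q, hq⟩ := hg
  exact ⟨p + q, fun a => by simp [hp, hq]⟩

lemma IsPoly.mul {f g : (Fin M → k) → k} (hf : IsPoly f) (hg : IsPoly g) :
    IsPoly (fun a => f a * g a) := by
  obtain ⟨p, hp⟩ := hf
  obtain ⟨q, hq⟩ := hg
  exact ⟨p * q, fun a => by simp [hp, hq]⟩

lemma IsPoly.neg {f : (Fin M → k) → k} (hf : IsPoly f) : IsPoly (fun a => - f a) := by
  obtain ⟨p, hp⟩ := hf
  exact ⟨-p, fun a => by simp [hp]⟩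

lemma IsPoly.sub {f g : (Fin M → k) → k} (hf : IsPoly f) (hg : IsPoly g) :
    IsPoly (fun a => f a - g a) := by
  obtain ⟨p, hp⟩ := hf
  obtain ⟨q, hq⟩ := hg
  exact ⟨p - q, fun a => by simp [hp, hq]⟩

lemma IsPoly.pow {f : (Fin M → k) → k} (hf : IsPoly f) (n : ℕ) : IsPoly (fun a => f a ^ n) := by
  obtain ⟨p, hp⟩ := hf
  exact ⟨p ^ n, fun a => by simp [hp]⟩

lemma IsPoly.sum {ι : Type} (s : Finset ι) {f : ι → (Fin M → k) → k} (hf : ∀ i ∈ s, IsPoly (f i)) :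
    IsPoly (fun a => ∑ i ∈ s, f i a) := by
  classical
  induction s using Finset.induction_on with
  | empty => simpa using IsPoly.const 0
  | insert i s his ih =>
    simp only [Finset.sum_insert his]
    exact (hf i (by simp)).add (ih fun j hj => hf j (by simp [hj]))

lemma IsPoly.linear (f : (Fin M → k) →ₗ[k] k) : IsPoly (fun a => f a) := by
  obtain ⟨b, hb⟩ := exists_dot f
  refine ⟨linForm b, fun a => ?_⟩
  rw [eval_linForm, hb]

lemma IsPoly.comp (h : MvPolynomial (Fin N) k) {v : (Fin M → k) → (Fin N → k)}
    (hv : ∀ i, IsPoly (fun a => v a i)) : IsPoly (fun a => eval (v a) h) := by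
  choose p hp using hv
  refine ⟨bind₁ p h, fun a => ?_⟩
  have : (fun i => eval a (p i)) = v a := by funext i; rw [← hp]
  change eval (v a) h = _
  rw [← this]
  exact (eval₂Hom_bind₁ (RingHom.id k) a p h).symm

/-- Polynomial functions that are not identically zero. -/
def NZ (f : (Fin M → k) → k) : Prop := IsPoly f ∧ ∃ a, f a ≠ 0

lemma NZ.mul [Infinite k] {f g : (Fin M → k) → k} (hf : NZ f) (hg : NZ g) :
    NZ (fun a => f a * g a) := by
  obtain ⟨⟨p, hp⟩, a, ha⟩ := hf
  obtain ⟨⟨q, hq⟩, b, hb⟩ := hg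
  refine ⟨⟨p * q, fun a => by simp [hp, hq]⟩, ?_⟩
  by_contra hcon
  push Not at hcon
  have : p * q = 0 := MvPolynomial.funext fun x => by
    have := hcon x
    rw [hp, hq] at this
    simpa using this
  rcases mul_eq_zero.mp this with h | h
  · apply ha; rw [hp, h]; simp
  · apply hb; rw [hq, h]; simp

lemma NZ.prod [Infinite k] {ι : Type} (s : Finset ι) {f : ι → (Fin M → k) → k}
    (hf : ∀ i ∈ s, NZ (f i)) : NZ (fun a => ∏ i ∈ s, f i a) := by
  classical
  induction s using Finset.induction_on with
  | empty =>
    simp only [Finset.prod_empty]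
    exact ⟨IsPoly.const 1, 0, one_ne_zero⟩
  | insert i s his ih =>
    simp only [Finset.prod_insert his]
    exact (hf i (by simp)).mul (ih fun j hj => hf j (by simp [hj]))

lemma isPoly_coeff_D (F : MvPolynomial (Fin N) k) (m : Fin N →₀ ℕ) :
    IsPoly (fun a : Fin N → k => coeff m (D a F)) :=
  IsPoly.linear ((lcoeff k m) ∘ₗ DL F)

lemma D_eq_sum (a : Fin N → k) (F : MvPolynomial (Fin N) k) :
    D a F = ∑ i, a i • D (Pi.single i 1) F := by
  have h := congrArg (DL F) (Finset.univ_sum_single a)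
  rw [map_sum] at h
  change _ = D a F at h
  rw [← h]
  refine Finset.sum_congr rfl fun i _ => ?_
  have : (Pi.single i (a i) : Fin N → k) = a i • Pi.single i 1 := by
    rw [← Pi.single_smul]; simp
  rw [this, map_smul]; rfl

lemma isPoly_coeff_DD (F : MvPolynomial (Fin N) k) (m : Fin N →₀ ℕ) :
    IsPoly (fun a : Fin N → k => coeff m (D a (D a F))) := by
  have : (fun a : Fin N → k => coeff m (D a (D a F)))
      = fun a => ∑ i, a i * coeff m (D a (D (Pi.single i 1) F)) := by
    funext a
    conv_lhs => rw [D_eq_sum a F]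
    rw [map_sum, coeff_sum]
    refine Finset.sum_congr rfl fun i _ => ?_
    rw [Derivation.map_smul, coeff_smul, smul_eq_mul]
  rw [this]
  exact IsPoly.sum _ fun i _ => (IsPoly.coord i).mul (isPoly_coeff_D _ m)

lemma isPoly_coeff_DDD (F : MvPolynomial (Fin N) k) (m : Fin N →₀ ℕ) :
    IsPoly (fun a : Fin N → k => coeff m (D a (D a (D a F)))) := by
  have : (fun a : Fin N → k => coeff m (D a (D a (D a F))))
      = fun a => ∑ i, a i * coeff m (D a (D a (D (Pi.single i 1) F))) := by
    funext a
    conv_lhs => rw [D_eq_sum a F]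
    rw [map_sum, map_sum, coeff_sum]
    refine Finset.sum_congr rfl fun i _ => ?_
    rw [Derivation.map_smul, Derivation.map_smul, coeff_smul, smul_eq_mul]
  rw [this]
  exact IsPoly.sum _ fun i _ => (IsPoly.coord i).mul (isPoly_coeff_DD _ m)

lemma exists_coeff_ne {F : MvPolynomial (Fin N) k} (hF : F ≠ 0) : ∃ m, coeff m F ≠ 0 := by
  by_contra h
  push Not at h
  exact hF (MvPolynomial.ext _ _ (by simpa using h))

lemma exists_DD_ne [CharZero k] {d : ℕ} {W : Submodule k (Fin N → k)} {F : MvPolynomial (Fin N) k}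
    (hF : F ∈ P (d + 2) W) (h0 : F ≠ 0) : ∃ a, D a (D a F) ≠ 0 := by
  by_contra hcon
  push Not at hcon
  apply h0
  apply eq_zero_of_D hF
  intro a
  apply eq_zero_of_D (D_mem_P a hF)
  intro b
  have h1 := hcon (a + b)
  rw [D_add a b F, map_add, D_add a b, D_add a b, hcon a, hcon b, D_comm a b F] at h1
  have h2 : (2 : k) • D b (D a F) = 0 := by rw [two_smul]; simpa using h1
  exact (smul_eq_zero.mp h2).resolve_left two_ne_zero

end Generic

section DecSection

variable {k : Type} [Field k] {N : ℕ}

/-- `F` is a linear combination of at most `m` powers of linear forms from `S`. -/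
inductive Dec (S : Set (Fin N → k)) (d : ℕ) : ℕ → MvPolynomial (Fin N) k → Prop
  | zero (m : ℕ) : Dec S d m 0
  | add {m : ℕ} {F : MvPolynomial (Fin N) k} {c : k} {l : Fin N → k} (h : Dec S d m F)
      (hc : c ≠ 0) (hl : l ∈ S) : Dec S d (m + 1) (F + c • linForm l ^ d)

lemma Dec.mono {S S' : Set (Fin N → k)} {d m m' : ℕ} {F : MvPolynomial (Fin N) k}
    (h : Dec S d m F) (hS : S ⊆ S') (hm : m ≤ m') : Dec S' d m' F := by
  induction h generalizing m' with
  | zero m => exact Dec.zero _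
  | add h hc hl ih =>
    obtain ⟨j, rfl⟩ : ∃ j, m' = j + 1 := ⟨m' - 1, by omega⟩
    exact Dec.add (ih (by omega)) hc (hS hl)

lemma Dec.sum {S : Set (Fin N → k)} {d m m' : ℕ} {F G : MvPolynomial (Fin N) k}
    (h : Dec S d m F) (h' : Dec S d m' G) : Dec S d (m + m') (F + G) := by
  induction h' with
  | zero m' => simpa using h.mono le_rfl (Nat.le_add_right m m')
  | add h' hc hl ih =>
    rw [← add_assoc, ← add_assoc]
    exact Dec.add ih hc hl

lemma Dec.smul {S : Set (Fin N → k)} {d m : ℕ} {F : MvPolynomial (Fin N) k}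
    (h : Dec S d m F) {c : k} (hc : c ≠ 0) : Dec S d m (c • F) := by
  induction h with
  | zero m => simpa using Dec.zero m
  | add h hc' hl ih =>
    rw [smul_add, smul_smul]
    exact Dec.add ih (mul_ne_zero hc hc') hl

/-- a single term, possibly with zero coefficient -/
lemma Dec.single {S : Set (Fin N → k)} {d : ℕ} (c : k) {l : Fin N → k} (hl : l ∈ S) :
    Dec S d 1 (c • linForm l ^ d) := by
  by_cases hc : c = 0
  · rw [hc, zero_smul]; exact Dec.zero 1
  · simpa using Dec.add (Dec.zero 0) hc hl

lemma Dec.integrate [CharZero k] {S : Set (Fin N → k)} {d m : ℕ} {Q : MvPolynomial (Fin N) k}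
    (h : Dec S d m Q) {a : Fin N → k} (ha : ∀ l ∈ S, a ⬝ᵥ l ≠ 0) :
    ∃ F, Dec S (d + 1) m F ∧ D a F = Q := by
  induction h with
  | zero m => exact ⟨0, Dec.zero m, by simp⟩
  | @add m F c l h hc hl ih =>
    obtain ⟨G, hG, hGQ⟩ := ih
    have hd : (d + 1 : k) ≠ 0 := by exact_mod_cast Nat.succ_ne_zero d
    have hal := ha l hl
    refine ⟨G + (c / ((d + 1 : k) * (a ⬝ᵥ l))) • linForm l ^ (d + 1),
      Dec.add hG (div_ne_zero hc (mul_ne_zero hd hal)) hl, ?_⟩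
    rw [map_add, hGQ, Derivation.map_smul, D_pow, smul_smul, div_mul_cancel₀]
    exact mul_ne_zero hd hal

lemma Dec.mem_P {S : Set (Fin N → k)} {d m : ℕ} {F : MvPolynomial (Fin N) k}
    (h : Dec S d m F) {W : Submodule k (Fin N → k)} (hS : ∀ l ∈ S, l ∈ W) : F ∈ P d W := by
  induction h with
  | zero m => exact zero_mem _
  | add h hc hl ih => exact add_mem ih (Submodule.smul_mem _ _ (pow_mem_P (hS _ hl) d))

/-- `F` essentially depends on `W`. -/
def Ess (d : ℕ) (W : Submodule k (Fin N → k)) (F : MvPolynomial (Fin N) k) : Prop :=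
  F ∈ P d W ∧ ∀ W' < W, F ∉ P d W'

lemma exists_ess {d : ℕ} {W : Submodule k (Fin N → k)} {F : MvPolynomial (Fin N) k}
    (hF : F ∈ P d W) : ∃ W' ≤ W, Ess d W' F := by
  induction W using WellFoundedLT.induction with
  | ind W ih =>
    by_cases h : ∃ W' < W, F ∈ P d W'
    · obtain ⟨W', hlt, hW'⟩ := h
      obtain ⟨W'', hle, hE⟩ := ih W' hlt hW'
      exact ⟨W'', hle.trans hlt.le, hE⟩
    · push Not at h
      exact ⟨W, le_rfl, hF, h⟩

lemma Ess.D_ne [CharZero k] {d : ℕ} {W : Submodule k (Fin N → k)} {F : MvPolynomial (Fin N) k}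
    (h : Ess d W F) {a w : Fin N → k} (hw : w ∈ W) (haw : a ⬝ᵥ w ≠ 0) : D a F ≠ 0 := by
  intro h0
  refine h.2 (W ⊓ kerv a) ?_ (mem_P_kerv h.1 h0)
  refine lt_of_le_of_ne inf_le_left fun heq => haw ?_
  rw [← heq] at hw
  exact (Submodule.mem_inf.mp hw).2

lemma linForm_pow_ne {l : Fin N → k} (hl : l ≠ 0) (d : ℕ) : linForm l ^ d ≠ 0 :=
  pow_ne_zero _ (linForm_ne_zero hl)

lemma mem_of_add_pow [CharZero k] {d : ℕ} {W₁ W₂ : Submodule k (Fin N → k)}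
    {F : MvPolynomial (Fin N) k} {l : Fin N → k} {c : k} (hF : F ∈ P (d + 2) W₁) (hl : l ∉ W₁)
    (hc : c ≠ 0) (h : F + c • linForm l ^ (d + 2) ∈ P (d + 2) W₂) : l ∈ W₂ := by
  by_contra hl2
  obtain ⟨b, hb, hbl⟩ := exists_sep hl2
  obtain ⟨g, hg, hgl⟩ := exists_sep hl
  have h1 := D_eq_zero_of_mem hb h
  have h2 : D g (D b F) = 0 := by rw [D_comm, D_eq_zero_of_mem hg hF, map_zero]
  have h3 := congrArg (D g) h1
  rw [map_add, map_add, h2, Derivation.map_smul, D_pow, Derivation.map_smul, Derivation.map_smul,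
    D_pow, map_zero, zero_add, smul_smul, smul_smul] at h3
  have hl0 : l ≠ 0 := by rintro rfl; exact hl W₁.zero_mem
  rcases smul_eq_zero.mp h3 with h4 | h4
  · have e1 : ((d + 1 : ℕ) + 1 : k) ≠ 0 := by exact_mod_cast Nat.succ_ne_zero (d + 1)
    have e2 : (d + 1 : k) ≠ 0 := by exact_mod_cast Nat.succ_ne_zero d
    simp only [mul_eq_zero] at h4
    tauto
  · exact linForm_pow_ne hl0 d h4

/-- Good linear forms. -/
def Good (h : MvPolynomial (Fin N) k) (W : Submodule k (Fin N → k)) : Set (Fin N → k) :=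
  {l | l ∈ W ∧ eval l h ≠ 0}

lemma Good_mono {h : MvPolynomial (Fin N) k} {W W' : Submodule k (Fin N → k)} (hW : W ≤ W') :
    Good h W ⊆ Good h W' := fun _ hl => ⟨hW hl.1, hl.2⟩

lemma eval_smul_homog {h : MvPolynomial (Fin N) k} {t : ℕ} (hh : h.IsHomogeneous t) (c : k)
    (l : Fin N → k) : eval (c • l) h = c ^ t * eval l h := by
  rw [eval_eq', eval_eq', Finset.mul_sum]
  refine Finset.sum_congr rfl fun s hs => ?_
  have hdeg : ∑ i, s i = t := by
    have := hh.coeff_eq_zero (d := s)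
    by_contra hne
    refine (mem_support_iff.mp hs) (this ?_)
    rwa [Finsupp.degree_eq_sum]
  simp only [Pi.smul_apply, smul_eq_mul, mul_pow, Finset.prod_mul_distrib]
  rw [Finset.prod_pow_eq_pow_sum, hdeg]
  ring

lemma coeffs_mem_of_forall [Infinite k] {A : Type} [AddCommGroup A] [Module k A] (Q : Submodule k A)
    (n : ℕ) (v : ℕ → A) (h : ∀ t : k, ∑ j ∈ Finset.range n, t ^ j • v j ∈ Q) :
    ∀ j < n, v j ∈ Q := by
  intro j hj
  rw [← Submodule.Quotient.mk_eq_zero, ← Module.forall_dual_apply_eq_zero_iff k]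
  intro f
  let g : A →ₗ[k] k := f ∘ₗ Q.mkQ
  have hg : ∀ t : k, ∑ j ∈ Finset.range n, t ^ j * g (v j) = 0 := by
    intro t
    have h1 : Q.mkQ (∑ j ∈ Finset.range n, t ^ j • v j) = 0 := by
      rw [Submodule.mkQ_apply, Submodule.Quotient.mk_eq_zero]; exact h t
    have h2 : g (∑ j ∈ Finset.range n, t ^ j • v j) = 0 := by
      rw [LinearMap.comp_apply, h1, map_zero]
    simpa [map_sum] using h2
  let p : Polynomial k := ∑ j ∈ Finset.range n, Polynomial.monomial j (g (v j))
  have hp : p = 0 := by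
    apply Polynomial.funext
    intro t
    simp only [p, Polynomial.eval_finsetSum, Polynomial.eval_monomial, Polynomial.eval_zero]
    rw [← hg t]
    exact Finset.sum_congr rfl fun _ _ => mul_comm _ _
  have hc := congrArg (fun q => Polynomial.coeff q j) hp
  simp only [p, Polynomial.finsetSum_coeff, Polynomial.coeff_monomial, Polynomial.coeff_zero] at hc
  rw [Finset.sum_ite_eq' (Finset.range n) j] at hc
  rw [if_pos (Finset.mem_range.mpr hj)] at hc
  exact hc

lemma mul_mem_P [CharZero k] {d : ℕ} {W : Submodule k (Fin N → k)} {F : MvPolynomial (Fin N) k}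
    (hF : F ∈ P d W) {m : Fin N → k} (hm : m ∈ W) : F * linForm m ∈ P (d + 1) W := by
  refine P_induction (p := fun F => F * linForm m ∈ P (d + 1) W) ?_ ?_ ?_ ?_ hF
  · intro l hl
    have h1 := coeffs_mem_of_forall (P (d + 1) W) (d + 2)
      (fun j => ((d + 1).choose j : k) • (linForm m ^ j * linForm l ^ (d + 1 - j))) ?_ 1 (by omega)
    · have hd : (d + 1 : k) ≠ 0 := by exact_mod_cast Nat.succ_ne_zero d
      have h2 := Submodule.smul_mem _ (d + 1 : k)⁻¹ h1
      simp only [Nat.choose_one_right, pow_one, Nat.add_sub_cancel] at h2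
      push_cast at h2
      rw [smul_smul, inv_mul_cancel₀ hd, one_smul, mul_comm] at h2
      exact h2
    · intro t
      have h3 : linForm (t • m + l) ^ (d + 1) ∈ P (d + 1) W :=
        pow_mem_P (add_mem (W.smul_mem t hm) hl) _
      rw [linForm_add, linForm_smul, add_pow] at h3
      convert h3 using 1
      refine Finset.sum_congr rfl fun j _ => ?_
      simp only [smul_eq_C_mul, map_pow, map_natCast]
      ring
  · simp
  · intro F G hF hG; rw [add_mul]; exact add_mem hF hG
  · intro c F hF; rw [smul_mul_assoc]; exact Submodule.smul_mem _ _ hF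

lemma linForm_single (i : Fin N) : linForm (Pi.single i (1 : k)) = X i := by
  unfold linForm
  rw [Finset.sum_eq_single i]
  · simp
  · intro j _ hj; simp [Pi.single_eq_of_ne hj]
  · simp

lemma monomial_mem_P [CharZero k] (s : Fin N →₀ ℕ) : ∀ d : ℕ, s.degree = d →
    monomial s (1 : k) ∈ P d (⊤ : Submodule k (Fin N → k)) := by
  intro d
  induction d generalizing s with
  | zero =>
    intro hs
    have : s = 0 := (Finsupp.degree_eq_zero_iff s).mp hs
    subst this
    simpa using pow_mem_P (Submodule.mem_top (x := (0 : Fin N → k))) 0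
  | succ d ih =>
    intro hs
    have hne : s ≠ 0 := by rintro rfl; simp at hs
    obtain ⟨i, hi⟩ := Finsupp.ne_iff.mp hne
    have hle : Finsupp.single i 1 ≤ s := by
      rw [Finsupp.single_le_iff]; exact Nat.one_le_iff_ne_zero.mpr hi
    have hs' : s = (s - Finsupp.single i 1) + Finsupp.single i 1 := (tsub_add_cancel_of_le hle).symm
    have h1 := ih (s - Finsupp.single i 1) (by
      have := congrArg Finsupp.degree hs'
      rw [map_add, Finsupp.degree_single] at this
      omega)
    have h2 := mul_mem_P h1 (Submodule.mem_top (x := Pi.single i (1 : k)))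
    rw [linForm_single, X, monomial_mul, ← hs', one_mul] at h2
    exact h2

lemma homog_mem_P [CharZero k] {F : MvPolynomial (Fin N) k} {d : ℕ} (hF : F.IsHomogeneous d) :
    F ∈ P d (⊤ : Submodule k (Fin N → k)) := by
  rw [F.as_sum]
  refine Submodule.sum_mem _ fun s hs => ?_
  have : monomial s (coeff s F) = coeff s F • monomial s (1 : k) := by
    rw [smul_monomial, smul_eq_mul, mul_one]
  rw [this]
  refine Submodule.smul_mem _ _ (monomial_mem_P s d ?_)
  by_contra hne
  exact (mem_support_iff.mp hs) (hF.coeff_eq_zero hne)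

lemma writable_of_mem_P {d : ℕ} {W : Submodule k (Fin N → k)} {F : MvPolynomial (Fin N) k}
    (hF : F ∈ P d W) : WritableIn (Module.finrank k W) F := by
  let b := Module.finBasis k W
  refine ⟨fun j => linForm (b j : Fin N → k), fun j => linForm_isHomogeneous _, ?_⟩
  refine P_induction (p := fun F => ∃ G : MvPolynomial (Fin (Module.finrank k W)) k,
    F = aeval (fun j => linForm (b j : Fin N → k)) G) ?_ ?_ ?_ ?_ hF
  · intro l hl
    refine ⟨(linForm (b.repr ⟨l, hl⟩)) ^ d, ?_⟩
    rw [map_pow]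
    congr 1
    have h1 : l = ∑ j, b.repr ⟨l, hl⟩ j • (b j : Fin N → k) := by
      have := congrArg (Subtype.val) (b.sum_repr ⟨l, hl⟩)
      rw [Submodule.coe_sum] at this
      exact this.symm
    conv_lhs => rw [h1]
    have h2 : ∀ s : Finset (Fin (Module.finrank k W)), linForm (∑ j ∈ s, b.repr ⟨l, hl⟩ j • (b j : Fin N → k))
        = ∑ j ∈ s, b.repr ⟨l, hl⟩ j • linForm (b j : Fin N → k) := by
      classical
      intro s
      induction s using Finset.induction_on with
      | empty => simp [linForm_zero]
      | insert i s his ih => rw [Finset.sum_insert his, Finset.sum_insert his, linForm_add, linForm_smul, ih]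
    rw [h2]
    simp [linForm, smul_eq_C_mul, algebraMap_eq]
  · exact ⟨0, by simp⟩
  · rintro _ _ ⟨G, rfl⟩ ⟨G', rfl⟩; exact ⟨G + G', by simp⟩
  · rintro c _ ⟨G, rfl⟩; exact ⟨c • G, by simp⟩

lemma Dec.exists_sum [IsAlgClosed k] {h : MvPolynomial (Fin N) k} {t : ℕ} (hh : h.IsHomogeneous t)
    {W : Submodule k (Fin N → k)} {d m : ℕ} (hd : 0 < d) {F : MvPolynomial (Fin N) k}
    (hD : Dec (Good h W) d m F) : ∃ m' ≤ m, ∃ l : Fin m' → (Fin N → k),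
      (∀ i, eval (l i) h ≠ 0) ∧ F = ∑ i, linForm (l i) ^ d := by
  induction hD with
  | zero m => exact ⟨0, Nat.zero_le _, Fin.elim0, fun i => i.elim0, by simp⟩
  | @add m F c l hD hc hl ih =>
    obtain ⟨m', hm', L, hL, rfl⟩ := ih
    obtain ⟨z, hz⟩ := IsAlgClosed.exists_pow_nat_eq c hd
    refine ⟨m' + 1, by omega, Fin.snoc L (z • l), ?_, ?_⟩
    · intro i
      refine Fin.lastCases ?_ (fun i => ?_) i
      · rw [Fin.snoc_last, eval_smul_homog hh]
        refine mul_ne_zero (pow_ne_zero _ ?_) hl.2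
        rintro rfl
        rw [zero_pow hd.ne'] at hz
        exact hc hz.symm
      · rw [Fin.snoc_castSucc]; exact hL i
    · rw [Fin.sum_univ_castSucc]
      simp only [Fin.snoc_castSucc, Fin.snoc_last]
      rw [linForm_smul, smul_pow, hz]

end DecSection



section Bound

/-- The bound: `bd n e` bounds the open rank of forms of degree `e + 2` in `n` variables. -/
def bd : ℕ → ℕ → ℕ
  | 0, _ => 0
  | n + 1, 0 => n + 1
  | n + 1, e + 1 => if n = 2 ∧ e = 0 then 5 else bd (n + 1) e + bd n (e + 1)

lemma bd_zero (e : ℕ) : bd 0 e = 0 := by cases e <;> simp [bd]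

lemma bd_n_zero (n : ℕ) : bd n 0 = n := by cases n <;> simp [bd]

lemma bd_succ {n e : ℕ} (h : ¬ (n = 2 ∧ e = 0)) :
    bd (n + 1) (e + 1) = bd (n + 1) e + bd n (e + 1) := by
  conv_lhs => unfold bd
  rw [if_neg h]

lemma bd_pos (n e : ℕ) : 1 ≤ bd (n + 1) e := by
  induction e with
  | zero => simp [bd]
  | succ e ih =>
    by_cases h : n = 2 ∧ e = 0
    · unfold bd; rw [if_pos h]; norm_num
    · rw [bd_succ h]; omega

lemma bd_two_one : bd 2 1 = 3 := by simp [bd]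

lemma bd_three_one : bd 3 1 = 5 := by simp [bd]

lemma bd_lt (n e : ℕ) : bd n e + 1 ≤ bd (n + 1) e := by
  cases e with
  | zero => simp [bd_n_zero]
  | succ e =>
    by_cases h : n = 2 ∧ e = 0
    · obtain ⟨rfl, rfl⟩ := h
      simp [bd]
    · rw [bd_succ h]
      have := bd_pos n e
      omega

lemma bd_mono {n m : ℕ} (h : n ≤ m) (e : ℕ) : bd n e ≤ bd m e := by
  induction h with
  | refl => exact le_rfl
  | step _ ih => exact ih.trans ((Nat.le_succ _).trans (bd_lt _ _))

lemma bd_one (e : ℕ) : bd 1 e = 1 := by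
  induction e with
  | zero => exact bd_n_zero _
  | succ e ih => rw [bd_succ (by omega), ih, bd_zero]

lemma bd_two (e : ℕ) : bd 2 e = e + 2 := by
  induction e with
  | zero => exact bd_n_zero _
  | succ e ih => rw [bd_succ (by omega), ih, bd_one]

lemma bd_closed (n e : ℕ) : bd (n + 3) (e + 1) + (n + e).choose e = (n + e + 4).choose (e + 2) := by
  induction e generalizing n with
  | zero =>
    induction n with
    | zero => simp [bd]; decide
    | succ n ih =>
      rw [bd_succ (by omega), bd_n_zero]
      have h1 : (n + 1 + 0 + 4).choose (0 + 2) = (n + 4).choose 1 + (n + 4).choose 2 :=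
        Nat.choose_succ_succ (n + 4) 1
      rw [h1]
      simp only [Nat.add_zero, Nat.zero_add, Nat.choose_zero_right, Nat.choose_one_right] at ih ⊢
      omega
  | succ e ihe =>
    induction n with
    | zero =>
      rw [bd_succ (by omega), bd_two]
      have h1 : (0 + (e + 1) + 4).choose (e + 1 + 2)
          = (0 + e + 4).choose (e + 2) + (e + 4).choose (e + 3) := by
        have := Nat.choose_succ_succ (e + 4) (e + 2)
        simpa [Nat.add_assoc, Nat.add_comm, Nat.add_left_comm] using this
      have h2 : (e + 4).choose (e + 3) = e + 4 := by
        exact Nat.choose_succ_self_right (e + 3)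
      have h3 := ihe 0
      simp only [Nat.zero_add, Nat.choose_self, Nat.reduceAdd] at h1 h3 ⊢
      omega
    | succ n ih =>
      rw [bd_succ (by omega)]
      have h1 : (n + 1 + (e + 1) + 4).choose (e + 1 + 2)
          = (n + 1 + e + 4).choose (e + 2) + (n + (e + 1) + 4).choose (e + 1 + 2) := by
        have := Nat.choose_succ_succ (n + e + 5) (e + 2)
        rw [show n + 1 + (e + 1) + 4 = (n + e + 5).succ by omega,
          show n + 1 + e + 4 = n + e + 5 by omega, show n + (e + 1) + 4 = n + e + 5 by omega]
        exact this
      have h2 : (n + 1 + (e + 1)).choose (e + 1)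
          = (n + 1 + e).choose e + (n + (e + 1)).choose (e + 1) := by
        have := Nat.choose_succ_succ (n + e + 1) e
        rw [show n + 1 + (e + 1) = (n + e + 1).succ by omega,
          show n + 1 + e = n + e + 1 by omega, show n + (e + 1) = n + e + 1 by omega]
        exact this
      have h3 := ihe (n + 1)
      rw [h1, h2, show n + 1 + 2 = n + 3 by omega]
      rw [show n + 1 + 3 = n + 3 + 1 by omega] at h3
      omega

end Bound

section Recursion

variable {k : Type} [Field k] {N : ℕ}

/-- The main claim for forms of degree `e + 2` essentially depending on `n` variables. -/
def Main (k : Type) [Field k] (N e n : ℕ) : Prop :=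
  ∀ W : Submodule k (Fin N → k), Module.finrank k W = n → ∀ F : MvPolynomial (Fin N) k,
    Ess (e + 2) W F → ∀ (h : MvPolynomial (Fin N) k) (t : ℕ), h.IsHomogeneous t →
    (∃ w ∈ W, eval w h ≠ 0) → Dec (Good h W) (e + 2) (bd n e) F

lemma step [CharZero k] {e n m t : ℕ} {W : Submodule k (Fin N → k)} {F h : MvPolynomial (Fin N) k}
    {a : Fin N → k} (hfin : Module.finrank k W = n + 1) (hF : F ∈ P (e + 2) W)
    (hIH : ∀ n' ≤ n, Main k N e n') (hh : h.IsHomogeneous t)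
    (hker : ∃ w ∈ W ⊓ kerv a, eval w h ≠ 0)
    (hDec : Dec (Good (h * linForm a) W) (e + 1) m (D a F)) (h0 : D a F ≠ 0) :
    Dec (Good h W) (e + 2) (m + bd n e) F := by
  have hsub : Good (h * linForm a) W ⊆ Good h W := by
    intro l hl
    refine ⟨hl.1, fun h1 => hl.2 ?_⟩
    rw [map_mul, h1, zero_mul]
  have hne : ∀ l ∈ Good (h * linForm a) W, a ⬝ᵥ l ≠ 0 := by
    intro l hl h1
    apply hl.2
    rw [map_mul, eval_linForm, h1, mul_zero]
  generalize hQ : D a F = Q at hDec h0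
  cases hDec with
  | zero m => exact absurd rfl h0
  | @add m Q c l hDec hc hl =>
    obtain ⟨F₁, hF₁, hDF₁⟩ := hDec.integrate hne
    have hd : ((e + 1 : ℕ) + 1 : k) ≠ 0 := by exact_mod_cast Nat.succ_ne_zero (e + 1)
    have hal := hne l hl
    set c' : k := c / (((e + 1 : ℕ) + 1 : k) * (a ⬝ᵥ l)) with hc'
    have hc'0 : c' ≠ 0 := div_ne_zero hc (mul_ne_zero hd hal)
    set G := F - F₁ - c' • linForm l ^ (e + 2) with hG
    have hDG : D a G = 0 := by
      rw [hG, map_sub, map_sub, hQ, hDF₁, Derivation.map_smul, D_pow, smul_smul, hc',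
        div_mul_cancel₀ _ (mul_ne_zero hd hal)]
      ring
    have hF₁W : F₁ ∈ P (e + 2) W := hF₁.mem_P fun l hl => hl.1
    have hGW : G ∈ P (e + 2) W :=
      sub_mem (sub_mem hF hF₁W) (Submodule.smul_mem _ _ (pow_mem_P hl.1 _))
    have hGK := mem_P_kerv hGW hDG
    have hlt : W ⊓ kerv a < W := by
      refine lt_of_le_of_ne inf_le_left fun heq => hal ?_
      have := hl.1
      rw [← heq] at this
      exact (Submodule.mem_inf.mp this).2
    have hfin2 := Submodule.finrank_lt_finrank_of_lt hlt
    obtain ⟨W₃, hW₃, hE₃⟩ := exists_ess hGK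
    by_cases hgood : ∃ w ∈ W₃, eval w h ≠ 0
    · have hle := Submodule.finrank_mono hW₃
      have h3 := hIH (Module.finrank k W₃) (by omega) W₃ rfl G hE₃ h t hh hgood
      have h4 : Dec (Good h W) (e + 2) (bd n e) G :=
        h3.mono (Good_mono (hW₃.trans inf_le_left)) (bd_mono (by omega) e)
      have h5 := (hF₁.mono hsub le_rfl).sum ((Dec.single c' (hsub hl)).sum h4)
      have h6 : F₁ + (c' • linForm l ^ (e + 2) + G) = F := by rw [hG]; ring
      rw [h6] at h5
      exact h5.mono le_rfl (by omega)
    · have hlt3 : W₃ < W ⊓ kerv a := by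
        refine lt_of_le_of_ne hW₃ fun heq => hgood ?_
        rw [heq]; exact hker
      have hfin3 := Submodule.finrank_lt_finrank_of_lt hlt3
      have hlW₃ : l ∉ W₃ := fun hmem => hgood ⟨l, hmem, (hsub hl).2⟩
      have hmem : G + c' • linForm l ^ (e + 2) ∈ P (e + 2) (W₃ ⊔ Submodule.span k {l}) :=
        add_mem (P_mono _ le_sup_left hE₃.1)
          (Submodule.smul_mem _ _ (pow_mem_P (Submodule.mem_sup_right (Submodule.mem_span_singleton_self l)) _))
      obtain ⟨W₄, hW₄, hE₄⟩ := exists_ess hmem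
      have hlW₄ : l ∈ W₄ := mem_of_add_pow hE₃.1 hlW₃ hc'0 hE₄.1
      have hle4 : Module.finrank k W₄ ≤ Module.finrank k W₃ + 1 := by
        refine (Submodule.finrank_mono hW₄).trans ((Submodule.finrank_add_le_finrank_add_finrank _ _).trans ?_)
        have := finrank_span_le_card (R := k) ({l} : Set (Fin N → k))
        rw [Set.toFinset_singleton, Finset.card_singleton] at this
        omega
      have hW₄W : W₄ ≤ W := hW₄.trans (sup_le (hW₃.trans inf_le_left)
        (by rw [Submodule.span_singleton_le_iff_mem]; exact hl.1))
      have h3 := hIH (Module.finrank k W₄) (by omega) W₄ rfl _ hE₄ h t hh ⟨l, hlW₄, (hsub hl).2⟩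
      have h4 : Dec (Good h W) (e + 2) (bd n e) (G + c' • linForm l ^ (e + 2)) :=
        h3.mono (Good_mono hW₄W) (bd_mono (by omega) e)
      have h5 := (hF₁.mono hsub le_rfl).sum h4
      have h6 : F₁ + (G + c' • linForm l ^ (e + 2)) = F := by rw [hG]; ring
      rw [h6] at h5
      exact h5.mono le_rfl (by omega)

lemma exists_both [CharZero k] {W : Submodule k (Fin N → k)} {h g : MvPolynomial (Fin N) k}
    (hh : ∃ w ∈ W, eval w h ≠ 0) (hg : ∃ w ∈ W, eval w g ≠ 0) : ∃ w ∈ W, eval w (h * g) ≠ 0 := by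
  obtain ⟨w, hw, hwh⟩ := hh
  obtain ⟨v, hv, hvg⟩ := hg
  have hp : ∀ i, IsPoly (fun a : Fin 2 → k => (a 0 • w + a 1 • v) i) := fun i =>
    ((IsPoly.coord 0).mul (IsPoly.const _)).add ((IsPoly.coord 1).mul (IsPoly.const _))
  have h1 : NZ (fun a : Fin 2 → k => eval (a 0 • w + a 1 • v) h) :=
    ⟨IsPoly.comp h hp, ![1, 0], by simpa using hwh⟩
  have h2 : NZ (fun a : Fin 2 → k => eval (a 0 • w + a 1 • v) g) :=
    ⟨IsPoly.comp g hp, ![0, 1], by simpa using hvg⟩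
  obtain ⟨-, a, ha⟩ := h1.mul h2
  refine ⟨a 0 • w + a 1 • v, add_mem (W.smul_mem _ hw) (W.smul_mem _ hv), ?_⟩
  rwa [map_mul]

lemma isPoly_dot (w : Fin N → k) : IsPoly (fun a : Fin N → k => a ⬝ᵥ w) :=
  ⟨linForm w, fun a => by rw [eval_linForm, dotProduct_comm]⟩

/-- For a generic hyperplane, `h` does not vanish on its intersection with `W`. -/
lemma generic_ker [CharZero k] {n t : ℕ} {W : Submodule k (Fin N → k)} {h : MvPolynomial (Fin N) k}
    (hfin : Module.finrank k W = n + 2) (hh : h.IsHomogeneous t) (hw : ∃ w ∈ W, eval w h ≠ 0) :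
    ∃ Φ : (Fin N → k) → k, NZ Φ ∧ ∀ a, Φ a ≠ 0 → ∃ w ∈ W ⊓ kerv a, eval w h ≠ 0 := by
  obtain ⟨w, hw, hwh⟩ := hw
  obtain ⟨v, hv, hvw⟩ : ∃ v ∈ W, v ∉ Submodule.span k {w} := by
    by_contra hcon
    push Not at hcon
    have h1 := Submodule.finrank_mono (show W ≤ Submodule.span k {w} from hcon)
    have := finrank_span_le_card (R := k) ({w} : Set (Fin N → k))
    rw [Set.toFinset_singleton, Finset.card_singleton] at this
    omega
  refine ⟨fun a => eval ((a ⬝ᵥ v) • w - (a ⬝ᵥ w) • v) h, ⟨IsPoly.comp h fun i =>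
    ((isPoly_dot v).mul (IsPoly.const _)).sub ((isPoly_dot w).mul (IsPoly.const _)), ?_⟩, ?_⟩
  · obtain ⟨a, ha, hav⟩ := exists_sep hvw
    refine ⟨a, ?_⟩
    change eval ((a ⬝ᵥ v) • w - (a ⬝ᵥ w) • v) h ≠ 0
    rw [ha w (Submodule.mem_span_singleton_self w), zero_smul, sub_zero, eval_smul_homog hh]
    exact mul_ne_zero (pow_ne_zero _ hav) hwh
  · intro a ha
    refine ⟨_, Submodule.mem_inf.mpr ⟨sub_mem (W.smul_mem _ hw) (W.smul_mem _ hv), ?_⟩, ha⟩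
    rw [mem_kerv, dotProduct_sub, dotProduct_smul, dotProduct_smul, smul_eq_mul, smul_eq_mul]
    ring

lemma generic_DD [CharZero k] {d : ℕ} {W : Submodule k (Fin N → k)} {F : MvPolynomial (Fin N) k}
    (hF : F ∈ P (d + 2) W) (h0 : F ≠ 0) :
    ∃ Φ : (Fin N → k) → k, NZ Φ ∧ ∀ a, Φ a ≠ 0 → D a (D a F) ≠ 0 := by
  obtain ⟨a, ha⟩ := exists_DD_ne hF h0
  obtain ⟨m, hm⟩ := exists_coeff_ne ha
  refine ⟨fun a => coeff m (D a (D a F)), ⟨isPoly_coeff_DD F m, a, hm⟩, fun b hb h1 => hb ?_⟩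
  change coeff m (D b (D b F)) = 0
  rw [h1, coeff_zero]

lemma finite_hyperplanes [CharZero k] {t : ℕ} (W : Submodule k (Fin N → k))
    {h : MvPolynomial (Fin N) k} (hh : h.IsHomogeneous t) (w : W) (hw : eval (w : Fin N → k) h ≠ 0) :
    {φ : W →ₗ[k] k | φ w = 1 ∧ ∀ v : W, φ v = 0 → eval (v : Fin N → k) h = 0}.Finite := by
  classical
  let b := Module.finBasis k W
  have hroots : ∀ v : Fin N → k, {c : k | eval (v - c • (w : Fin N → k)) h = 0}.Finite := by
    intro v
    let ψ : MvPolynomial (Fin N) k →ₐ[k] Polynomial k :=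
      aeval (fun i => Polynomial.C ((w : Fin N → k) i) - Polynomial.X * Polynomial.C (v i))
    have hψ : ∀ s : k, (ψ h).eval s = eval ((w : Fin N → k) - s • v) h := by
      intro s
      rw [← Polynomial.coe_evalRingHom]
      change ((Polynomial.evalRingHom s).comp (ψ : MvPolynomial (Fin N) k →+* Polynomial k)) h = _
      congr 1
      apply MvPolynomial.ringHom_ext
      · intro c; simp [ψ]
      · intro i; simp [ψ]; ring
    have hne : ψ h ≠ 0 := by
      intro h0
      apply hw
      have := hψ 0
      rw [h0] at this
      simpa using this.symm
    have hfin : {s : k | (ψ h).eval s = 0}.Finite := by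
      refine (ψ h).roots.toFinset.finite_toSet.subset fun s hs => ?_
      simp only [Finset.mem_coe, Multiset.mem_toFinset]
      exact (Polynomial.mem_roots hne).mpr hs
    refine ((hfin.image fun s => s⁻¹).union (Set.finite_singleton 0)).subset fun c hc => ?_
    by_cases hc0 : c = 0
    · right; exact hc0
    · left
      refine ⟨c⁻¹, ?_, inv_inv c⟩
      change (ψ h).eval c⁻¹ = 0
      rw [hψ]
      have : (w : Fin N → k) - c⁻¹ • v = (-c⁻¹) • (v - c • (w : Fin N → k)) := by
        rw [smul_sub, smul_smul, neg_mul, inv_mul_cancel₀ hc0]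
        module
      rw [this, eval_smul_homog hh]
      have h2 : eval (v - c • (w : Fin N → k)) h = 0 := hc
      rw [h2, mul_zero]
  have hpi : (Set.pi Set.univ fun i => {c : k | eval ((b i : Fin N → k) - c • (w : Fin N → k)) h = 0}).Finite :=
    Set.Finite.pi fun i => hroots _
  refine Set.Finite.of_finite_image (f := fun (φ : W →ₗ[k] k) i => φ (b i)) (hpi.subset ?_) ?_
  · rintro _ ⟨φ, ⟨hφ1, hφ2⟩, rfl⟩ i _
    have := hφ2 (b i - φ (b i) • w) (by rw [map_sub, map_smul, hφ1]; simp)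
    simpa using this
  · intro φ _ φ' _ heq
    exact b.ext fun i => congrFun heq i

/-- Key lemma: genericity of the derivative. -/
lemma generic_key [CharZero k] {e n t : ℕ} {W : Submodule k (Fin N → k)}
    {F h : MvPolynomial (Fin N) k} (hfin : Module.finrank k W = n + 2) (hE : Ess (e + 3) W F)
    (hh : h.IsHomogeneous t) (hw : ∃ w ∈ W, eval w h ≠ 0) :
    ∃ Φ : (Fin N → k) → k, NZ Φ ∧ ∀ a, Φ a ≠ 0 → ∀ W₁ ≤ W, D a F ∈ P (e + 2) W₁ →
      Module.finrank k W₁ = n + 1 → ∃ w ∈ W₁, eval w h ≠ 0 := by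
  obtain ⟨w, hwW, hwh⟩ := hw
  have hB := finite_hyperplanes W hh ⟨w, hwW⟩ hwh
  set B := hB.toFinset with hBdef
  have hex : ∀ φ : W →ₗ[k] k, ∃ β : Fin N → k, ∀ x : W, β ⬝ᵥ (x : Fin N → k) = φ x := by
    intro φ
    obtain ⟨f, hf⟩ := LinearMap.exists_extend φ
    obtain ⟨β, hβ⟩ := exists_dot f
    refine ⟨β, fun x => ?_⟩
    rw [hβ, ← hf]; rfl
  choose β hβ using hex
  have hnz : ∀ φ ∈ B, ∃ m, NZ (fun a => coeff m (D a (D (β φ) F))) := by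
    intro φ hφ
    have hφ' := (hB.mem_toFinset.mp hφ).1
    have h1 : D (β φ) F ≠ 0 := hE.D_ne hwW (a := β φ) (by
      have := hβ φ ⟨w, hwW⟩
      rw [hφ'] at this
      rw [this]; exact one_ne_zero)
    obtain ⟨a, ha⟩ : ∃ a, D a (D (β φ) F) ≠ 0 := by
      by_contra hcon
      push Not at hcon
      exact h1 (eq_zero_of_D (D_mem_P (β φ) hE.1) hcon)
    obtain ⟨m, hm⟩ := exists_coeff_ne ha
    exact ⟨m, isPoly_coeff_D _ m, a, hm⟩
  choose! m hm using hnz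
  refine ⟨_, NZ.prod B hm, ?_⟩
  intro a ha W₁ hW₁ hmem hfin1
  by_contra hcon
  push Not at hcon
  have hwW₁ : w ∉ W₁ := fun h1 => hwh (hcon w h1)
  obtain ⟨γ₀, hγ₀, hγ₀w⟩ := exists_sep hwW₁
  obtain ⟨γ, hγ, hγw⟩ : ∃ γ : Fin N → k, (∀ x ∈ W₁, γ ⬝ᵥ x = 0) ∧ γ ⬝ᵥ w = 1 :=
    ⟨(γ₀ ⬝ᵥ w)⁻¹ • γ₀, fun x hx => by rw [smul_dotProduct, hγ₀ x hx, smul_zero],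
      by rw [smul_dotProduct, smul_eq_mul, inv_mul_cancel₀ hγ₀w]⟩
  let φ : W →ₗ[k] k :=
    { toFun := fun x => γ ⬝ᵥ (x : Fin N → k)
      map_add' := fun x y => by simp [dotProduct_add]
      map_smul' := fun c x => by simp }
  have hW₁eq : W₁ = W ⊓ kerv γ := by
    apply Submodule.eq_of_le_of_finrank_le
    · exact le_inf hW₁ hγ
    · have hlt : W ⊓ kerv γ < W := by
        refine lt_of_le_of_ne inf_le_left fun heq => ?_
        rw [← heq] at hwW
        have := (Submodule.mem_inf.mp hwW).2
        rw [mem_kerv, hγw] at this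
        exact one_ne_zero this
      have := Submodule.finrank_lt_finrank_of_lt hlt
      omega
  have hφB : φ ∈ B := by
    rw [hBdef, hB.mem_toFinset]
    refine ⟨hγw, fun v hv => hcon v ?_⟩
    rw [hW₁eq]
    exact Submodule.mem_inf.mpr ⟨v.2, hv⟩
  have h1 : coeff (m φ) (D a (D (β φ) F)) ≠ 0 := (Finset.prod_ne_zero_iff.mp ha) φ hφB
  apply h1
  have h2 : D (β φ) F = D γ F := by
    have h3 : D (β φ - γ) F = 0 := D_eq_zero_of_mem (fun l hl => by
      rw [sub_dotProduct]
      exact sub_eq_zero.mpr (hβ φ ⟨l, hl⟩)) hE.1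
    have h4 := D_add (β φ - γ) γ F
    rwa [sub_add_cancel, h3, zero_add] at h4
  rw [h2, D_comm, D_eq_zero_of_mem hγ hmem, coeff_zero]

lemma mem_P_bot {d : ℕ} {F : MvPolynomial (Fin N) k} (hF : F ∈ P (d + 1) (⊥ : Submodule k (Fin N → k))) :
    F = 0 := by
  refine P_induction (p := fun F => F = 0) ?_ rfl ?_ ?_ hF
  · intro l hl
    rw [(Submodule.mem_bot k).mp hl, linForm_zero]; simp
  · rintro _ _ rfl rfl; simp
  · rintro c _ rfl; simp

lemma Ess.ne_zero {d n : ℕ} {W : Submodule k (Fin N → k)} {F : MvPolynomial (Fin N) k}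
    (hE : Ess d W F) (hfin : Module.finrank k W = n + 1) : F ≠ 0 := by
  rintro rfl
  refine hE.2 ⊥ ?_ (zero_mem _)
  rw [bot_lt_iff_ne_bot]
  rintro rfl
  simp at hfin

lemma main_zero (e : ℕ) : Main k N e 0 := by
  intro W hfin F hE h t hh hw
  have : W = ⊥ := Submodule.finrank_eq_zero.mp hfin
  have hF := hE.1
  rw [this] at hF
  rw [mem_P_bot (d := e + 1) hF]
  exact Dec.zero _

lemma main_one (e : ℕ) : Main k N e 1 := by
  intro W hfin F hE h t hh hw
  obtain ⟨w₀, hw₀, hwh₀⟩ := hw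
  obtain ⟨w, hw, hw0⟩ : ∃ w ∈ W, w ≠ 0 := by
    refine (Submodule.ne_bot_iff W).mp ?_
    rintro rfl
    simp at hfin
  have hspan : ∀ v ∈ W, ∃ c : k, c • w = v := by
    intro v hv
    obtain ⟨c, hc⟩ := (finrank_eq_one_iff_of_nonzero' (⟨w, hw⟩ : W) (by simpa using hw0)).mp hfin ⟨v, hv⟩
    exact ⟨c, congrArg Subtype.val hc⟩
  have hwh : eval w h ≠ 0 := by
    obtain ⟨c, rfl⟩ := hspan w₀ hw₀
    rw [eval_smul_homog hh] at hwh₀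
    exact right_ne_zero_of_mul hwh₀
  obtain ⟨c, rfl⟩ : ∃ c : k, F = c • linForm w ^ (e + 2) := by
    refine P_induction (p := fun F => ∃ c : k, F = c • linForm w ^ (e + 2)) ?_ ?_ ?_ ?_ hE.1
    · intro l hl
      obtain ⟨c, rfl⟩ := hspan l hl
      exact ⟨c ^ (e + 2), by rw [linForm_smul, smul_pow]⟩
    · exact ⟨0, by simp⟩
    · rintro _ _ ⟨c, rfl⟩ ⟨c', rfl⟩; exact ⟨c + c', by rw [add_smul]⟩
    · rintro c _ ⟨c', rfl⟩; exact ⟨c * c', by rw [smul_smul]⟩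
  rw [bd_one]
  exact Dec.single c ⟨hw, hwh⟩

end Recursion



section Steps

variable {k : Type} [Field k] {N : ℕ}

/-- The coefficient vector of the linear form `D a F`, for a quadratic form `F`. -/
noncomputable def vL (F : MvPolynomial (Fin N) k) : (Fin N → k) →ₗ[k] (Fin N → k) :=
  LinearMap.pi fun i => (lcoeff k (Finsupp.single i 1)) ∘ₗ DL F

lemma vL_spec {W : Submodule k (Fin N → k)} {F : MvPolynomial (Fin N) k} (hF : F ∈ P 2 W)
    (a : Fin N → k) : vL F a ∈ W ∧ D a F = linForm (vL F a) := by
  obtain ⟨l, hl, hDl⟩ := mem_P_one (D_mem_P (d := 1) a hF)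
  have : vL F a = l := by
    funext i
    change coeff (Finsupp.single i 1) (D a F) = l i
    rw [hDl, coeff_linForm]
  rw [this]
  exact ⟨hl, hDl⟩

lemma vL_surj [CharZero k] {W : Submodule k (Fin N → k)} {F : MvPolynomial (Fin N) k}
    (hE : Ess 2 W F) {w : Fin N → k} (hw : w ∈ W) : ∃ a, vL F a = w := by
  by_contra hcon
  have hw' : w ∉ LinearMap.range (vL F) := fun ⟨a, ha⟩ => hcon ⟨a, ha⟩
  obtain ⟨β, hβ, hβw⟩ := exists_sep hw'
  refine hE.D_ne hw hβw (eq_zero_of_D (D_mem_P (d := 1) β hE.1) fun a => ?_)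
  rw [D_comm, (vL_spec hE.1 a).2, D_linForm, hβ _ ⟨a, rfl⟩, C_0]

lemma main_quad [CharZero k] {n : ℕ} (hIH : ∀ n' ≤ n + 1, Main k N 0 n') : Main k N 0 (n + 2) := by
  intro W hfin F hE h t hh hw
  obtain ⟨Φ₁, hΦ₁, hker⟩ := generic_ker hfin hh hw
  obtain ⟨Φ₂, hΦ₂, hDD⟩ := generic_DD (d := 0) hE.1 (hE.ne_zero hfin)
  obtain ⟨w, hwW, hwh⟩ := hw
  have hΦ₃ : NZ (fun a => eval (vL F a) h) := by
    refine ⟨IsPoly.comp h fun i => isPoly_coeff_D F _, ?_⟩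
    obtain ⟨a, ha⟩ := vL_surj hE hwW
    exact ⟨a, by change eval (vL F a) h ≠ 0; rwa [ha]⟩
  obtain ⟨-, a, ha⟩ := (hΦ₁.mul hΦ₂).mul hΦ₃
  have ha3 := right_ne_zero_of_mul ha
  have ha1 := left_ne_zero_of_mul (left_ne_zero_of_mul ha)
  have ha2 := hDD a (right_ne_zero_of_mul (left_ne_zero_of_mul ha))
  obtain ⟨hvW, hv⟩ := vL_spec hE.1 a
  have hne : D a F ≠ 0 := fun h0 => ha2 (by rw [h0, map_zero])
  have hal : a ⬝ᵥ vL F a ≠ 0 := by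
    intro h0
    apply ha2
    rw [hv, D_linForm, h0, C_0]
  have hdec : Dec (Good (h * linForm a) W) 1 1 (D a F) := by
    have := Dec.single (S := Good (h * linForm a) W) (d := 1) 1 (l := vL F a)
      ⟨hvW, by rw [map_mul, eval_linForm]; exact mul_ne_zero ha3 hal⟩
    rwa [one_smul, pow_one, ← hv] at this
  have := step (e := 0) hfin hE.1 hIH hh (hker a ha1) hdec hne
  refine this.mono le_rfl ?_
  rw [bd_n_zero, bd_n_zero]; omega

/-- The derivative in a generic direction is decomposable. -/
lemma dec_deriv [CharZero k] {e n t : ℕ} {W : Submodule k (Fin N → k)}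
    {F h : MvPolynomial (Fin N) k} {a : Fin N → k}
    (hIH : ∀ n' ≤ n + 2, Main k N e n')
    (hfin : Module.finrank k W = n + 2) (hE : Ess (e + 3) W F)
    (hh : h.IsHomogeneous t) (hw : ∃ w ∈ W, eval w h ≠ 0) (hDD : D a (D a F) ≠ 0)
    (hkey : ∀ W₁ ≤ W, D a F ∈ P (e + 2) W₁ →
      Module.finrank k W₁ = n + 1 → ∃ w ∈ W₁, eval w h ≠ 0) :
    Dec (Good (h * linForm a) W) (e + 2) (bd (n + 2) e) (D a F) := by
  have hh' := hh.mul (linForm_isHomogeneous a)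
  have hDW : D a F ∈ P (e + 2) W := D_mem_P a hE.1
  have haW : ∀ W₁ : Submodule k (Fin N → k), D a F ∈ P (e + 2) W₁ →
      ∃ w ∈ W₁, eval w (linForm a) ≠ 0 := by
    intro W₁ hm
    by_contra hcon
    push Not at hcon
    exact hDD (D_eq_zero_of_mem (fun l hl => by rw [← eval_linForm]; exact hcon l hl) hm)
  obtain ⟨W₁, hW₁, hE₁⟩ := exists_ess hDW
  have hle := Submodule.finrank_mono hW₁
  by_cases hgood : ∃ w ∈ W₁, eval w (h * linForm a) ≠ 0
  · exact (hIH _ (by omega) W₁ rfl _ hE₁ _ _ hh' hgood).mono (Good_mono hW₁) (bd_mono (by omega) e)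
  · have hne2 : Module.finrank k W₁ ≠ n + 2 := by
      intro h2
      have heq : W₁ = W := Submodule.eq_of_le_of_finrank_eq hW₁ (by omega)
      apply hgood
      rw [heq]
      exact exists_both hw (haW W hDW)
    have hne1 : Module.finrank k W₁ ≠ n + 1 := fun h1 =>
      hgood (exists_both (hkey W₁ hW₁ hE₁.1 h1) (haW W₁ hE₁.1))
    obtain ⟨l, hlW, hlh⟩ := exists_both hw (haW W hDW)
    have hl₁ : l ∉ W₁ := fun hmem => hgood ⟨l, hmem, hlh⟩
    have hmem : D a F + (-1 : k) • linForm l ^ (e + 2) ∈ P (e + 2) (W₁ ⊔ Submodule.span k {l}) :=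
      add_mem (P_mono _ le_sup_left hE₁.1)
        (Submodule.smul_mem _ _ (pow_mem_P (Submodule.mem_sup_right
          (Submodule.mem_span_singleton_self l)) _))
    obtain ⟨W₂, hW₂, hE₂⟩ := exists_ess hmem
    have hl₂ : l ∈ W₂ := mem_of_add_pow hE₁.1 hl₁ (neg_ne_zero.mpr one_ne_zero) hE₂.1
    have hle2 : Module.finrank k W₂ ≤ Module.finrank k W₁ + 1 := by
      refine (Submodule.finrank_mono hW₂).trans
        ((Submodule.finrank_add_le_finrank_add_finrank _ _).trans ?_)
      have := finrank_span_le_card (R := k) ({l} : Set (Fin N → k))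
      rw [Set.toFinset_singleton, Finset.card_singleton] at this
      omega
    have hW₂W : W₂ ≤ W := hW₂.trans (sup_le hW₁
      (by rw [Submodule.span_singleton_le_iff_mem]; exact hlW))
    have h3 := (hIH _ (by omega) W₂ rfl _ hE₂ _ _ hh' ⟨l, hl₂, hlh⟩).mono (Good_mono hW₂W)
      (bd_mono (show _ ≤ n + 1 by omega) e)
    have h4 := h3.sum (Dec.single (d := e + 2) 1 (l := l) (S := Good (h * linForm a) W) ⟨hlW, hlh⟩)
    have h5 : D a F + (-1 : k) • linForm l ^ (e + 2) + (1 : k) • linForm l ^ (e + 2) = D a F := by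
      rw [neg_smul]; ring
    rw [h5] at h4
    exact h4.mono le_rfl (bd_lt (n + 1) e)

lemma main_succ [CharZero k] {e n : ℕ} (hne : ¬ (n + 1 = 2 ∧ e = 0))
    (hIHe : ∀ n' ≤ n + 2, Main k N e n') (hIH : ∀ n' ≤ n + 1, Main k N (e + 1) n') :
    Main k N (e + 1) (n + 2) := by
  intro W hfin F hE h t hh hw
  obtain ⟨Φ₁, hΦ₁, hker⟩ := generic_ker hfin hh hw
  obtain ⟨Φ₂, hΦ₂, hDD⟩ := generic_DD (d := e + 1) hE.1 (hE.ne_zero hfin)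
  obtain ⟨Φ₃, hΦ₃, hkey⟩ := generic_key hfin hE hh hw
  obtain ⟨-, a, ha⟩ := (hΦ₁.mul hΦ₂).mul hΦ₃
  have ha3 := right_ne_zero_of_mul ha
  have ha1 := left_ne_zero_of_mul (left_ne_zero_of_mul ha)
  have ha2 := hDD a (right_ne_zero_of_mul (left_ne_zero_of_mul ha))
  have hdec := dec_deriv hIHe hfin hE hh hw ha2 (hkey a ha3)
  have := step (e := e + 1) hfin hE.1 hIH hh (hker a ha1) hdec
    (fun h0 => ha2 (by rw [h0, map_zero]))
  rwa [← bd_succ hne] at this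

end Steps



section Cubic

variable {k : Type} [Field k] {N : ℕ}

lemma binary_coeffs {g0 g1 g2 g3 p1 q1 p2 q2 : k} (hΔ : p1 * q2 - p2 * q1 ≠ 0)
    (h1 : q1 * q2 * g0 - (q1 * p2 + p1 * q2) * g1 + p1 * p2 * g2 = 0)
    (h2 : q1 * q2 * g1 - (q1 * p2 + p1 * q2) * g2 + p1 * p2 * g3 = 0) :
    ∃ t1 t2 : k, g0 = t1 * p1 ^ 3 + t2 * p2 ^ 3 ∧ g1 = t1 * (p1 ^ 2 * q1) + t2 * (p2 ^ 2 * q2) ∧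
      g2 = t1 * (p1 * q1 ^ 2) + t2 * (p2 * q2 ^ 2) ∧ g3 = t1 * q1 ^ 3 + t2 * q2 ^ 3 := by
  refine ⟨(q2 ^ 3 * g0 - 3 * q2 ^ 2 * p2 * g1 + 3 * q2 * p2 ^ 2 * g2 - p2 ^ 3 * g3)
      / (p1 * q2 - p2 * q1) ^ 3,
    -(q1 ^ 3 * g0 - 3 * q1 ^ 2 * p1 * g1 + 3 * q1 * p1 ^ 2 * g2 - p1 ^ 3 * g3)
      / (p1 * q2 - p2 * q1) ^ 3, ?_, ?_, ?_, ?_⟩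
  · rw [div_mul_eq_mul_div, div_mul_eq_mul_div, ← add_div, eq_div_iff (pow_ne_zero _ hΔ)]
    linear_combination (-3 * p1 * p2 * (p1 * q2 - p2 * q1)) * h1
  · rw [div_mul_eq_mul_div, div_mul_eq_mul_div, ← add_div, eq_div_iff (pow_ne_zero _ hΔ)]
    linear_combination (-((p1 * q2) ^ 2 - (p2 * q1) ^ 2)) * h1
      + (-p1 * p2 * (p1 * q2 - p2 * q1)) * h2
  · rw [div_mul_eq_mul_div, div_mul_eq_mul_div, ← add_div, eq_div_iff (pow_ne_zero _ hΔ)]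
    linear_combination (-((p1 * q2) ^ 2 - (p2 * q1) ^ 2)) * h2
      + (-q1 * q2 * (p1 * q2 - p2 * q1)) * h1
  · rw [div_mul_eq_mul_div, div_mul_eq_mul_div, ← add_div, eq_div_iff (pow_ne_zero _ hΔ)]
    linear_combination (-3 * q1 * q2 * (p1 * q2 - p2 * q1)) * h2

/-- The binary cubic with the given coefficients. -/
noncomputable def bin (y z : Fin N → k) (g0 g1 g2 g3 : k) : MvPolynomial (Fin N) k :=
  C g0 * linForm y ^ 3 + 3 * C g1 * (linForm y ^ 2 * linForm z)
    + 3 * C g2 * (linForm y * linForm z ^ 2) + C g3 * linForm z ^ 3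

lemma dec_two {W : Submodule k (Fin N → k)} {h : MvPolynomial (Fin N) k}
    {y z : Fin N → k} (hyW : y ∈ W) (hzW : z ∈ W)
    {g0 g1 g2 g3 p1 q1 p2 q2 : k} (hΔ : p1 * q2 - p2 * q1 ≠ 0)
    (h1 : q1 * q2 * g0 - (q1 * p2 + p1 * q2) * g1 + p1 * p2 * g2 = 0)
    (h2 : q1 * q2 * g1 - (q1 * p2 + p1 * q2) * g2 + p1 * p2 * g3 = 0)
    (hm1 : eval (p1 • y + q1 • z) h ≠ 0) (hm2 : eval (p2 • y + q2 • z) h ≠ 0) :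
    Dec (Good h W) 3 2 (bin y z g0 g1 g2 g3) := by
  obtain ⟨t1, t2, e0, e1, e2, e3⟩ := binary_coeffs hΔ h1 h2
  have := (Dec.single (S := Good h W) (d := 3) t1 (l := p1 • y + q1 • z)
    ⟨add_mem (W.smul_mem _ hyW) (W.smul_mem _ hzW), hm1⟩).sum
    (Dec.single (S := Good h W) (d := 3) t2 (l := p2 • y + q2 • z)
    ⟨add_mem (W.smul_mem _ hyW) (W.smul_mem _ hzW), hm2⟩)
  convert this using 1
  rw [bin, e0, e1, e2, e3]
  simp only [linForm_add, linForm_smul, smul_eq_C_mul, map_add, map_mul, map_pow]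
  ring

lemma dec_bin [IsAlgClosed k] [CharZero k] {t : ℕ} {W : Submodule k (Fin N → k)}
    {h : MvPolynomial (Fin N) k} (hh : h.IsHomogeneous t)
    {y z : Fin N → k} (hyW : y ∈ W) (hzW : z ∈ W) (hy : eval y h ≠ 0)
    {g0 g1 g2 g3 : k}
    (hdisc : (g0 * g3 - g1 * g2) ^ 2 - 4 * (g0 * g2 - g1 ^ 2) * (g1 * g3 - g2 ^ 2) ≠ 0)
    (hroot : ∀ s : k, eval (s • y + z) h = 0 →
      (g1 * g3 - g2 ^ 2) * s ^ 2 - (g0 * g3 - g1 * g2) * s + (g0 * g2 - g1 ^ 2) ≠ 0) :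
    Dec (Good h W) 3 2 (bin y z g0 g1 g2 g3) := by
  by_cases hD : g1 * g3 - g2 ^ 2 = 0
  · have hB : g0 * g3 - g1 * g2 ≠ 0 := by
      intro hB
      apply hdisc
      rw [hD, hB]; ring
    refine dec_two (p1 := 1) (q1 := 0) (p2 := g0 * g2 - g1 ^ 2) (q2 := g0 * g3 - g1 * g2) hyW hzW
      (by simpa using hB) (by linear_combination -g0 * hD)
      (by linear_combination -g1 * hD) (by simpa using hy) ?_
    intro h0
    refine hroot ((g0 * g2 - g1 ^ 2) / (g0 * g3 - g1 * g2)) ?_ ?_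
    · have h3 : ((g0 * g2 - g1 ^ 2) / (g0 * g3 - g1 * g2)) • y + z
          = (g0 * g3 - g1 * g2)⁻¹ • ((g0 * g2 - g1 ^ 2) • y + (g0 * g3 - g1 * g2) • z) := by
        rw [smul_add, smul_smul, smul_smul, inv_mul_cancel₀ hB, one_smul, div_eq_inv_mul]
      rw [h3, eval_smul_homog hh, h0, mul_zero]
    · rw [hD, mul_div_cancel₀ _ hB]; ring
  · obtain ⟨r, hr⟩ := IsAlgClosed.exists_pow_nat_eq
      ((g0 * g3 - g1 * g2) ^ 2 - 4 * (g0 * g2 - g1 ^ 2) * (g1 * g3 - g2 ^ 2)) (n := 2) (by norm_num)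
    have hr0 : r ≠ 0 := by
      rintro rfl
      apply hdisc
      rw [← hr]; ring
    generalize hA' : g0 * g2 - g1 ^ 2 = A at *
    generalize hB' : g0 * g3 - g1 * g2 = B at *
    generalize hD' : g1 * g3 - g2 ^ 2 = E at *
    have h20 : (2 : k) ≠ 0 := two_ne_zero
    refine dec_two (p1 := (B + r) / (2 * E)) (q1 := 1) (p2 := (B - r) / (2 * E)) (q2 := 1) hyW hzW
      ?_ ?_ ?_ ?_ ?_
    · have : (B + r) / (2 * E) * 1 - (B - r) / (2 * E) * 1 = r / E := by field_simp; ring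
      rw [this]; exact div_ne_zero hr0 hD
    · have e1 : (B + r) / (2 * E) * ((B - r) / (2 * E)) = A / E := by
        field_simp; linear_combination -hr
      have e2 : (1 * ((B - r) / (2 * E)) + (B + r) / (2 * E) * 1) = B / E := by field_simp; ring
      rw [e1, e2]
      field_simp
      rw [← hA', ← hB', ← hD']; ring
    · have e1 : (B + r) / (2 * E) * ((B - r) / (2 * E)) = A / E := by
        field_simp; linear_combination -hr
      have e2 : (1 * ((B - r) / (2 * E)) + (B + r) / (2 * E) * 1) = B / E := by field_simp; ring
      rw [e1, e2]
      field_simp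
      rw [← hA', ← hB', ← hD']; ring
    · intro h0
      rw [one_smul] at h0
      apply hroot _ h0
      field_simp
      linear_combination hr
    · intro h0
      rw [one_smul] at h0
      apply hroot _ h0
      field_simp
      linear_combination hr

lemma roots_finite {h : MvPolynomial (Fin N) k} {y z : Fin N → k} (hz : eval z h ≠ 0) :
    {s : k | eval (s • y + z) h = 0}.Finite := by
  classical
  let ψ : MvPolynomial (Fin N) k →ₐ[k] Polynomial k :=
    aeval (fun i => Polynomial.X * Polynomial.C (y i) + Polynomial.C (z i))
  have hψ : ∀ s : k, (ψ h).eval s = eval (s • y + z) h := by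
    intro s
    rw [← Polynomial.coe_evalRingHom]
    change ((Polynomial.evalRingHom s).comp (ψ : MvPolynomial (Fin N) k →+* Polynomial k)) h = _
    congr 1
    apply MvPolynomial.ringHom_ext
    · intro c; simp [ψ]
    · intro i; simp [ψ]; ring
  have hne : ψ h ≠ 0 := by
    intro h0
    apply hz
    have := hψ 0
    rw [h0] at this
    simpa using this.symm
  refine (ψ h).roots.toFinset.finite_toSet.subset fun s hs => ?_
  simp only [Finset.mem_coe, Multiset.mem_toFinset]
  refine (Polynomial.mem_roots hne).mpr ?_
  rw [Polynomial.IsRoot, hψ]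
  exact hs

/-- Ternary cubics with a nondegenerate derivative have open rank at most five. -/
lemma dec_cubic [IsAlgClosed k] [CharZero k] {t : ℕ} {W : Submodule k (Fin N → k)}
    {h : MvPolynomial (Fin N) k} (hh : h.IsHomogeneous t)
    {x y z : Fin N → k} (hxW : x ∈ W) (hyW : y ∈ W) (hzW : z ∈ W) (hy : eval y h ≠ 0)
    (hz : eval z h ≠ 0) {t0 : k} (hx : eval (x + t0 • (y + z)) h ≠ 0) (c0 c1 c2 c3 : k) :
    Dec (Good h W) 3 5 (linForm x ^ 3 + 3 * linForm x * (linForm y ^ 2 + linForm z ^ 2)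
      + bin y z c0 c1 c2 c3) := by
  classical
  have h20 : (2 : k) ≠ 0 := two_ne_zero
  -- the coefficients of the binary cubic, as functions of the parameter
  let K : k → k := fun ε => ε * (2 + ε ^ 2) ^ 2 * (2 - ε ^ 2)
  let n0 : k → k := fun ε => 4 * ((1 - ε ^ 6 / 8) * (2 - ε ^ 2) - 2 * ε ^ 4)
  let n1 : k → k := fun ε => 4 * ε ^ 2 * ((-1 / 2 + ε ^ 2 / 4) * (2 - ε ^ 2) - 2 * ε ^ 2)
  let g0 : k → k := fun ε => K ε * c0 - n0 ε
  let g1 : k → k := fun ε => K ε * c1 - n1 ε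
  let g2 : k → k := fun ε => K ε * c2 - n1 ε
  let g3 : k → k := fun ε => K ε * c3 - n0 ε
  have pe : IsPoly (fun a : Fin 1 → k => a 0) := IsPoly.coord 0
  have pc : ∀ c : k, IsPoly (fun _ : Fin 1 → k => c) := fun c => IsPoly.const c
  have pK : IsPoly (fun a : Fin 1 → k => K (a 0)) :=
    (pe.mul (((pc 2).add (pe.pow 2)).pow 2)).mul ((pc 2).sub (pe.pow 2))
  have pn0 : IsPoly (fun a : Fin 1 → k => n0 (a 0)) := by
    have := (pc 4).mul ((((pc 1).sub ((pe.pow 6).mul (pc (1 / 8)))).mul ((pc 2).sub (pe.pow 2))).sub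
      ((pc 2).mul (pe.pow 4)))
    convert this using 2
    simp only [n0]; ring
  have pn1 : IsPoly (fun a : Fin 1 → k => n1 (a 0)) := by
    have := ((pc 4).mul (pe.pow 2)).mul ((((pc (-1 / 2)).add ((pe.pow 2).mul (pc (1 / 4)))).mul
      ((pc 2).sub (pe.pow 2))).sub ((pc 2).mul (pe.pow 2)))
    convert this using 2
    simp only [n1]; ring
  have pg0 : IsPoly (fun a : Fin 1 → k => g0 (a 0)) := (pK.mul (pc c0)).sub pn0
  have pg1 : IsPoly (fun a : Fin 1 → k => g1 (a 0)) := (pK.mul (pc c1)).sub pn1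
  have pg2 : IsPoly (fun a : Fin 1 → k => g2 (a 0)) := (pK.mul (pc c2)).sub pn1
  have pg3 : IsPoly (fun a : Fin 1 → k => g3 (a 0)) := (pK.mul (pc c3)).sub pn0
  have pA := (pg0.mul pg2).sub (pg1.pow 2)
  have pB := (pg0.mul pg3).sub (pg1.mul pg2)
  have pD := (pg1.mul pg3).sub (pg2.pow 2)
  have z0 : g0 0 = -8 := by simp [g0, K, n0]; norm_num
  have z1 : g1 0 = 0 := by simp [g1, K, n1]
  have z2 : g2 0 = 0 := by simp [g2, K, n1]
  have z3 : g3 0 = -8 := by simp [g3, K, n0]; norm_num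
  -- genericity conditions
  have hroots := roots_finite (y := y) hz
  set T := hroots.toFinset with hT
  have q1 : NZ (fun a : Fin 1 → k => ∏ s ∈ T, ((g1 (a 0) * g3 (a 0) - g2 (a 0) ^ 2) * s ^ 2
      - (g0 (a 0) * g3 (a 0) - g1 (a 0) * g2 (a 0)) * s + (g0 (a 0) * g2 (a 0) - g1 (a 0) ^ 2))) := by
    refine NZ.prod T fun s hs => ⟨((pD.mul (pc (s ^ 2))).sub (pB.mul (pc s))).add pA, 0, ?_⟩
    have hs0 : s ≠ 0 := by
      rintro rfl
      have := hroots.mem_toFinset.mp hs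
      apply hz
      simpa using this
    simp only [Pi.zero_apply, z0, z1, z2, z3]
    intro h0
    have h64 : (64 : k) * s = 0 := by linear_combination -h0
    exact (mul_ne_zero (by norm_num) hs0) h64
  have q2 : NZ (fun a : Fin 1 → k => (g0 (a 0) * g3 (a 0) - g1 (a 0) * g2 (a 0)) ^ 2
      - 4 * (g0 (a 0) * g2 (a 0) - g1 (a 0) ^ 2) * (g1 (a 0) * g3 (a 0) - g2 (a 0) ^ 2)) := by
    refine ⟨(pB.pow 2).sub (((pc 4).mul pA).mul pD), 0, ?_⟩
    simp only [Pi.zero_apply, z0, z1, z2, z3]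
    norm_num
  have q3 : NZ (fun a : Fin 1 → k => K (a 0)) := by
    refine ⟨pK, 1, ?_⟩
    simp only [K, Pi.one_apply]
    norm_num
  have q4 : NZ (fun a : Fin 1 → k => eval (a 0 • x + y - (a 0 ^ 2 / 2) • z) h) := by
    refine ⟨IsPoly.comp h fun i => ?_, 0, by simpa using hy⟩
    have := ((pe.mul (pc (x i))).add (pc (y i))).sub ((pe.pow 2).mul (pc (z i / 2)))
    convert this using 2
    simp; ring
  have q5 : NZ (fun a : Fin 1 → k => eval (a 0 • x - (a 0 ^ 2 / 2) • y + z) h) := by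
    refine ⟨IsPoly.comp h fun i => ?_, 0, by simpa using hz⟩
    have := ((pe.mul (pc (x i))).sub ((pe.pow 2).mul (pc (y i / 2)))).add (pc (z i))
    convert this using 2
    simp; ring
  have q6 : NZ (fun a : Fin 1 → k => eval ((2 - a 0 ^ 2) • x - (2 * a 0) • (y + z)) h) := by
    refine ⟨IsPoly.comp h fun i => ?_, ?_⟩
    · exact (((pc 2).sub (pe.pow 2)).mul (pc (x i))).sub (((pc 2).mul pe).mul (pc ((y + z) i)))
    · obtain ⟨ε, h1, h2⟩ : ∃ ε : k, 2 - ε ^ 2 ≠ 0 ∧ 2 * ε = - ((2 - ε ^ 2) * t0) := by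
        by_cases ht0 : t0 = 0
        · exact ⟨0, by simp, by simp [ht0]⟩
        · obtain ⟨r, hr⟩ := IsAlgClosed.exists_pow_nat_eq (1 + 2 * t0 ^ 2) (n := 2) (by norm_num)
          have hne : 1 + r ≠ 0 := by
            intro h0
            have h3 : 2 * t0 ^ 2 = 0 := by linear_combination (r - 1) * h0 - hr
            exact mul_ne_zero h20 (pow_ne_zero 2 ht0) h3
          have h4 : 2 * ((1 + r) / t0) = - ((2 - ((1 + r) / t0) ^ 2) * t0) := by
            field_simp
            linear_combination -hr
          refine ⟨(1 + r) / t0, fun h0 => ?_, h4⟩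
          rw [h0, zero_mul, neg_zero] at h4
          exact mul_ne_zero h20 (div_ne_zero hne ht0) h4
      refine ⟨fun _ => ε, ?_⟩
      change eval ((2 - ε ^ 2) • x - (2 * ε) • (y + z)) h ≠ 0
      have h3 : (2 - ε ^ 2) • x - (2 * ε) • (y + z) = (2 - ε ^ 2) • (x + t0 • (y + z)) := by
        rw [h2]; module
      rw [h3, eval_smul_homog hh]
      exact mul_ne_zero (pow_ne_zero _ h1) hx
  obtain ⟨-, a, ha⟩ := ((q1.mul q2).mul q3).mul ((q4.mul q5).mul q6)
  simp only [mul_ne_zero_iff] at ha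
  obtain ⟨⟨⟨r1, r2⟩, r3⟩, ⟨r4, r5⟩, r6⟩ := ha
  generalize a 0 = ε at r1 r2 r3 r4 r5 r6
  have hG := dec_bin hh hyW hzW hy r2 (fun s hs => by
    have := Finset.prod_ne_zero_iff.mp r1 s (hroots.mem_toFinset.mpr hs)
    exact this)
  have d1 := Dec.single (S := Good h W) (d := 3) (4 * (2 - ε ^ 2))
    (l := ε • x + y - (ε ^ 2 / 2) • z)
    ⟨sub_mem (add_mem (W.smul_mem _ hxW) hyW) (W.smul_mem _ hzW), r4⟩
  have d2 := Dec.single (S := Good h W) (d := 3) (4 * (2 - ε ^ 2))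
    (l := ε • x - (ε ^ 2 / 2) • y + z)
    ⟨add_mem (sub_mem (W.smul_mem _ hxW) (W.smul_mem _ hyW)) hzW, r5⟩
  have d3 := Dec.single (S := Good h W) (d := 3) ε
    (l := (2 - ε ^ 2) • x - (2 * ε) • (y + z))
    ⟨sub_mem (W.smul_mem _ hxW) (W.smul_mem _ (add_mem hyW hzW)), r6⟩
  have hsum := (((d1.sum d2).sum d3).sum hG).smul (inv_ne_zero r3)
  convert hsum using 1
  rw [eq_inv_smul_iff₀ r3]
  obtain ⟨δ, hδ⟩ : ∃ δ : k, ε = 2 * δ := ⟨ε / 2, by field_simp⟩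
  have f1 : ε ^ 2 / 2 = 2 * δ ^ 2 := by rw [hδ]; ring
  have f2 : n0 ε = 4 * ((1 - 8 * δ ^ 6) * (2 - 4 * δ ^ 2) - 32 * δ ^ 4) := by
    simp only [n0]; rw [hδ]; ring
  have f3 : n1 ε = 16 * δ ^ 2 * (-(1 - 2 * δ ^ 2) ^ 2 - 8 * δ ^ 2) := by
    simp only [n1]; rw [hδ]; field_simp; ring
  have c2' : (C (2 : k) : MvPolynomial (Fin N) k) = 2 := rfl
  have c4' : (C (4 : k) : MvPolynomial (Fin N) k) = 4 := rfl
  have c8' : (C (8 : k) : MvPolynomial (Fin N) k) = 8 := rfl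
  have c16' : (C (16 : k) : MvPolynomial (Fin N) k) = 16 := rfl
  have c32' : (C (32 : k) : MvPolynomial (Fin N) k) = 32 := rfl
  simp only [bin, g0, g1, g2, g3, f1, f2, f3, K]
  rw [hδ]
  simp only [linForm_add, linForm_sub, linForm_smul, smul_eq_C_mul,
    map_add, map_sub, map_mul, map_pow, map_neg, c2', c4', c8', c16', c32', C_1]
  ring

end Cubic



section Ternary

variable {k : Type} [Field k] {N : ℕ}

lemma D_smulF (a : Fin N → k) (c : k) (F : MvPolynomial (Fin N) k) : D a (c • F) = c • D a F :=
  Derivation.map_smul _ _ _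

lemma exists_DDD_ne [CharZero k] {W : Submodule k (Fin N → k)} {F : MvPolynomial (Fin N) k}
    (hF : F ∈ P 3 W) (h0 : F ≠ 0) : ∃ a, D a (D a (D a F)) ≠ 0 := by
  by_contra hcon
  push Not at hcon
  obtain ⟨b, hb⟩ := exists_DD_ne (d := 1) hF h0
  refine hb (eq_zero_of_D (D_mem_P (d := 1) b (D_mem_P b hF)) fun a => ?_)
  have h1 := hcon (a + b)
  have h2 := hcon (a + (-1 : k) • b)
  have ha := hcon a
  have hb' := hcon b
  have e1 : D b (D a (D a F)) = D a (D a (D b F)) := by rw [D_comm b a, D_comm b a]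
  have e2 : D b (D b (D a F)) = D a (D b (D b F)) := by rw [D_comm b a, D_comm b a]
  have e3 : D a (D b (D a F)) = D a (D a (D b F)) := by rw [D_comm b a]
  have e4 : D b (D a (D b F)) = D a (D b (D b F)) := by rw [D_comm b a]
  simp only [D_add, D_smul, D_smulF, map_add, ha, hb', e1, e2, e3, e4] at h1 h2
  have h6 : (6 : k) • D a (D b (D b F)) = 0 := by
    have := congrArg₂ (· + ·) h1 h2
    simp only [add_zero] at this
    rw [← this]
    module
  exact (smul_eq_zero.mp h6).resolve_left (by norm_num)

lemma generic_DDD [CharZero k] {W : Submodule k (Fin N → k)} {F : MvPolynomial (Fin N) k}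
    (hF : F ∈ P 3 W) (h0 : F ≠ 0) :
    ∃ Φ : (Fin N → k) → k, NZ Φ ∧ ∀ a, Φ a ≠ 0 → D a (D a (D a F)) ≠ 0 := by
  obtain ⟨a, ha⟩ := exists_DDD_ne hF h0
  obtain ⟨m, hm⟩ := exists_coeff_ne ha
  refine ⟨fun a => coeff m (D a (D a (D a F))), ⟨isPoly_coeff_DDD F m, a, hm⟩, fun b hb h1 => hb ?_⟩
  change coeff m (D b (D b (D b F))) = 0
  rw [h1, coeff_zero]

lemma parallel {u v : Fin N → k} (hu : u ≠ 0) (h : ∀ i j, u i * v j - u j * v i = 0) :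
    ∃ s : k, v = s • u := by
  obtain ⟨i, hi⟩ := Function.ne_iff.mp hu
  refine ⟨v i / u i, funext fun j => ?_⟩
  have hi' : u i ≠ 0 := hi
  rw [Pi.smul_apply, smul_eq_mul, div_mul_eq_mul_div, eq_div_iff hi']
  linear_combination h i j

lemma generic_minor [CharZero k] {n : ℕ} {W : Submodule k (Fin N → k)} {F : MvPolynomial (Fin N) k}
    (hfin : Module.finrank k W = n + 2) (hE : Ess 3 W F) :
    ∃ Φ : (Fin N → k) → k, NZ Φ ∧ ∀ a, Φ a ≠ 0 → ∀ W₁ : Submodule k (Fin N → k),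
      D a F ∈ P 2 W₁ → 2 ≤ Module.finrank k W₁ := by
  by_cases hex : ∃ a b c : Fin N → k, ∃ i j : Fin N,
      vL (D b F) a i * vL (D c F) a j - vL (D b F) a j * vL (D c F) a i ≠ 0
  · obtain ⟨a, b, c, i, j, hne⟩ := hex
    refine ⟨fun a => vL (D b F) a i * vL (D c F) a j - vL (D b F) a j * vL (D c F) a i,
      ⟨((isPoly_coeff_D _ _).mul (isPoly_coeff_D _ _)).sub
        ((isPoly_coeff_D _ _).mul (isPoly_coeff_D _ _)), a, hne⟩, ?_⟩
    intro a ha W₁ hW₁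
    by_contra hlt
    obtain ⟨v, hv⟩ := finrank_le_one_iff.mp (show Module.finrank k W₁ ≤ 1 by omega)
    have hpar : ∀ b : Fin N → k, ∃ s : k, vL (D b F) a = s • (v : Fin N → k) := by
      intro b
      obtain ⟨l, hl, hDl⟩ := mem_P_one (D_mem_P (d := 1) b hW₁)
      have : vL (D b F) a = l := by
        funext i
        change coeff (Finsupp.single i 1) (D a (D b F)) = l i
        rw [D_comm, hDl, coeff_linForm]
      rw [this]
      obtain ⟨s, hs⟩ := hv ⟨l, hl⟩
      exact ⟨s, (congrArg Subtype.val hs).symm⟩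
    obtain ⟨s, hs⟩ := hpar b
    obtain ⟨s', hs'⟩ := hpar c
    apply ha
    simp only [hs, hs', Pi.smul_apply, smul_eq_mul]
    ring
  · exfalso
    push Not at hex
    have hsymm : ∀ a b, vL (D b F) a = vL (D a F) b := by
      intro a b
      funext i
      change coeff _ (D a (D b F)) = coeff _ (D b (D a F))
      rw [D_comm]
    have hD2 : ∀ b, D b F ∈ P 2 W := fun b => D_mem_P b hE.1
    obtain ⟨a, ha⟩ := exists_DD_ne (d := 1) hE.1 (hE.ne_zero (n := n + 1) hfin)
    set l := vL (D a F) a with hl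
    have hl0 : l ≠ 0 := by
      intro h0
      apply ha
      rw [(vL_spec (hD2 a) a).2, ← hl, h0, linForm_zero]
    have hMa : ∀ b, ∃ s : k, vL (D b F) a = s • l := fun b =>
      parallel hl0 fun i j => hex a a b i j
    have hadd : ∀ b b' c, vL (D c F) (b + b') = vL (D c F) b + vL (D c F) b' := fun b b' c =>
      map_add _ _ _
    have hcase : ∀ b c (s : k), s ≠ 0 → vL (D a F) b = s • l → ∃ r : k, vL (D c F) b = r • l := by
      intro b c s hs hb
      obtain ⟨r, hr⟩ := parallel (u := vL (D a F) b) (v := vL (D c F) b)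
        (by rw [hb]; exact smul_ne_zero hs hl0) fun i j => hex b a c i j
      exact ⟨r * s, by rw [hr, hb, smul_smul]⟩
    have hall : ∀ b c, ∃ r : k, vL (D c F) b = r • l := by
      intro b c
      obtain ⟨s, hs⟩ := hMa b
      rw [hsymm] at hs
      by_cases hs0 : s = 0
      · have h1 : vL (D a F) (a + b) = (1 : k) • l := by
          rw [hadd, hs, hs0, zero_smul, add_zero, one_smul]
        obtain ⟨r, hr⟩ := hcase (a + b) c 1 one_ne_zero h1
        obtain ⟨r', hr'⟩ := hMa c
        refine ⟨r - r', ?_⟩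
        rw [hadd, hr'] at hr
        rw [sub_smul, ← hr, add_sub_cancel_left]
      · exact hcase b c s hs0 hs
    obtain ⟨w, hw, hwl⟩ : ∃ w ∈ W, w ∉ Submodule.span k {l} := by
      by_contra hcon
      push Not at hcon
      have h1 := Submodule.finrank_mono (show W ≤ Submodule.span k {l} from hcon)
      have := finrank_span_le_card (R := k) ({l} : Set (Fin N → k))
      rw [Set.toFinset_singleton, Finset.card_singleton] at this
      omega
    obtain ⟨β, hβ, hβw⟩ := exists_sep hwl
    have hβl := hβ l (Submodule.mem_span_singleton_self l)
    refine hE.D_ne hw hβw (eq_zero_of_D (d := 1) (D_mem_P β hE.1) fun b => ?_)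
    refine eq_zero_of_D (d := 0) (D_mem_P b (D_mem_P β hE.1)) fun c => ?_
    rw [D_comm b β, D_comm c β, (vL_spec (hD2 b) c).2, D_linForm]
    obtain ⟨r, hr⟩ := hall c b
    rw [hr, dotProduct_smul, hβl, smul_zero, C_0]

lemma Dec.zero_eq {S : Set (Fin N → k)} {d : ℕ} {F : MvPolynomial (Fin N) k} (h : Dec S d 0 F) :
    F = 0 := by
  cases h; rfl

lemma Dec.succ_inv {S : Set (Fin N → k)} {d m : ℕ} {F : MvPolynomial (Fin N) k}
    (h : Dec S d (m + 1) F) {U : Submodule k (Fin N → k)} (hS : ∀ l ∈ S, l ∈ U) :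
    ∃ (F' : MvPolynomial (Fin N) k) (c : k) (l : Fin N → k), l ∈ U ∧ Dec S d m F' ∧
      F = F' + c • linForm l ^ d := by
  cases h with
  | zero => exact ⟨0, 0, 0, zero_mem _, Dec.zero _, by simp⟩
  | @add m F c l h hc hl => exact ⟨F, c, l, hS _ hl, h, rfl⟩

/-- A binary quadratic form is a product. -/
lemma quad_factor [IsAlgClosed k] [CharZero k] (hIH0 : ∀ n' ≤ 2, Main k N 0 n')
    {U : Submodule k (Fin N → k)} (hU : Module.finrank k U ≤ 2) {Q : MvPolynomial (Fin N) k}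
    (hQ : Q ∈ P 2 U) : ∃ f ∈ U, ∃ g ∈ U, Q = linForm f * linForm g := by
  obtain ⟨U', hU', hE⟩ := exists_ess hQ
  have hle := Submodule.finrank_mono hU'
  have h1 := (hIH0 _ (by omega) U' rfl Q hE 1 0 (isHomogeneous_one _ _)
    ⟨0, zero_mem _, by simp⟩).mono (m' := 2) (Good_mono hU') (by rw [bd_n_zero]; omega)
  obtain ⟨Q', c1, p, hp, h2, rfl⟩ := h1.succ_inv fun l hl => hl.1
  obtain ⟨Q'', c2, r, hr, h3, rfl⟩ := h2.succ_inv fun l hl => hl.1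
  rw [h3.zero_eq]
  obtain ⟨s1, hs1⟩ := IsAlgClosed.exists_pow_nat_eq c1 (n := 2) (by norm_num)
  obtain ⟨s2, hs2⟩ := IsAlgClosed.exists_pow_nat_eq c2 (n := 2) (by norm_num)
  obtain ⟨i, hi⟩ := IsAlgClosed.exists_pow_nat_eq (-1 : k) (n := 2) (by norm_num)
  refine ⟨s1 • p + (i * s2) • r, add_mem (U.smul_mem _ hp) (U.smul_mem _ hr),
    s1 • p - (i * s2) • r, sub_mem (U.smul_mem _ hp) (U.smul_mem _ hr), ?_⟩
  have hi' : (C i : MvPolynomial (Fin N) k) ^ 2 = -1 := by rw [← C_pow, hi, C_neg, C_1]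
  rw [← hs1, ← hs2]
  simp only [linForm_add, linForm_sub, linForm_smul, smul_eq_C_mul, map_mul, map_pow]
  linear_combination (C s2 : MvPolynomial (Fin N) k) ^ 2 * linForm r ^ 2 * hi'

lemma exists_bin {U : Submodule k (Fin N → k)} {y z : Fin N → k}
    (hU : ∀ v ∈ U, ∃ α β : k, v = α • y + β • z) {G : MvPolynomial (Fin N) k} (hG : G ∈ P 3 U) :
    ∃ d0 d1 d2 d3 : k, G = bin y z d0 d1 d2 d3 := by
  refine P_induction (p := fun G => ∃ d0 d1 d2 d3 : k, G = bin y z d0 d1 d2 d3) ?_ ?_ ?_ ?_ hG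
  · intro l hl
    obtain ⟨α, β, rfl⟩ := hU l hl
    refine ⟨α ^ 3, α ^ 2 * β, α * β ^ 2, β ^ 3, ?_⟩
    simp only [bin, linForm_add, linForm_smul, smul_eq_C_mul, map_mul, map_pow]
    ring
  · exact ⟨0, 0, 0, 0, by simp [bin]⟩
  · rintro _ _ ⟨a0, a1, a2, a3, rfl⟩ ⟨b0, b1, b2, b3, rfl⟩
    refine ⟨a0 + b0, a1 + b1, a2 + b2, a3 + b3, ?_⟩
    simp only [bin, map_add]
    ring
  · rintro c _ ⟨a0, a1, a2, a3, rfl⟩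
    refine ⟨c * a0, c * a1, c * a2, c * a3, ?_⟩
    simp only [bin, map_mul, smul_eq_C_mul]
    ring

/-- Choice of coordinates adapted to `h`. -/
lemma exists_coords [IsAlgClosed k] [CharZero k] {t : ℕ} {h : MvPolynomial (Fin N) k}
    (hh : h.IsHomogeneous t) {x f g : Fin N → k}
    (h1 : ∃ α β : k, eval (α • f + β • g) h ≠ 0)
    (h2 : ∃ α β γ : k, eval (α • x + β • f + γ • g) h ≠ 0) :
    ∃ (y z : Fin N → k) (t0 μ ν i : k), μ * ν = 1 ∧ i ^ 2 = -1 ∧ f = μ • (y + i • z) ∧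
      g = ν • (y - i • z) ∧ eval y h ≠ 0 ∧ eval z h ≠ 0 ∧ eval (x + t0 • (y + z)) h ≠ 0 := by
  obtain ⟨i, hi⟩ := IsAlgClosed.exists_pow_nat_eq (-1 : k) (n := 2) (by norm_num)
  have hi0 : i ≠ 0 := by
    rintro rfl
    norm_num at hi
  have h20 : (2 : k) ≠ 0 := two_ne_zero
  have hi1 : 1 + i ≠ 0 := by
    intro h0
    have : (2 : k) = 0 := by linear_combination (1 - i) * h0 + hi
    exact h20 this
  have p0 : IsPoly (fun a : Fin 2 → k => a 0) := IsPoly.coord 0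
  have p1 : IsPoly (fun a : Fin 2 → k => a 1) := IsPoly.coord 1
  have pc : ∀ c : k, IsPoly (fun _ : Fin 2 → k => c) := fun c => IsPoly.const c
  -- points on the line with nonzero second coordinate
  obtain ⟨r, hr⟩ : ∃ r : k, eval (r • f + g) h ≠ 0 := by
    obtain ⟨α, β, hαβ⟩ := h1
    have n1 : NZ (fun a : Fin 2 → k => eval (a 0 • f + a 1 • g) h) :=
      ⟨IsPoly.comp h fun j => (p0.mul (pc (f j))).add (p1.mul (pc (g j))), ![α, β], by simpa using hαβ⟩
    have n2 : NZ (fun a : Fin 2 → k => a 1) := ⟨p1, fun _ => 1, one_ne_zero⟩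
    obtain ⟨-, a, ha⟩ := n1.mul n2
    have ha1 := right_ne_zero_of_mul ha
    have ha0 := left_ne_zero_of_mul ha
    refine ⟨a 0 / a 1, fun h0 => ha0 ?_⟩
    have : a 0 • f + a 1 • g = a 1 • ((a 0 / a 1) • f + g) := by
      rw [smul_add, smul_smul, mul_div_cancel₀ _ ha1]
    rw [this, eval_smul_homog hh, h0, mul_zero]
  obtain ⟨ρ', b', hρ'⟩ : ∃ ρ b : k, eval (x + b • (ρ • f + g)) h ≠ 0 := by
    obtain ⟨α, β, γ, hαβ⟩ := h2
    have m0 : IsPoly (fun a : Fin 3 → k => a 0) := IsPoly.coord 0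
    have m1 : IsPoly (fun a : Fin 3 → k => a 1) := IsPoly.coord 1
    have m2 : IsPoly (fun a : Fin 3 → k => a 2) := IsPoly.coord 2
    have mc : ∀ c : k, IsPoly (fun _ : Fin 3 → k => c) := fun c => IsPoly.const c
    have n1 : NZ (fun a : Fin 3 → k => eval (a 0 • x + a 1 • f + a 2 • g) h) :=
      ⟨IsPoly.comp h fun j => ((m0.mul (mc (x j))).add (m1.mul (mc (f j)))).add (m2.mul (mc (g j))),
        ![α, β, γ], by simpa using hαβ⟩
    have n2 : NZ (fun a : Fin 3 → k => a 0 * a 2) := ⟨m0.mul m2, fun _ => 1, by simp⟩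
    obtain ⟨-, a, ha⟩ := n1.mul n2
    have hb := right_ne_zero_of_mul ha
    have ha0 := left_ne_zero_of_mul ha
    have hb0 := left_ne_zero_of_mul hb
    have hb2 := right_ne_zero_of_mul hb
    refine ⟨a 1 / a 2, a 2 / a 0, fun h0 => ha0 ?_⟩
    have : a 0 • x + a 1 • f + a 2 • g = a 0 • (x + (a 2 / a 0) • ((a 1 / a 2) • f + g)) := by
      rw [smul_add, smul_add, smul_add, smul_smul, smul_smul, smul_smul,
        show a 0 * (a 2 / a 0) * (a 1 / a 2) = a 1 by field_simp,
        show a 0 * (a 2 / a 0) = a 2 by field_simp, add_assoc]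
    rw [this, eval_smul_homog hh, h0, mul_zero]
  have n1 : NZ (fun a : Fin 2 → k => eval ((i * a 0) • f + g) h) :=
    ⟨IsPoly.comp h fun j => (((pc i).mul p0).mul (pc (f j))).add (pc (g j)), fun _ => r / i, by
      change eval ((i * (r / i)) • f + g) h ≠ 0
      rw [mul_div_cancel₀ _ hi0]; exact hr⟩
  have n2 : NZ (fun a : Fin 2 → k => eval ((i * a 0) • f - g) h) :=
    ⟨IsPoly.comp h fun j => (((pc i).mul p0).mul (pc (f j))).sub (pc (g j)), fun _ => -r / i, by
      change eval ((i * (-r / i)) • f - g) h ≠ 0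
      rw [mul_div_cancel₀ _ hi0, show (-r) • f - g = (-1 : k) • (r • f + g) by module,
        eval_smul_homog hh]
      exact mul_ne_zero (pow_ne_zero _ (by norm_num)) hr⟩
  have n3 : NZ (fun a : Fin 2 → k => eval (x + a 1 • (a 0 • f + g)) h) :=
    ⟨IsPoly.comp h fun j => (pc (x j)).add (p1.mul ((p0.mul (pc (f j))).add (pc (g j)))),
      ![ρ', b'], by simpa using hρ'⟩
  have n4 : NZ (fun a : Fin 2 → k => a 0) := ⟨p0, fun _ => 1, one_ne_zero⟩
  obtain ⟨-, a, ha⟩ := (n1.mul n2).mul (n3.mul n4)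
  simp only [mul_ne_zero_iff] at ha
  obtain ⟨⟨r1, r2⟩, r3, r4⟩ := ha
  generalize a 0 = ρ at r1 r2 r3 r4
  generalize a 1 = b at r3
  obtain ⟨s, hs⟩ := IsAlgClosed.exists_pow_nat_eq (i * ρ) (n := 2) (by norm_num)
  have hs0 : s ≠ 0 := by
    rintro rfl
    apply mul_ne_zero hi0 r4
    rw [← hs]; ring
  have ey : (s / 2) • f + (s⁻¹ / 2) • g = (s⁻¹ / 2) • ((i * ρ) • f + g) := by
    rw [← hs, smul_add, smul_smul, show s⁻¹ / 2 * s ^ 2 = s / 2 by field_simp]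
  have ez : (s / (2 * i)) • f - (s⁻¹ / (2 * i)) • g = (s⁻¹ / (2 * i)) • ((i * ρ) • f - g) := by
    rw [← hs, smul_sub, smul_smul, show s⁻¹ / (2 * i) * s ^ 2 = s / (2 * i) by field_simp]
  refine ⟨(s / 2) • f + (s⁻¹ / 2) • g, (s / (2 * i)) • f - (s⁻¹ / (2 * i)) • g,
    b * (2 * s / (1 + i)), s⁻¹, s, i, inv_mul_cancel₀ hs0, hi, ?_, ?_, ?_, ?_, ?_⟩
  · funext j
    simp only [Pi.add_apply, Pi.sub_apply, Pi.smul_apply, smul_eq_mul]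
    field_simp
    ring
  · funext j
    simp only [Pi.add_apply, Pi.sub_apply, Pi.smul_apply, smul_eq_mul]
    field_simp
    ring
  · rw [ey, eval_smul_homog hh]
    exact mul_ne_zero (pow_ne_zero _ (div_ne_zero (inv_ne_zero hs0) h20)) r1
  · rw [ez, eval_smul_homog hh]
    exact mul_ne_zero (pow_ne_zero _ (div_ne_zero (inv_ne_zero hs0) (mul_ne_zero h20 hi0))) r2
  · have : x + (b * (2 * s / (1 + i))) • ((s / 2) • f + (s⁻¹ / 2) • g
        + ((s / (2 * i)) • f - (s⁻¹ / (2 * i)) • g)) = x + b • (ρ • f + g) := by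
      funext j
      simp only [Pi.add_apply, Pi.sub_apply, Pi.smul_apply, smul_eq_mul]
      field_simp
      linear_combination b * (1 + i) * f j * hs - b * g j * hi
    rw [this]
    exact r3

lemma dec_nondeg [IsAlgClosed k] [CharZero k] (hIH0 : ∀ n' ≤ 2, Main k N 0 n') {t : ℕ}
    {W : Submodule k (Fin N → k)} (hfin : Module.finrank k W = 3) {F h : MvPolynomial (Fin N) k}
    (hF : F ∈ P 3 W) (hh : h.IsHomogeneous t) (hw : ∃ w ∈ W, eval w h ≠ 0) {a : Fin N → k}
    (hker : ∃ w ∈ W ⊓ kerv a, eval w h ≠ 0) (hDDD : D a (D a (D a F)) ≠ 0)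
    (hE : Ess 2 W (D a F)) : Dec (Good h W) 3 5 F := by
  have h20 : (2 : k) ≠ 0 := two_ne_zero
  have h30 : (3 : k) ≠ 0 := three_ne_zero
  obtain ⟨x0, hx0, hDx0⟩ := mem_P_one (D_mem_P (d := 1) a hE.1)
  have hax0 : a ⬝ᵥ x0 ≠ 0 := by
    intro h0
    apply hDDD
    rw [hDx0, D_linForm, h0, C_0]
  obtain ⟨x, c, hxW, hax, hc0, hDx⟩ : ∃ (x : Fin N → k) (c : k), x ∈ W ∧ a ⬝ᵥ x = 1 ∧ c ≠ 0 ∧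
      D a (D a F) = (2 * c) • linForm x := by
    refine ⟨(a ⬝ᵥ x0)⁻¹ • x0, (a ⬝ᵥ x0) / 2, W.smul_mem _ hx0, ?_, div_ne_zero hax0 h20, ?_⟩
    · rw [dotProduct_smul, smul_eq_mul, inv_mul_cancel₀ hax0]
    · rw [hDx0, linForm_smul, smul_smul, show 2 * (a ⬝ᵥ x0 / 2) * (a ⬝ᵥ x0)⁻¹ = 1 by field_simp,
        one_smul]
  have hDX : D a (linForm x) = 1 := by rw [D_linForm, hax, C_1]
  have hQ0 : D a (D a F - c • linForm x ^ 2) = 0 := by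
    rw [map_sub, D_smulF, hDx, D_pow a x 1, hax, smul_smul, pow_one]
    rw [show c * (((1 : ℕ) + 1 : k) * 1) = 2 * c by push_cast; ring, sub_self]
  have hQU : c⁻¹ • (D a F - c • linForm x ^ 2) ∈ P 2 (W ⊓ kerv a) :=
    Submodule.smul_mem _ _ (mem_P_kerv (sub_mem hE.1 (Submodule.smul_mem _ _ (pow_mem_P hxW 2))) hQ0)
  have hlt : W ⊓ kerv a < W := by
    refine lt_of_le_of_ne inf_le_left fun heq => one_ne_zero (α := k) ?_
    rw [← hax]
    rw [← heq] at hxW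
    exact (Submodule.mem_inf.mp hxW).2
  have hfinU := Submodule.finrank_lt_finrank_of_lt hlt
  obtain ⟨f, hf, g, hg, hfg⟩ := quad_factor hIH0 (by omega) hQU
  rw [inv_smul_eq_iff₀ hc0, sub_eq_iff_eq_add, ← smul_add] at hfg
  have haf : a ⬝ᵥ f = 0 := (Submodule.mem_inf.mp hf).2
  have hag : a ⬝ᵥ g = 0 := (Submodule.mem_inf.mp hg).2
  have hfW := (Submodule.mem_inf.mp hf).1
  have hgW := (Submodule.mem_inf.mp hg).1
  -- the three forms span
  have hspan : ∀ v ∈ W, ∃ α β γ : k, v = α • x + β • f + γ • g := by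
    have hle : Submodule.span k {x, f, g} ≤ W := by
      rw [Submodule.span_le]
      rintro v (rfl | rfl | rfl)
      · exact hxW
      · exact hfW
      · exact hgW
    have heq : Submodule.span k {x, f, g} = W := by
      by_contra hne
      refine hE.2 _ (lt_of_le_of_ne hle hne) ?_
      rw [hfg]
      refine Submodule.smul_mem _ _ (add_mem ?_ (pow_mem_P (Submodule.subset_span (by simp)) 2))
      refine mul_mem_P (d := 1) ?_ (Submodule.subset_span (by simp))
      simpa using pow_mem_P (W := Submodule.span k {x, f, g}) (l := f)
        (Submodule.subset_span (by simp)) 1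
    intro v hv
    rw [← heq, Submodule.mem_span_triple] at hv
    obtain ⟨α, β, γ, hv⟩ := hv
    exact ⟨α, β, γ, hv.symm⟩
  have hspanU : ∀ v ∈ W ⊓ kerv a, ∃ β γ : k, v = β • f + γ • g := by
    intro v hv
    obtain ⟨hvW, hva⟩ := Submodule.mem_inf.mp hv
    obtain ⟨α, β, γ, rfl⟩ := hspan v hvW
    rw [mem_kerv, dotProduct_add, dotProduct_add, dotProduct_smul, dotProduct_smul, dotProduct_smul,
      hax, haf, hag] at hva
    have hα : α = 0 := by simpa using hva
    exact ⟨β, γ, by rw [hα, zero_smul, zero_add]⟩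
  obtain ⟨y, z, t0, μ, ν, i, hμν, hi, rfl, rfl, hy, hz, hx⟩ := exists_coords hh (x := x) (f := f) (g := g)
    (by
      obtain ⟨w, hw, hwh⟩ := hker
      obtain ⟨β, γ, rfl⟩ := hspanU w hw
      exact ⟨β, γ, hwh⟩)
    (by
      obtain ⟨w, hw, hwh⟩ := hw
      obtain ⟨α, β, γ, rfl⟩ := hspan w hw
      exact ⟨α, β, γ, hwh⟩)
  have hμ0 : μ ≠ 0 := left_ne_zero_of_mul (hμν ▸ one_ne_zero)
  have hν0 : ν ≠ 0 := right_ne_zero_of_mul (hμν ▸ one_ne_zero)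
  have hi0 : i ≠ 0 := by
    rintro rfl
    norm_num at hi
  have hyp : y + i • z ∈ W := (W.smul_mem_iff hμ0).mp hfW
  have hym : y - i • z ∈ W := (W.smul_mem_iff hν0).mp hgW
  have hyW : y ∈ W := by
    have := W.smul_mem (2 : k)⁻¹ (add_mem hyp hym)
    rwa [show y + i • z + (y - i • z) = (2 : k) • y by module, inv_smul_smul₀ h20] at this
  have hzW : z ∈ W := by
    have := W.smul_mem (2 * i)⁻¹ (sub_mem hyp hym)
    rwa [show y + i • z - (y - i • z) = (2 * i : k) • z by module,
      inv_smul_smul₀ (mul_ne_zero h20 hi0)] at this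
  have hfgyz : linForm (μ • (y + i • z)) * linForm (ν • (y - i • z)) = linForm y ^ 2 + linForm z ^ 2 := by
    have hi' : (C i : MvPolynomial (Fin N) k) ^ 2 = -1 := by rw [← C_pow, hi, C_neg, C_1]
    have hμν' : (C μ : MvPolynomial (Fin N) k) * C ν = 1 := by rw [← C_mul, hμν, C_1]
    simp only [linForm_add, linForm_sub, linForm_smul, smul_eq_C_mul]
    linear_combination (linForm y ^ 2 - C i ^ 2 * linForm z ^ 2) * hμν' - linForm z ^ 2 * hi'
  rw [hfgyz] at hfg
  set R := linForm x ^ 3 + 3 * linForm x * (linForm y ^ 2 + linForm z ^ 2) with hR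
  have hYZ : D a (linForm y ^ 2 + linForm z ^ 2) = 0 := by
    rw [← hfgyz, Derivation.leibniz, D_linForm, D_linForm, haf, hag, C_0, smul_zero, smul_zero,
      add_zero]
  have hDR : D a R = (3 * c⁻¹) • D a F := by
    rw [hfg, smul_smul, mul_assoc, inv_mul_cancel₀ hc0, mul_one, hR, map_add, D_pow a x 2, hax,
      mul_assoc, show (3 : MvPolynomial (Fin N) k) = C 3 from rfl, ← smul_eq_C_mul, D_smulF,
      Derivation.leibniz, hYZ, hDX, smul_zero, zero_add, smul_eq_mul, mul_one]
    rw [mul_one, show ((2 : ℕ) + 1 : k) = 3 by push_cast; norm_num, ← smul_add, add_comm]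
  have hRW : R ∈ P 3 W := by
    have hX : linForm x ∈ P 1 W := by simpa using pow_mem_P hxW 1
    have h1 : linForm x * (linForm y ^ 2 + linForm z ^ 2) ∈ P 3 W := by
      rw [← hfgyz, ← mul_assoc]
      exact mul_mem_P (mul_mem_P hX hfW) hgW
    rw [hR, mul_assoc, show (3 : MvPolynomial (Fin N) k) = C 3 from rfl, ← smul_eq_C_mul]
    exact add_mem (pow_mem_P hxW 3) (Submodule.smul_mem _ _ h1)
  have hG : (3 * c⁻¹) • F - R ∈ P 3 (W ⊓ kerv a) := by
    refine mem_P_kerv (sub_mem (Submodule.smul_mem _ _ hF) hRW) ?_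
    rw [map_sub, D_smulF, hDR, sub_self]
  obtain ⟨d0, d1, d2, d3, hG⟩ := exists_bin (y := y) (z := z) (fun v hv => by
    obtain ⟨β, γ, rfl⟩ := hspanU v hv
    exact ⟨β * μ + γ * ν, β * μ * i - γ * ν * i, by module⟩) hG
  have hdec := dec_cubic hh hxW hyW hzW hy hz hx d0 d1 d2 d3
  rw [← hR, ← hG, add_sub_cancel] at hdec
  have h3c : 3 * c⁻¹ ≠ 0 := mul_ne_zero h30 (inv_ne_zero hc0)
  have := hdec.smul (inv_ne_zero h3c)
  rwa [inv_smul_smul₀ h3c] at this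

lemma main_cubic [IsAlgClosed k] [CharZero k] (hIH0 : ∀ n' ≤ 2, Main k N 0 n')
    (hIH1 : ∀ n' ≤ 2, Main k N 1 n') : Main k N 1 3 := by
  intro W hfin F hE h t hh hw
  have hF0 := hE.ne_zero (n := 2) hfin
  obtain ⟨Φ₁, hΦ₁, hker⟩ := generic_ker (n := 1) hfin hh hw
  obtain ⟨Φ₂, hΦ₂, hDDD⟩ := generic_DDD hE.1 hF0
  obtain ⟨Φ₃, hΦ₃, hkey⟩ := generic_key (e := 0) (n := 1) hfin hE hh hw
  obtain ⟨Φ₄, hΦ₄, hmin⟩ := generic_minor (n := 1) hfin hE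
  obtain ⟨-, a, ha⟩ := (hΦ₁.mul hΦ₂).mul (hΦ₃.mul hΦ₄)
  simp only [mul_ne_zero_iff] at ha
  obtain ⟨⟨ha1, ha2⟩, ha3, ha4⟩ := ha
  have hD3 := hDDD a ha2
  have hD2 : D a (D a F) ≠ 0 := fun h0 => hD3 (by rw [h0, map_zero])
  have hD1 : D a F ≠ 0 := fun h0 => hD2 (by rw [h0, map_zero])
  obtain ⟨W₁, hW₁, hE₁⟩ := exists_ess (D_mem_P (d := 2) a hE.1)
  have hle := Submodule.finrank_mono hW₁
  have hge := hmin a ha4 W₁ hE₁.1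
  rw [bd_three_one]
  by_cases h3 : Module.finrank k W₁ = 3
  · have heq : W₁ = W := Submodule.eq_of_le_of_finrank_eq hW₁ (by omega)
    rw [heq] at hE₁
    exact dec_nondeg hIH0 hfin hE.1 hh hw (hker a ha1) hD3 hE₁
  · have h2 : Module.finrank k W₁ = 2 := by omega
    have hg1 := hkey a ha3 W₁ hW₁ hE₁.1 h2
    have hg2 : ∃ w ∈ W₁, eval w (linForm a) ≠ 0 := by
      by_contra hcon
      push Not at hcon
      exact hD2 (D_eq_zero_of_mem (fun l hl => by rw [← eval_linForm]; exact hcon l hl) hE₁.1)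
    have hdec := (hIH0 2 le_rfl W₁ h2 _ hE₁ _ _ (hh.mul (linForm_isHomogeneous a))
      (exists_both hg1 hg2)).mono (Good_mono hW₁) le_rfl
    have := step (e := 1) (n := 2) hfin hE.1 hIH1 hh (hker a ha1) hdec hD1
    rwa [bd_n_zero, bd_two_one] at this

lemma main_all [IsAlgClosed k] [CharZero k] (e : ℕ) : ∀ n, Main k N e n := by
  induction e with
  | zero =>
    intro n
    induction n using Nat.strong_induction_on with
    | _ n ih =>
      match n with
      | 0 => exact main_zero 0
      | 1 => exact main_one 0
      | n + 2 => exact main_quad fun n' hn' => ih n' (by omega)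
  | succ e ihe =>
    intro n
    induction n using Nat.strong_induction_on with
    | _ n ih =>
      match n with
      | 0 => exact main_zero _
      | 1 => exact main_one _
      | n + 2 =>
        by_cases hne : n + 1 = 2 ∧ e = 0
        · obtain ⟨h1, rfl⟩ := hne
          obtain rfl : n = 1 := by omega
          exact main_cubic (fun n' _ => ihe n') fun n' hn' => ih n' (by omega)
        · exact main_succ hne (fun n' _ => ihe n') fun n' hn' => ih n' (by omega)

end Ternary



lemma ork_bound {k : Type} [Field k] [IsAlgClosed k] [CharZero k] {n e : ℕ}
    {F : MvPolynomial (Fin n) k} (hF : F.IsHomogeneous (e + 2)) (hE : EssDep F)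
    {V : Set (Fin n → k)} (hV : HomZariskiClosed V) (hV' : V ≠ Set.univ) :
    OrkV (e + 2) F V ≤ (bd n e : ℕ∞) := by
  obtain ⟨Q, hQ, rfl⟩ := hV
  obtain ⟨v, hv⟩ := (Set.ne_univ_iff_exists_notMem _).mp hV'
  obtain ⟨h, hhQ, hvh⟩ : ∃ h ∈ Q, eval v h ≠ 0 := by
    by_contra hcon
    push Not at hcon
    exact hv hcon
  obtain ⟨t, hh⟩ := hQ h hhQ
  have hEss : Ess (e + 2) (⊤ : Submodule k (Fin n → k)) F := by
    refine ⟨homog_mem_P hF, fun W' hW' hmem => ?_⟩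
    have hlt := Submodule.finrank_lt_finrank_of_lt hW'
    rw [finrank_top, Module.finrank_fin_fun] at hlt
    exact hE _ hlt (writable_of_mem_P hmem)
  have hdec := main_all (k := k) (N := n) e n ⊤ (by rw [finrank_top, Module.finrank_fin_fun]) F hEss
    h t hh ⟨v, Submodule.mem_top, hvh⟩
  obtain ⟨m', hm', l, hl, hsum⟩ := hdec.exists_sum hh (by omega)
  have h1 : OrkV (e + 2) F {a | ∀ p ∈ Q, eval a p = 0} ≤ (m' : ℕ∞) := by
    refine sInf_le ⟨m', ⟨l, fun i hi => hl i (hi h hhQ), hsum⟩, rfl⟩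
  exact h1.trans (by exact_mod_cast hm')


end Waring


/-- For all integers `n ≥ 3` and `d ≥ 3`, the open Waring rank satisfies
`Ork(n, d) ≤ binom(n+d-2, d-1) − binom(n+d-6, d-3)`. -/
theorem stmt_5 (k : Type) [Field k] [IsAlgClosed k] [CharZero k]
    (n d : ℕ) (hn : 3 ≤ n) (hd : 3 ≤ d) :
    OrkND k n d ≤ (((n + d - 2).choose (d - 1) - (n + d - 6).choose (d - 3) : ℕ) : ℕ∞) := by
  obtain ⟨n, rfl⟩ := Nat.exists_eq_add_of_le' hn
  obtain ⟨e, rfl⟩ := Nat.exists_eq_add_of_le' hd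
  have hb := Waring.bd_closed n e
  have h1 : n + 3 + (e + 3) - 2 = n + e + 4 := by omega
  have h2 : e + 3 - 1 = e + 2 := by omega
  have h3 : n + 3 + (e + 3) - 6 = n + e := by omega
  have h4 : e + 3 - 3 = e := by omega
  rw [h1, h2, h3, h4, ← hb, Nat.add_sub_cancel]
  refine iSup_le fun F => iSup_le fun V => ?_
  exact Waring.ork_bound (e := e + 1) F.2.1 F.2.2 V.2.1 V.2.2
end
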